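/- Let (W, S) be a Coxeter system, v ∈ W, and ψ : [e, v]_W → [e, v′]_{W′} a poset isomorphism between lower Bruhat intervals of two Coxeter groups. Then ψ preserves Kazhdan–Lusztig polynomials: P_{x,y} = P_{ψ(x),ψ(y)} for all x ≤ y in [e, v], and equivalently preserves R-polynomials: R_{x,y} = R_{ψ(x),ψ(y)}. -/

import Mathlib

open CoxeterSystem Polynomial

section CoxPre

variable {B : Type*} {W : Type*} [Group W] {M : CoxeterMatrix B}

/-- The alternating word of length `n` starting with the letter `i`
(and then alternating between `i` and `j`). -/
def altW (i j : B) : ℕ → List B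
  | 0 => []
  | n + 1 => i :: altW j i n

variable (cs : CoxeterSystem M W)

/-- The Bruhat order on a Coxeter group: the reflexive-transitive closure of the
relation `u → u * t` (`t` a reflection) when the length goes up. -/
def bruhatLE : W → W → Prop :=
  Relation.ReflTransGen
    (fun u v => ∃ t, cs.IsReflection t ∧ v = u * t ∧ cs.length u < cs.length v)

/-- The covering relation of the Bruhat order. -/
def bCov (u v : W) : Prop :=
  bruhatLE cs u v ∧ u ≠ v ∧ ∀ z, bruhatLE cs u z → bruhatLE cs z v → z = u ∨ z = v

/-- The set of coatoms of `v` in the Bruhat order. -/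
def bCoat (v : W) : Set W := {x | bCov cs x v}

/-- A partial special matching of `W` equipped with the Bruhat order: a Bruhat order
ideal `dom` together with an involution of it such that `u ⋖ φ u` or `φ u ⋖ u` for all
`u ∈ dom`, satisfying the coatom condition. -/
structure BSM where
  dom : Set W
  toFun : W → W
  ideal : ∀ ⦃x y : W⦄, y ∈ dom → bruhatLE cs x y → x ∈ dom
  maps : ∀ x ∈ dom, toFun x ∈ dom
  invol : ∀ x ∈ dom, toFun (toFun x) = x
  cov : ∀ x ∈ dom, bCov cs (toFun x) x ∨ bCov cs x (toFun x)
  coatom : ∀ u ∈ dom, bCov cs u (toFun u) →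
    bCoat cs (toFun u) =
      {u} ∪ {w | ∃ v, bCov cs v u ∧ bCov cs v (toFun v) ∧ w = toFun v}

/-- The standard dihedral subgroup `⟨s,t⟩` of `W`, as a set. -/
def dihedral (s t : B) : Set W :=
  (Subgroup.closure {cs.simple s, cs.simple t} : Subgroup W)

/-- `w` is full with respect to `J ⊆ S`: for all distinct `i, j ∈ J`, `m i j < ∞` and the
longest element of `⟨i,j⟩` is `≤ w` in Bruhat order. -/
def IsFullWrt (J : Set B) (w : W) : Prop :=
  ∀ i ∈ J, ∀ j ∈ J, i ≠ j →
    M i j ≠ 0 ∧ bruhatLE cs (cs.wordProd (altW i j (M i j))) w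

/-- The standard axioms characterizing the `R`-polynomials of the Hecke algebra of `W`. -/
def RAxioms (R : W → W → Polynomial ℤ) : Prop :=
  (∀ u, R u u = 1) ∧
  (∀ u v, ¬ bruhatLE cs u v → R u v = 0) ∧
  (∀ (i : B) (x y : W),
      cs.length (cs.simple i * x) = cs.length x + 1 →
      cs.length (cs.simple i * y) = cs.length y + 1 →
      R (cs.simple i * x) (cs.simple i * y) = R x y ∧
      R x (cs.simple i * y) = (X - 1) * R x y + X * R (cs.simple i * x) y) ∧
  (∀ (i : B) (x y : W),
      cs.length (x * cs.simple i) = cs.length x + 1 →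
      cs.length (y * cs.simple i) = cs.length y + 1 →
      R (x * cs.simple i) (y * cs.simple i) = R x y ∧
      R x (y * cs.simple i) = (X - 1) * R x y + X * R (x * cs.simple i) y)

variable {cs}

/-- `ψ` extends the partial special matching `φ`. -/
def BExtends (ψ φ : BSM cs) : Prop :=
  φ.dom ⊆ ψ.dom ∧ ∀ x ∈ φ.dom, ψ.toFun x = φ.toFun x

/-- `φ` is a maximal partial special matching. -/
def BMax (φ : BSM cs) : Prop := ∀ ψ : BSM cs, BExtends ψ φ → ψ.dom = φ.dom

/-- `φ` is `g`-regular on the left: its domain is stable under left multiplication by `g`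
and `φ` commutes with left multiplication by `g`. -/
def LeftReg (φ : BSM cs) (g : W) : Prop :=
  (∀ x ∈ φ.dom, g * x ∈ φ.dom) ∧ ∀ x ∈ φ.dom, φ.toFun (g * x) = g * φ.toFun x

/-- `φ` is `g`-regular on the right. -/
def RightReg (φ : BSM cs) (g : W) : Prop :=
  (∀ x ∈ φ.dom, x * g ∈ φ.dom) ∧ ∀ x ∈ φ.dom, φ.toFun (x * g) = φ.toFun x * g

end CoxPre
/-- The defining axioms of the Kazhdan–Lusztig polynomials `P` in terms of the
`R`-polynomials: `P_{u,u} = 1`, `P_{u,w} = 0` unless `u ≤ w`, the degree bound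
`deg P_{u,w} ≤ (ℓ(w) - ℓ(u) - 1)/2` for `u < w`, and the functional equation
`q^{ℓ(w)-ℓ(u)} P_{u,w}(q⁻¹) = ∑_{u ≤ z ≤ w} R_{u,z} P_{z,w}` (stated in the ring of
Laurent polynomials). -/
def KLAxioms {B : Type*} {W : Type*} [Group W] {M : CoxeterMatrix B}
    (cs : CoxeterSystem M W)
    (hfin : ∀ u w : W, {z : W | bruhatLE cs u z ∧ bruhatLE cs z w}.Finite)
    (R P : W → W → Polynomial ℤ) : Prop :=
  (∀ u, P u u = 1) ∧
  (∀ u w, ¬ bruhatLE cs u w → P u w = 0) ∧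
  (∀ u w, bruhatLE cs u w → u ≠ w →
    2 * (P u w).natDegree < cs.length w - cs.length u) ∧
  (∀ u w, bruhatLE cs u w →
    LaurentPolynomial.T (R := ℤ) ((cs.length w - cs.length u : ℕ) : ℤ) *
        Polynomial.aeval (LaurentPolynomial.T (R := ℤ) (-1)) (P u w) =
      ∑ z ∈ (hfin u w).toFinset,
        Polynomial.toLaurent (R u z) * Polynomial.toLaurent (P z w))

namespace CoxeterSystem
section

variable {B : Type*} {W : Type*} [Group W] {M : CoxeterMatrix B} (cs : CoxeterSystem M W)

local prefix:100 "ℓ" => cs.length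
local infix:50 " ≼ " => bruhatLE cs

section

local prefix:100 "s" => cs.simple
local prefix:100 "π" => cs.wordProd
local prefix:100 "ris" => cs.rightInvSeq
open Classical in
/-- The permutation of `W × ℤ/2` attached to a simple reflection. -/
noncomputable def signedConj (i : B) : Equiv.Perm (W × ZMod 2) where
  toFun p := (s i * p.1 * s i, p.2 + if p.1 = s i then 1 else 0)
  invFun p := (s i * p.1 * s i, p.2 + if p.1 = s i then 1 else 0)
  left_inv p := by
    have h : s i * p.1 * s i = s i ↔ p.1 = s i := by
      constructor
      · intro h
        have := congrArg (fun x => s i * x * s i) h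
        simpa [mul_assoc] using this
      · intro h; simp [h]
    ext
    · simp [mul_assoc]
    · simp only [h, add_assoc, CharTwo.add_self_eq_zero, add_zero]
  right_inv p := by
    have h : s i * p.1 * s i = s i ↔ p.1 = s i := by
      constructor
      · intro h
        have := congrArg (fun x => s i * x * s i) h
        simpa [mul_assoc] using this
      · intro h; simp [h]
    ext
    · simp [mul_assoc]
    · simp only [h, add_assoc, CharTwo.add_self_eq_zero, add_zero]

open Classical in
theorem signedConj_apply (i : B) (p : W × ZMod 2) :
    cs.signedConj i p = (s i * p.1 * s i, p.2 + if p.1 = s i then 1 else 0) := rfl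

open Classical in
theorem signedConj_mul_pow (i j : B) (n : ℕ) (p : W × ZMod 2) :
    ((cs.signedConj i * cs.signedConj j) ^ n) p =
      ((s i * s j) ^ n * p.1 * ((s i * s j) ^ n)⁻¹,
        p.2 + ∑ q ∈ Finset.range (2 * n),
          if p.1 = ((s i * s j) ^ q)⁻¹ * s j then 1 else 0) := by
  induction n generalizing p with
  | zero => simp
  | succ n ih =>
    set a := s i * s j with ha
    have hb : s j * s j = 1 := cs.simple_mul_simple_self j
    have hba : SemiconjBy (s j) a a⁻¹ := by
      simp [SemiconjBy, ha, mul_assoc]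
    have hflip : ∀ q : ℕ, s j * a ^ q = (a ^ q)⁻¹ * s j := by
      intro q
      have := hba.pow_right q
      rwa [inv_pow] at this
    have hsi : s i = a * s j := by simp [ha]
    have h1 : a ^ n * p.1 * (a ^ n)⁻¹ = s j ↔ p.1 = (a ^ (2 * n))⁻¹ * s j := by
      rw [mul_inv_eq_iff_eq_mul, hflip, ← eq_inv_mul_iff_mul_eq, ← mul_assoc, ← mul_inv_rev,
        ← pow_add, two_mul]
    have h2 : s j * (a ^ n * p.1 * (a ^ n)⁻¹) * s j = s i ↔
        p.1 = (a ^ (2 * n + 1))⁻¹ * s j := by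
      rw [hsi, mul_left_inj, ← eq_inv_mul_iff_mul_eq, cs.inv_simple, mul_inv_eq_iff_eq_mul,
        hba.eq, mul_assoc, hflip, ← eq_inv_mul_iff_mul_eq, ← mul_assoc, ← mul_assoc,
        ← mul_inv_rev, ← mul_inv_rev, ← pow_succ', ← pow_add]
      rw [show n + (n + 1) = 2 * n + 1 by ring]
    rw [pow_succ', Equiv.Perm.mul_apply, ih, Equiv.Perm.mul_apply, signedConj_apply,
      signedConj_apply]
    ext
    · simp only [hsi, pow_succ', mul_inv_rev, mul_assoc]
      simp [ha, mul_assoc]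
    · simp only [h1, h2]
      rw [show 2 * (n + 1) = 2 * n + 1 + 1 by ring, Finset.sum_range_succ,
        Finset.sum_range_succ]
      ring

theorem signedConj_isLiftable : M.IsLiftable cs.signedConj := by
  classical
  intro i j
  ext1 p
  rw [signedConj_mul_pow, cs.simple_mul_simple_pow, two_mul, Finset.sum_range_add]
  have : ∀ q, (s i * s j) ^ (M i j + q) = (s i * s j) ^ q := by
    intro q
    rw [pow_add, cs.simple_mul_simple_pow, one_mul]
  simp only [this, CharTwo.add_self_eq_zero]
  simp

/-- The action of `W` on `W × ℤ/2` used for the strong exchange condition. -/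
noncomputable def signedAction : W →* Equiv.Perm (W × ZMod 2) :=
  cs.lift ⟨cs.signedConj, cs.signedConj_isLiftable⟩

theorem signedAction_simple (i : B) : cs.signedAction (s i) = cs.signedConj i :=
  cs.lift_apply_simple cs.signedConj_isLiftable i

open Classical in
theorem signedAction_wordProd (ω : List B) (p : W × ZMod 2) :
    cs.signedAction (π ω) p = (π ω * p.1 * (π ω)⁻¹, p.2 + ((ris ω).count p.1 : ZMod 2)) := by
  induction ω generalizing p with
  | nil => simp
  | cons i ω ih =>
    have h : π ω * p.1 * (π ω)⁻¹ = s i ↔ (π ω)⁻¹ * s i * π ω = p.1 := by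
      rw [mul_inv_eq_iff_eq_mul, ← eq_inv_mul_iff_mul_eq, mul_assoc, eq_comm]
    rw [wordProd_cons, map_mul, Equiv.Perm.mul_apply, ih, signedAction_simple, signedConj_apply]
    ext
    · simp [mul_assoc]
    · simp only [h, rightInvSeq, List.count_cons, beq_iff_eq]
      push_cast
      ring

theorem signedAction_add (w t : W) (a b : ZMod 2) :
    cs.signedAction w (t, a + b) =
      ((cs.signedAction w (t, a)).1, (cs.signedAction w (t, a)).2 + b) := by
  obtain ⟨ω, rfl⟩ := cs.wordProd_surjective w
  simp only [signedAction_wordProd]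
  ext
  · rfl
  · simp only; ring

theorem signedAction_reflection {t : W} (ht : cs.IsReflection t) (a : ZMod 2) :
    cs.signedAction t (t, a) = (t, a + 1) := by
  classical
  obtain ⟨g, i, rfl⟩ := ht
  set t := g * s i * g⁻¹ with htd
  have h1 : (cs.signedAction g⁻¹ (t, a)).1 = s i := by
    obtain ⟨ω, hω⟩ := cs.wordProd_surjective g⁻¹
    rw [← hω, signedAction_wordProd, hω]
    simp [htd, mul_assoc]
  obtain ⟨c, hc⟩ : ∃ c, cs.signedAction g⁻¹ (t, a) = (s i, c) := ⟨_, Prod.ext h1 rfl⟩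
  have h2 : cs.signedAction g (s i, c) = (t, a) := by
    rw [← hc, ← Equiv.Perm.mul_apply, ← map_mul]; simp
  have : cs.signedAction t (t, a) =
      cs.signedAction g (cs.signedAction (s i) (cs.signedAction g⁻¹ (t, a))) := by
    rw [htd, map_mul, map_mul]; rfl
  rw [this, hc, signedAction_simple, signedConj_apply]
  simp only [cs.simple_mul_simple_self, one_mul, if_true]
  rw [signedAction_add, h2]

/-- The strong exchange condition. -/
theorem exists_eraseIdx_of_isReflection {w t : W} (ht : cs.IsReflection t)
    (hlt : ℓ (w * t) < ℓ w) (ω : List B) (hω : π ω = w) :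
    ∃ j < ω.length, w * t = π (ω.eraseIdx j) := by
  classical
  have hmem : t ∈ ris ω := by
    by_contra hn
    have h0 : (ris ω).count t = 0 := List.count_eq_zero.2 hn
    have h1 : cs.signedAction w (t, 1) = (w * t * w⁻¹, 1) := by
      rw [← hω, signedAction_wordProd, h0]; simp
    have h2 : (cs.signedAction (w * t) (t, 0)).2 = 1 := by
      rw [map_mul, Equiv.Perm.mul_apply, cs.signedAction_reflection ht, zero_add, h1]
    obtain ⟨ω', hr, hω'⟩ := cs.exists_isReduced (w * t)
    rw [hω', signedAction_wordProd] at h2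
    have h3 : t ∈ ris ω' := by
      by_contra h3
      rw [List.count_eq_zero.2 h3] at h2
      simp at h2
    have h4 := (cs.isRightInversion_of_mem_rightInvSeq hr h3).2
    rw [← hω', mul_assoc, ht.mul_self, mul_one] at h4
    omega
  obtain ⟨j, hj, hjt⟩ := List.mem_iff_getElem.1 hmem
  refine ⟨j, by simpa using hj, ?_⟩
  rw [← cs.wordProd_mul_getD_rightInvSeq, hω, List.getD_eq_getElem _ _ hj, hjt]

end

section

variable {cs}

theorem letter_mul_self {k : W} (hk : ℓ k = 1) : k * k = 1 := by
  obtain ⟨i, rfl⟩ := cs.length_eq_one_iff.1 hk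
  simp

theorem letter_inv {k : W} (hk : ℓ k = 1) : k⁻¹ = k :=
  inv_eq_of_mul_eq_one_right (letter_mul_self hk)

theorem letter_mul_cancel_left {k : W} (hk : ℓ k = 1) (u : W) : k * (k * u) = u := by
  rw [← mul_assoc, letter_mul_self hk, one_mul]

theorem letter_mul_cancel_right {k : W} (hk : ℓ k = 1) (u : W) : u * k * k = u := by
  rw [mul_assoc, letter_mul_self hk, mul_one]

theorem letter_isReflection {k : W} (hk : ℓ k = 1) : cs.IsReflection k := by
  obtain ⟨i, rfl⟩ := cs.length_eq_one_iff.1 hk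
  exact cs.isReflection_simple i

theorem letter_ne_one {k : W} (hk : ℓ k = 1) : k ≠ 1 := by
  rintro rfl; simp at hk

theorem length_letter_mul {k : W} (hk : ℓ k = 1) (u : W) :
    ℓ (k * u) = ℓ u + 1 ∨ ℓ (k * u) + 1 = ℓ u := by
  obtain ⟨i, rfl⟩ := cs.length_eq_one_iff.1 hk
  exact cs.length_simple_mul u i

theorem length_mul_letter {k : W} (hk : ℓ k = 1) (u : W) :
    ℓ (u * k) = ℓ u + 1 ∨ ℓ (u * k) + 1 = ℓ u := by
  obtain ⟨i, rfl⟩ := cs.length_eq_one_iff.1 hk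
  exact cs.length_mul_simple u i

theorem exists_left_descent {u : W} (hu : u ≠ 1) : ∃ k, ℓ k = 1 ∧ ℓ (k * u) < ℓ u := by
  obtain ⟨i, hi⟩ := cs.exists_leftDescent_of_ne_one hu
  exact ⟨_, cs.length_simple i, hi⟩

theorem exists_right_descent {u : W} (hu : u ≠ 1) : ∃ k, ℓ k = 1 ∧ ℓ (u * k) < ℓ u := by
  obtain ⟨i, hi⟩ := cs.exists_rightDescent_of_ne_one hu
  exact ⟨_, cs.length_simple i, hi⟩

/-- Induction on the length, removing a letter on the left. -/
theorem left_induction {p : W → Prop} (h1 : p 1)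
    (hs : ∀ k u, ℓ k = 1 → ℓ (k * u) = ℓ u + 1 → p u → p (k * u)) (u : W) : p u := by
  induction hn : ℓ u using Nat.strong_induction_on generalizing u with
  | _ n ih =>
    by_cases hu : u = 1
    · rwa [hu]
    · obtain ⟨k, hk, hku⟩ := exists_left_descent (cs := cs) hu
      have := hs k (k * u) hk
      rw [letter_mul_cancel_left hk] at this
      rcases length_letter_mul hk u with h | h
      · omega
      · exact this (by omega) (ih _ (by omega) _ rfl)

/-- Induction on the length, removing a letter on the right. -/
theorem right_induction {p : W → Prop} (h1 : p 1)
    (hs : ∀ k u, ℓ k = 1 → ℓ (u * k) = ℓ u + 1 → p u → p (u * k)) (u : W) : p u := by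
  have := left_induction (cs := cs) (p := fun u => p u⁻¹) (by simpa) (by
    intro k u hk h hp
    rw [mul_inv_rev, letter_inv hk]
    refine hs k _ hk ?_ hp
    rw [← cs.length_inv, mul_inv_rev, letter_inv hk, inv_inv, h, cs.length_inv]) u⁻¹
  simpa using this

theorem exists_prefix_of_isReflection {w t : W} (ht : cs.IsReflection t)
    (hlt : ℓ (w * t) < ℓ w) :
    ∃ a p b, ℓ p = 1 ∧ w = a * p * b ∧ ℓ w = ℓ a + 1 + ℓ b ∧ w * t = a * b := by
  obtain ⟨ω, hr, hω⟩ := cs.exists_isReduced w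
  obtain ⟨j, hj, he⟩ := cs.exists_eraseIdx_of_isReflection ht hlt ω hω.symm
  have hsplit : ω = ω.take j ++ ω[j] :: ω.drop (j + 1) := by
    rw [List.getElem_cons_drop, List.take_append_drop]
  have hw : w = cs.wordProd (ω.take j) * cs.simple ω[j] * cs.wordProd (ω.drop (j + 1)) := by
    conv_lhs => rw [hω, hsplit]
    rw [wordProd_append, wordProd_cons, mul_assoc]
  refine ⟨_, _, _, cs.length_simple _, hw, ?_, ?_⟩
  · have h1 := cs.length_wordProd_le (ω.take j)
    have h2 := cs.length_wordProd_le (ω.drop (j + 1))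
    have h3 : ℓ w = ω.length := by rw [hω]; exact hr
    have h4 := cs.length_mul_le (cs.wordProd (ω.take j) * cs.simple ω[j])
      (cs.wordProd (ω.drop (j + 1)))
    have h5 := cs.length_mul_le (cs.wordProd (ω.take j)) (cs.simple ω[j])
    rw [← hw] at h4
    rw [cs.length_simple] at h5
    simp only [List.length_take, List.length_drop] at h1 h2
    omega
  · rw [he, List.eraseIdx_eq_take_drop_succ, wordProd_append]

theorem bruhatLE_refl (u : W) : u ≼ u := Relation.ReflTransGen.refl

theorem _root_.bruhatLE.trans {u w z : W} (h : u ≼ w) (h' : w ≼ z) : u ≼ z :=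
  Relation.ReflTransGen.trans h h'

theorem bruhatLE_of_reflection {u t : W} (ht : cs.IsReflection t) (h : ℓ u < ℓ (u * t)) :
    u ≼ u * t := Relation.ReflTransGen.single ⟨t, ht, rfl, h⟩

theorem bruhatLE_of_reflection_left {u t : W} (ht : cs.IsReflection t) (h : ℓ u < ℓ (t * u)) :
    u ≼ t * u := by
  have h2 : t * u = u * (u⁻¹ * t * u) := by group
  have h3 : cs.IsReflection (u⁻¹ * t * u) := by
    have := ht.conj u⁻¹
    simpa using this
  rw [h2] at h ⊢
  exact bruhatLE_of_reflection h3 h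

theorem length_le_of_bruhatLE {u w : W} (h : u ≼ w) : ℓ u ≤ ℓ w := by
  induction h with
  | refl => rfl
  | tail _ h ih => obtain ⟨t, _, _, h⟩ := h; omega

theorem eq_of_bruhatLE_of_length {u w : W} (h : u ≼ w) (hl : ℓ w ≤ ℓ u) : u = w := by
  rcases Relation.ReflTransGen.cases_tail h with h | ⟨z, hz, t, _, _, h3⟩
  · exact h.symm
  · have := length_le_of_bruhatLE hz
    omega

theorem bruhatLE_antisymm {u w : W} (h : u ≼ w) (h' : w ≼ u) : u = w :=
  eq_of_bruhatLE_of_length h (length_le_of_bruhatLE h')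

theorem length_lt_of_bruhatLE {u w : W} (h : u ≼ w) (hne : u ≠ w) : ℓ u < ℓ w := by
  by_contra hc
  exact hne (eq_of_bruhatLE_of_length h (by omega))

theorem inv_bruhatLE_inv {u w : W} (h : u ≼ w) : u⁻¹ ≼ w⁻¹ := by
  induction h with
  | refl => exact bruhatLE_refl _
  | tail _ h ih =>
    obtain ⟨t, ht, rfl, h⟩ := h
    refine ih.trans ?_
    rw [mul_inv_rev, ht.inv]
    refine bruhatLE_of_reflection_left ht ?_
    rwa [← ht.inv, ← mul_inv_rev, cs.length_inv, cs.length_inv]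

theorem inv_bruhatLE_inv_iff {u w : W} : u⁻¹ ≼ w⁻¹ ↔ u ≼ w :=
  ⟨fun h => by simpa using inv_bruhatLE_inv h, inv_bruhatLE_inv⟩

theorem le_letter_mul {k u : W} (hk : ℓ k = 1) (h : ℓ u < ℓ (k * u)) : u ≼ k * u :=
  bruhatLE_of_reflection_left (letter_isReflection hk) h

theorem le_mul_letter {k u : W} (hk : ℓ k = 1) (h : ℓ u < ℓ (u * k)) : u ≼ u * k :=
  bruhatLE_of_reflection (letter_isReflection hk) h

theorem letter_mul_le {k u : W} (hk : ℓ k = 1) (h : ℓ (k * u) < ℓ u) : k * u ≼ u := by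
  have := le_letter_mul (u := k * u) hk (by rwa [letter_mul_cancel_left hk])
  rwa [letter_mul_cancel_left hk] at this

theorem mul_letter_le {k u : W} (hk : ℓ k = 1) (h : ℓ (u * k) < ℓ u) : u * k ≼ u := by
  have := le_mul_letter (u := u * k) hk (by rwa [letter_mul_cancel_right hk])
  rwa [letter_mul_cancel_right hk] at this

/-- Left multiplication by a letter maps an edge of the Bruhat graph to an edge, unless the
edge is the multiplication by that letter. -/
theorem letter_mul_edge {k x t : W} (hk : ℓ k = 1) (ht : cs.IsReflection t)
    (h : ℓ x < ℓ (x * t)) (hne : x * t ≠ k * x) : ℓ (k * x) < ℓ (k * x * t) := by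
  by_contra hc
  have hodd := ht.length_mul_left_ne (k * x)
  have hlt : ℓ (k * x * t) < ℓ (k * x) := by
    rcases lt_trichotomy (ℓ (k * x * t)) (ℓ (k * x)) with h' | h' | h'
    · exact h'
    · exact absurd h' hodd
    · omega
  obtain ⟨ω, hr, hω⟩ := cs.exists_isReduced x
  obtain ⟨i, rfl⟩ := cs.length_eq_one_iff.1 hk
  obtain ⟨j, hj, he⟩ := cs.exists_eraseIdx_of_isReflection ht hlt (i :: ω)
    (by rw [wordProd_cons, ← hω])
  cases j with
  | zero =>
    apply hne
    simp only [List.eraseIdx_zero, List.tail_cons, ← hω] at he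
    calc x * t = cs.simple i * (cs.simple i * x * t) := by simp [mul_assoc]
      _ = _ := by rw [he]
  | succ j =>
    rw [List.eraseIdx_cons_succ, wordProd_cons, mul_assoc, mul_right_inj] at he
    have h1 := cs.length_wordProd_le (ω.eraseIdx j)
    rw [← he, List.length_eraseIdx] at h1
    have h2 : ℓ x = ω.length := by rw [hω]; exact hr
    simp only [List.length_cons] at hj
    split_ifs at h1 <;> omega

theorem letter_mul_le_or {k x y : W} (hk : ℓ k = 1) (h : x ≼ y) :
    k * x ≼ y ∨ k * x ≼ k * y := by
  induction h using Relation.ReflTransGen.head_induction_on with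
  | refl => exact Or.inr (bruhatLE_refl _)
  | @head a _ h h' ih =>
    obtain ⟨t, ht, rfl, h⟩ := h
    by_cases hne : a * t = k * a
    · left; rw [← hne]; exact h'
    · have := letter_mul_edge hk ht h hne
      have h2 := bruhatLE_of_reflection ht this
      rw [mul_assoc] at h2
      exact ih.imp h2.trans h2.trans

theorem le_letter_mul_or {k x y : W} (hk : ℓ k = 1) (h : x ≼ y) :
    x ≼ k * y ∨ k * x ≼ k * y := by
  induction h with
  | refl => exact Or.inr (bruhatLE_refl _)
  | tail h' h ih =>
    rename_i b c
    obtain ⟨t, ht, rfl, h⟩ := h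
    by_cases hne : b * t = k * b
    · left; rw [hne, letter_mul_cancel_left hk]; exact h'
    · have := letter_mul_edge hk ht h hne
      have h2 := bruhatLE_of_reflection ht this
      rw [mul_assoc] at h2
      exact ih.imp (fun h => h.trans h2) (fun h => h.trans h2)

theorem inv_letter_mul {k : W} (hk : ℓ k = 1) (u : W) : (k * u)⁻¹ = u⁻¹ * k := by
  rw [mul_inv_rev, letter_inv hk]

theorem inv_mul_letter {k : W} (hk : ℓ k = 1) (u : W) : (u * k)⁻¹ = k * u⁻¹ := by
  rw [mul_inv_rev, letter_inv hk]

theorem length_letter_mul_inv {k : W} (hk : ℓ k = 1) (u : W) : ℓ (k * u⁻¹) = ℓ (u * k) := by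
  rw [← inv_mul_letter hk, cs.length_inv]

theorem length_inv_mul_letter {k : W} (hk : ℓ k = 1) (u : W) : ℓ (u⁻¹ * k) = ℓ (k * u) := by
  rw [← inv_letter_mul hk, cs.length_inv]

theorem mul_letter_le_or {k x y : W} (hk : ℓ k = 1) (h : x ≼ y) :
    x * k ≼ y ∨ x * k ≼ y * k := by
  rw [← inv_bruhatLE_inv_iff (u := x * k), ← inv_bruhatLE_inv_iff (u := x * k),
    inv_mul_letter hk, inv_mul_letter hk]
  exact letter_mul_le_or hk (inv_bruhatLE_inv h)

theorem le_mul_letter_or {k x y : W} (hk : ℓ k = 1) (h : x ≼ y) :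
    x ≼ y * k ∨ x * k ≼ y * k := by
  rw [← inv_bruhatLE_inv_iff (u := x), ← inv_bruhatLE_inv_iff (u := x * k),
    inv_mul_letter hk, inv_mul_letter hk]
  exact le_letter_mul_or hk (inv_bruhatLE_inv h)

theorem letter_mul_mono {k x y : W} (hk : ℓ k = 1) (h : x ≼ y) (hy : ℓ y < ℓ (k * y)) :
    k * x ≼ k * y :=
  (letter_mul_le_or hk h).elim (fun h => h.trans (le_letter_mul hk hy)) id

theorem mul_letter_mono {k x y : W} (hk : ℓ k = 1) (h : x ≼ y) (hy : ℓ y < ℓ (y * k)) :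
    x * k ≼ y * k :=
  (mul_letter_le_or hk h).elim (fun h => h.trans (le_mul_letter hk hy)) id

theorem letter_mul_le_of_descent {k x y : W} (hk : ℓ k = 1) (h : x ≼ y)
    (hy : ℓ (k * y) < ℓ y) : k * x ≼ y :=
  (letter_mul_le_or hk h).elim id (fun h => h.trans (letter_mul_le hk hy))

theorem mul_letter_le_of_descent {k x y : W} (hk : ℓ k = 1) (h : x ≼ y)
    (hy : ℓ (y * k) < ℓ y) : x * k ≼ y :=
  (mul_letter_le_or hk h).elim id (fun h => h.trans (mul_letter_le hk hy))

theorem strip_left {k x y : W} (hk : ℓ k = 1) (h : x ≼ y) (hx : ℓ x < ℓ (k * x)) :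
    x ≼ k * y :=
  (le_letter_mul_or hk h).elim id (fun h => (le_letter_mul hk hx).trans h)

theorem strip_right {k x y : W} (hk : ℓ k = 1) (h : x ≼ y) (hx : ℓ x < ℓ (x * k)) :
    x ≼ y * k :=
  (le_mul_letter_or hk h).elim id (fun h => (le_mul_letter hk hx).trans h)

theorem strip_both_left {k x y : W} (hk : ℓ k = 1) (h : x ≼ y) (hx : ℓ (k * x) < ℓ x) :
    k * x ≼ k * y :=
  (le_letter_mul_or hk h).elim (fun h => (letter_mul_le hk hx).trans h) id

theorem strip_both_right {k x y : W} (hk : ℓ k = 1) (h : x ≼ y) (hx : ℓ (x * k) < ℓ x) :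
    x * k ≼ y * k :=
  (le_mul_letter_or hk h).elim (fun h => (mul_letter_le hk hx).trans h) id

theorem one_bruhatLE (u : W) : 1 ≼ u := by
  refine left_induction (cs := cs) (bruhatLE_refl _) ?_ u
  intro k u hk h ih
  exact ih.trans (le_letter_mul hk (by omega))

theorem eq_one_of_length {u : W} (h : ℓ u = 0) : u = 1 := cs.length_eq_zero_iff.1 h

theorem le_letter {k u : W} (hk : ℓ k = 1) (h : u ≼ k) : u = 1 ∨ u = k := by
  by_cases hne : u = k
  · exact Or.inr hne
  · have := length_lt_of_bruhatLE h hne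
    exact Or.inl (eq_one_of_length (cs := cs) (by omega))

theorem letter_le_letter {k k' : W} (hk : ℓ k = 1) (hk' : ℓ k' = 1) (h : k ≼ k') : k = k' :=
  (le_letter hk' h).resolve_left (letter_ne_one hk)

/-- The chain property of the Bruhat order. -/
theorem exists_coatom_ge {x y : W} (h : x ≼ y) (hne : x ≠ y) :
    ∃ z, x ≼ z ∧ z ≼ y ∧ ℓ z + 1 = ℓ y := by
  induction hn : ℓ y using Nat.strong_induction_on generalizing x y with
  | _ n ih =>
    have hlt := length_lt_of_bruhatLE h hne
    have hy : y ≠ 1 := by rintro rfl; simp at hlt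
    obtain ⟨k, hk, hky⟩ := exists_left_descent (cs := cs) hy
    have hky' := length_letter_mul hk y
    have hle := letter_mul_le hk hky
    rcases length_letter_mul hk x with hx | hx
    · exact ⟨k * y, strip_left hk h (by omega), hle, by omega⟩
    · obtain ⟨z, hz1, hz2, hz3⟩ := ih (ℓ (k * y)) (by omega)
        (strip_both_left hk h (by omega)) (by simpa using hne) rfl
      rcases length_letter_mul hk z with hz | hz
      · refine ⟨k * z, ?_, letter_mul_le_of_descent hk (hz2.trans hle) hky, by omega⟩
        have := letter_mul_mono hk hz1 (by omega)
        rwa [letter_mul_cancel_left hk] at this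
      · refine ⟨k * y, ?_, hle, by omega⟩
        have := letter_mul_le_of_descent hk hz1 (by omega)
        rw [letter_mul_cancel_left hk] at this
        exact this.trans hz2

theorem exists_atom_le {x y : W} (h : x ≼ y) (hne : x ≠ y) :
    ∃ z, x ≼ z ∧ z ≼ y ∧ ℓ z = ℓ x + 1 := by
  induction hn : ℓ y using Nat.strong_induction_on generalizing y with
  | _ n ih =>
    obtain ⟨z, h1, h2, h3⟩ := exists_coatom_ge h hne
    by_cases hz : x = z
    · subst hz; exact ⟨y, h, bruhatLE_refl _, h3.symm⟩
    · obtain ⟨w, hw1, hw2, hw3⟩ := ih (ℓ z) (by omega) h1 hz rfl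
      exact ⟨w, hw1, hw2.trans h2, hw3⟩

theorem bCov_iff {u w : W} : bCov cs u w ↔ u ≼ w ∧ ℓ w = ℓ u + 1 := by
  constructor
  · rintro ⟨h, hne, hc⟩
    obtain ⟨z, h1, h2, h3⟩ := exists_coatom_ge h hne
    refine ⟨h, ?_⟩
    rcases hc z h1 h2 with rfl | rfl
    · omega
    · omega
  · rintro ⟨h, hl⟩
    refine ⟨h, by rintro rfl; omega, fun z h1 h2 => ?_⟩
    have := length_le_of_bruhatLE h1
    by_cases hz : ℓ z = ℓ u
    · left; exact (eq_of_bruhatLE_of_length h1 (by omega)).symm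
    · right; exact eq_of_bruhatLE_of_length h2 (by omega)

theorem exists_reflection_of_cover {z w : W} (h : z ≼ w) (hl : ℓ w = ℓ z + 1) :
    ∃ t, cs.IsReflection t ∧ w = z * t := by
  rcases Relation.ReflTransGen.cases_tail h with h | ⟨z', hz, t, ht, he, h3⟩
  · subst h; omega
  · have := length_le_of_bruhatLE hz
    have := eq_of_bruhatLE_of_length hz (by omega)
    subst this
    exact ⟨t, ht, he⟩

end

section

variable {cs}

/-- Products of elements below. -/
theorem exists_mul_of_le_mul {u x y : W} (h : u ≼ x * y) :
    ∃ x' y', x' ≼ x ∧ y' ≼ y ∧ u = x' * y' ∧ ℓ u = ℓ x' + ℓ y' := by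
  induction x using left_induction (cs := cs) generalizing u with
  | h1 => exact ⟨1, u, bruhatLE_refl _, by simpa using h, by simp, by simp⟩
  | hs k x hk hl ih =>
    have hkx : x ≼ k * x := le_letter_mul hk (by omega)
    have h' := le_letter_mul_or hk h
    rw [mul_assoc, letter_mul_cancel_left hk] at h'
    by_cases hu : u ≼ x * y
    · obtain ⟨x', y', h1, h2, h3, h4⟩ := ih hu
      exact ⟨x', y', h1.trans hkx, h2, h3, h4⟩
    · have h2 := h'.resolve_left hu
      obtain ⟨x', y', h3, h4, h5, h6⟩ := ih h2
      have h7 : ℓ (k * u) + 1 = ℓ u := by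
        rcases length_letter_mul hk u with h | h
        · exact absurd ((le_letter_mul hk (by omega)).trans h2) hu
        · exact h
      have h8 : u = k * x' * y' := by rw [mul_assoc, ← h5, letter_mul_cancel_left hk]
      have h9 := cs.length_mul_le (k * x') y'
      have h10 := length_letter_mul hk x'
      rw [← h8] at h9
      exact ⟨k * x', y', letter_mul_mono hk h3 (by omega), h4, h8, by omega⟩

/-- Monotonicity of the product into a reduced product. -/
theorem mul_le_mul_of_additive {x y x' y' : W} (hx : x' ≼ x) (hy : y' ≼ y)
    (h : ℓ (x * y) = ℓ x + ℓ y) : x' * y' ≼ x * y := by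
  induction x using left_induction (cs := cs) generalizing x' with
  | h1 =>
    have : x' = 1 := eq_of_bruhatLE_of_length hx (by simp)
    simpa [this] using hy
  | hs k x hk hl ih =>
    have h1 := length_letter_mul hk (x * y)
    have h2 := cs.length_mul_le x y
    rw [← mul_assoc] at h1
    have h3 : ℓ (x * y) < ℓ (k * (x * y)) := by rw [← mul_assoc]; omega
    rcases length_letter_mul hk x' with hx' | hx'
    · have h4 := strip_left hk hx (by omega)
      rw [letter_mul_cancel_left hk] at h4
      have h5 := (ih h4 (by omega)).trans (le_letter_mul hk h3)
      rwa [← mul_assoc] at h5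
    · have h4 := strip_both_left hk hx (by omega)
      rw [letter_mul_cancel_left hk] at h4
      have h5 := letter_mul_mono hk (ih h4 (by omega)) h3
      rwa [← mul_assoc, ← mul_assoc, ← mul_assoc, letter_mul_self hk, one_mul] at h5

theorem left_le_mul {x y : W} (h : ℓ (x * y) = ℓ x + ℓ y) : x ≼ x * y := by
  simpa using mul_le_mul_of_additive (bruhatLE_refl x) (one_bruhatLE y) h

theorem right_le_mul {x y : W} (h : ℓ (x * y) = ℓ x + ℓ y) : y ≼ x * y := by
  simpa using mul_le_mul_of_additive (one_bruhatLE x) (bruhatLE_refl y) h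

theorem letter_le_mul {k x y : W} (hk : ℓ k = 1) (h : k ≼ x * y) : k ≼ x ∨ k ≼ y := by
  obtain ⟨x', y', hx, hy, he, hl⟩ := exists_mul_of_le_mul h
  by_cases h0 : ℓ x' = 0
  · rw [eq_one_of_length h0, one_mul] at he
    exact Or.inr (he ▸ hy)
  · rw [eq_one_of_length (cs := cs) (u := y') (by omega), mul_one] at he
    exact Or.inl (he ▸ hx)

theorem letter_le_inv {k x : W} (hk : ℓ k = 1) : k ≼ x⁻¹ ↔ k ≼ x := by
  rw [← inv_bruhatLE_inv_iff, inv_inv, letter_inv hk]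

theorem not_letter_le_mul {k x y : W} (hk : ℓ k = 1) (hx : ¬ k ≼ x) (hy : ¬ k ≼ y) :
    ¬ k ≼ x * y := fun h => (letter_le_mul hk h).elim hx hy

theorem left_descent_le {k u : W} (hk : ℓ k = 1) (h : ℓ (k * u) < ℓ u) : k ≼ u := by
  have := length_letter_mul hk u
  have := left_le_mul (cs := cs) (x := k) (y := k * u)
    (by rw [letter_mul_cancel_left hk]; omega)
  rwa [letter_mul_cancel_left hk] at this

theorem right_descent_le {k u : W} (hk : ℓ k = 1) (h : ℓ (u * k) < ℓ u) : k ≼ u := by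
  have := length_mul_letter hk u
  have := right_le_mul (cs := cs) (x := u * k) (y := k)
    (by rw [letter_mul_cancel_right hk]; omega)
  rwa [letter_mul_cancel_right hk] at this

theorem commute_of_letters {q j : W} (h : ∀ k, ℓ k = 1 → k ≼ q → k * j = j * k) :
    q * j = j * q := by
  induction q using left_induction (cs := cs) with
  | h1 => simp
  | hs k q hk hl ih =>
    rw [mul_assoc, ih fun k' hk' hle => h k' hk' (hle.trans (le_letter_mul hk (by omega))),
      ← mul_assoc, h k hk (left_descent_le hk (by rw [letter_mul_cancel_left hk]; omega)),
      mul_assoc]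

theorem length_mul_of_not_le {x r : W} (hr : ℓ r = 1) (hx : ¬ r ≼ x) : ℓ (x * r) = ℓ x + 1 :=
  (length_mul_letter hr x).resolve_right fun h => hx (right_descent_le hr (by omega))

theorem length_letter_mul_of_not_le {x r : W} (hr : ℓ r = 1) (hx : ¬ r ≼ x) :
    ℓ (r * x) = ℓ x + 1 :=
  (length_letter_mul hr x).resolve_right fun h => hx (left_descent_le hr (by omega))

theorem eq_of_mul_letter_eq {x y r : W} (hr : ℓ r = 1) (hx : ¬ r ≼ x) (hy : ¬ r ≼ y)
    (h : x * r = r * y) : x = y := by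
  have h1 := length_mul_of_not_le hr hx
  have h2 := length_letter_mul_of_not_le hr hy
  have h3 : x ≼ r * y := by rw [← h]; exact le_mul_letter hr (by omega)
  obtain ⟨x', y', hx', hy', he, hl⟩ := exists_mul_of_le_mul h3
  rcases le_letter hr hx' with rfl | rfl
  · rw [one_mul] at he
    subst he
    rw [h] at h1
    exact eq_of_bruhatLE_of_length hy' (by omega)
  · exact absurd (by rw [he]; exact left_le_mul (by rw [← he]; exact hl)) hx

theorem letter_commute_of_not_le {k r x : W} (hk : ℓ k = 1) (hr : ℓ r = 1) (hx : ¬ r ≼ x)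
    (h : x * r = r * x) (hkx : ℓ (k * x) < ℓ x) : k * r = r * k := by
  by_contra hne
  have hkr : k ≠ r := by rintro rfl; exact hne rfl
  have hnk : ¬ r ≼ k := fun h => hkr (letter_le_letter hr hk h).symm
  have hrx := length_letter_mul_of_not_le hr hx
  have hkw : ℓ (k * (r * x)) < ℓ (r * x) := by
    rw [← h, ← mul_assoc]
    have := cs.length_mul_le (k * x) r
    rw [hr] at this
    rw [h]
    omega
  have h1 : k ≼ r * x := left_descent_le hk hkw
  have h2 : r * k ≼ r * x := letter_mul_le_of_descent hr h1
    (by rw [letter_mul_cancel_left hr]; omega)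
  have h3 : k * (r * k) ≼ r * x := letter_mul_le_of_descent hk h2 hkw
  have h4 := le_letter_mul_or hr h3
  rw [letter_mul_cancel_left hr] at h4
  have h5 : ¬ r ≼ k * (r * k) := by
    intro h5
    rcases h4 with h4 | h4
    · exact hx (h5.trans h4)
    · have h6 : ¬ r ≼ r * (k * (r * k)) := fun h => hx (h.trans h4)
      have h7 := not_letter_le_mul hr h6 hnk
      have := eq_of_mul_letter_eq hr hnk h7 (by
        simp only [← mul_assoc]
        rw [letter_mul_self hr, one_mul, letter_mul_cancel_right hk])
      apply hne
      have h8 : r * (k * (r * k)) = 1 := by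
        have := this.symm
        rwa [mul_eq_right] at this
      calc k * r = r * (r * k * r) * k * k := by
            simp only [← mul_assoc]
            rw [letter_mul_self hr, one_mul, letter_mul_cancel_right hk]
        _ = r * (r * (k * (r * k))) * k := by simp only [mul_assoc]
        _ = r * k := by rw [h8, mul_one]
  have h6 := not_letter_le_mul hr (not_letter_le_mul hr hnk h5) hnk
  rw [letter_mul_cancel_left hk, letter_mul_cancel_right hk] at h6
  exact h6 (bruhatLE_refl _)

theorem letters_commute_of_mul_eq {x r : W} (hr : ℓ r = 1) (hx : ¬ r ≼ x)
    (h : x * r = r * x) : ∀ k, ℓ k = 1 → k ≼ x → k * r = r * k := by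
  induction x using left_induction (cs := cs) with
  | h1 =>
    intro k hk hle
    have := length_le_of_bruhatLE hle
    rw [cs.length_one] at this; omega
  | hs k x hk hl ih =>
    have hkr := letter_commute_of_not_le hk hr hx h
      (by rw [letter_mul_cancel_left hk]; omega)
    intro k' hk' hle
    rcases letter_le_mul hk' hle with h1 | h1
    · rw [letter_le_letter hk' hk h1]; exact hkr
    · refine ih (fun h => hx (h.trans (le_letter_mul hk (by omega)))) ?_ k' hk' h1
      rw [← mul_assoc, ← hkr, mul_assoc, mul_assoc, mul_right_inj] at h
      exact h

theorem length_insert {α β r : W} (hr : ℓ r = 1) (hα : ¬ r ≼ α) (hβ : ¬ r ≼ β)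
    (h : ℓ (α * β) = ℓ α + ℓ β) : ℓ (α * r * β) = ℓ α + 1 + ℓ β ∧ α * β ≼ α * r * β := by
  have ht : cs.IsReflection (β⁻¹ * r * β) := by
    simpa using (letter_isReflection hr).conj β⁻¹
  have he : α * r * β = α * β * (β⁻¹ * r * β) := by group
  have h1 := ht.length_mul_left_ne (α * β)
  rw [← he] at h1
  have h2 := cs.length_mul_le (α * r) β
  have h3 := cs.length_mul_le α r
  have h4 : ¬ ℓ (α * r * β) < ℓ (α * β) := by
    intro hlt
    have h5 : α * r * β ≼ α * β := by
      have hc : α * r * β * (β⁻¹ * r * β) = α * β := by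
        rw [he, mul_assoc (α * β), ht.mul_self, mul_one]
      rw [← hc] at hlt ⊢
      exact bruhatLE_of_reflection ht hlt
    have h6 : ¬ r ≼ α * r * β := fun h => not_letter_le_mul hr hα hβ (h.trans h5)
    have h7 := not_letter_le_mul hr
      (not_letter_le_mul hr (x := α⁻¹) (by rwa [letter_le_inv hr]) h6)
      (y := β⁻¹) (by rwa [letter_le_inv hr])
    apply h7
    have : α⁻¹ * (α * r * β) * β⁻¹ = r := by group
    rw [this]
    exact bruhatLE_refl _
  refine ⟨by omega, ?_⟩
  rw [he]
  exact bruhatLE_of_reflection ht (by rw [← he]; omega)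

/-- Comparison of two products with a single occurrence of the letter `r`. -/
theorem exists_transfer {a b γ₁ γ₂ r : W} (hr : ℓ r = 1) (ha : ¬ r ≼ a) (hb : ¬ r ≼ b)
    (h1 : ¬ r ≼ γ₁) (h2 : ¬ r ≼ γ₂) (h : a * r * b ≼ γ₁ * r * γ₂) :
    ∃ c, ¬ r ≼ c ∧ (∀ k, ℓ k = 1 → k ≼ c → k * r = r * k) ∧
      a * c ≼ γ₁ ∧ c⁻¹ * b ≼ γ₂ := by
  obtain ⟨xy, z, hxy, hz, he, -⟩ := exists_mul_of_le_mul h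
  obtain ⟨x, y, hx, hy, rfl, -⟩ := exists_mul_of_le_mul hxy
  have hx' : ¬ r ≼ x := fun h => h1 (h.trans hx)
  have hz' : ¬ r ≼ z := fun h => h2 (h.trans hz)
  have hai : ¬ r ≼ a⁻¹ := by rwa [letter_le_inv hr]
  have hbi : ¬ r ≼ b⁻¹ := by rwa [letter_le_inv hr]
  have hzi : ¬ r ≼ z⁻¹ := by rwa [letter_le_inv hr]
  rcases le_letter hr hy with rfl | rfl
  · exfalso
    have h3 := not_letter_le_mul hr (not_letter_le_mul hr hai
      (not_letter_le_mul hr hx' hz')) hbi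
    apply h3
    rw [mul_one] at he
    rw [← he]
    have : a⁻¹ * (a * r * b) * b⁻¹ = r := by group
    rw [this]
    exact bruhatLE_refl _
  · have h4 : a⁻¹ * x * y = y * (b * z⁻¹) := by
      have : a⁻¹ * x * y = a⁻¹ * (x * y * z) * z⁻¹ := by group
      rw [this, ← he]; group
    have h5 := not_letter_le_mul hr hai hx'
    have h6 := eq_of_mul_letter_eq hr h5 (not_letter_le_mul hr hb hzi) h4
    refine ⟨a⁻¹ * x, h5, ?_, ?_, ?_⟩
    · rw [← h6] at h4
      exact letters_commute_of_mul_eq hr h5 h4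
    · rwa [mul_inv_cancel_left]
    · rw [h6]
      simpa using hz

theorem exists_insertion_of_cover {z w r : W} (hr : ℓ r = 1) (h : z ≼ w) (hl : ℓ w = ℓ z + 1)
    (hz : ¬ r ≼ z) (hw : r ≼ w) :
    ∃ γ₁ γ₂, w = γ₁ * r * γ₂ ∧ z = γ₁ * γ₂ ∧ ℓ z = ℓ γ₁ + ℓ γ₂ ∧ ¬ r ≼ γ₁ ∧ ¬ r ≼ γ₂ := by
  obtain ⟨t, ht, rfl⟩ := exists_reflection_of_cover h hl
  have hz' : z * t * t = z := by rw [mul_assoc, ht.mul_self, mul_one]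
  obtain ⟨a, p, b, hp, h1, h2, h3⟩ := exists_prefix_of_isReflection (w := z * t) ht
    (by rw [hz']; omega)
  rw [hz'] at h3
  have h4 : ℓ z = ℓ a + ℓ b := by omega
  have ha : ¬ r ≼ a := fun h => hz (h.trans (h3 ▸ left_le_mul (by rw [← h3, h4])))
  have hb : ¬ r ≼ b := fun h => hz (h.trans (h3 ▸ right_le_mul (by rw [← h3, h4])))
  have : r = p := by
    rw [h1] at hw
    rcases letter_le_mul hr hw with h | h
    · rcases letter_le_mul hr h with h | h
      · exact absurd h ha
      · exact letter_le_letter hr hp h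
    · exact absurd h hb
  subst this
  exact ⟨a, b, h1, h3, h4, ha, hb⟩

theorem exists_insertion {x z a : W} (ha : ℓ a = 1) (h : x ≼ z) (haz : a ≼ z) (hax : ¬ a ≼ x) :
    ∃ α β, x = α * β ∧ ℓ x = ℓ α + ℓ β ∧ α * a * β ≼ z := by
  induction hn : ℓ z using Nat.strong_induction_on generalizing z with
  | _ n ih =>
    have hne : x ≠ z := by rintro rfl; exact hax haz
    obtain ⟨w, h1, h2, h3⟩ := exists_coatom_ge h hne
    by_cases haw : a ≼ w
    · obtain ⟨α, β, h4, h5, h6⟩ := ih (ℓ w) (by omega) h1 haw rfl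
      exact ⟨α, β, h4, h5, h6.trans h2⟩
    · obtain ⟨γ₁, γ₂, rfl, rfl, h6, h7, h8⟩ :=
        exists_insertion_of_cover ha h2 h3.symm haw haz
      obtain ⟨α, β, h9, h10, h11, h12⟩ := exists_mul_of_le_mul h1
      refine ⟨α, β, h11, h12, ?_⟩
      have h13 := length_mul_of_not_le ha h7
      exact mul_le_mul_of_additive
        (mul_le_mul_of_additive h9 (bruhatLE_refl _) (by rw [h13, ha])) h10 (by omega)

end

section

/-- All letters of `u` lie in `J`. -/
def InPar (J : Set W) (u : W) : Prop := ∀ k, ℓ k = 1 → k ≼ u → k ∈ J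

variable {cs}

theorem InPar.mono {J : Set W} {u w : W} (hw : cs.InPar J w) (h : u ≼ w) : cs.InPar J u :=
  fun k hk hle => hw k hk (hle.trans h)

theorem InPar.mul {J : Set W} {u w : W} (hu : cs.InPar J u) (hw : cs.InPar J w) :
    cs.InPar J (u * w) :=
  fun k hk hle => (letter_le_mul hk hle).elim (hu k hk) (hw k hk)

theorem InPar.inv {J : Set W} {u : W} (hu : cs.InPar J u) : cs.InPar J u⁻¹ :=
  fun k hk hle => hu k hk ((letter_le_inv hk).1 hle)

theorem inPar_one (J : Set W) : cs.InPar J 1 := by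
  intro k hk hle
  have := length_le_of_bruhatLE hle
  rw [cs.length_one] at this; omega

theorem inPar_letter {J : Set W} {k : W} (hk : ℓ k = 1) (h : k ∈ J) : cs.InPar J k :=
  fun k' hk' hle => by rwa [letter_le_letter hk' hk hle]

theorem InPar.not_le {J : Set W} {u r : W} (hu : cs.InPar J u) (hr : ℓ r = 1) (h : r ∉ J) :
    ¬ r ≼ u := fun hle => h (hu r hr hle)

theorem InPar.left_mem {J : Set W} {u k : W} (hu : cs.InPar J u) (hk : ℓ k = 1)
    (h : ℓ (k * u) < ℓ u) : k ∈ J := hu k hk (left_descent_le hk h)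

theorem InPar.right_mem {J : Set W} {u k : W} (hu : cs.InPar J u) (hk : ℓ k = 1)
    (h : ℓ (u * k) < ℓ u) : k ∈ J := hu k hk (right_descent_le hk h)

variable (cs) in
theorem exists_min_length {S : Set W} (h : S.Nonempty) :
    ∃ x ∈ S, ∀ y ∈ S, ℓ x ≤ ℓ y := by
  obtain ⟨x, hx, hy⟩ := (InvImage.wf cs.length Nat.lt_wfRel.wf).has_min S h
  exact ⟨x, hx, fun y hyS => not_lt.1 (hy y hyS)⟩

theorem additive_of_no_descent {J : Set W} {x q : W}
    (hx : ∀ k ∈ J, ℓ k = 1 → ℓ x < ℓ (x * k)) (hq : cs.InPar J q) :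
    ℓ (x * q) = ℓ x + ℓ q := by
  obtain ⟨x₀, ⟨p, hp, rfl⟩, hmin⟩ := exists_min_length cs (S := {y | ∃ p, cs.InPar J p ∧ y = x * p})
    ⟨x, 1, inPar_one J, by simp⟩
  have key : ∀ q, cs.InPar J q → ℓ (x * p * q) = ℓ (x * p) + ℓ q := by
    intro q hq
    induction q using right_induction (cs := cs) with
    | h1 => simp
    | hs k q hk hl ih =>
      have hq' := ih (hq.mono (le_mul_letter hk (by omega)))
      have h1 := length_mul_letter hk (x * p * q)
      rw [← mul_assoc]
      rcases h1 with h1 | h1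
      · omega
      · exfalso
        have h2 := mul_letter_le (u := x * p * q) hk (by omega)
        obtain ⟨x', y', hx', hy', he, -⟩ := exists_mul_of_le_mul h2
        have hqy : cs.InPar J y' := (hq.mono (le_mul_letter hk (by omega))).mono hy'
        have h3 := hmin x' ⟨p * (q * k) * y'⁻¹, (hp.mul hq).mul hqy.inv, by
          rw [eq_mul_inv_of_mul_eq he.symm]; group⟩
        have h4 := eq_of_bruhatLE_of_length hx' h3
        subst h4
        rw [mul_assoc (x * p), mul_right_inj] at he
        have := length_le_of_bruhatLE hy'
        rw [← he] at this
        omega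
  have hxp : x = x * p * p⁻¹ := by group
  have h1 := key p⁻¹ hp.inv
  rw [← hxp, cs.length_inv] at h1
  by_cases hp1 : p = 1
  · subst hp1
    simpa using key q hq
  · exfalso
    obtain ⟨k, hk, hkp⟩ := exists_left_descent (cs := cs) hp1
    have h2 := hx k (hp.left_mem hk hkp) hk
    have h3 := key (p⁻¹ * k) (hp.inv.mul (inPar_letter hk (hp.left_mem hk hkp)))
    have h4 : x * p * (p⁻¹ * k) = x * k := by group
    rw [h4, length_inv_mul_letter hk] at h3
    omega

theorem additive_of_no_descent_left {J : Set W} {x q : W}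
    (hx : ∀ k ∈ J, ℓ k = 1 → ℓ x < ℓ (k * x)) (hq : cs.InPar J q) :
    ℓ (q * x) = ℓ q + ℓ x := by
  have := additive_of_no_descent (cs := cs) (J := J) (x := x⁻¹) (q := q⁻¹)
    (fun k hk h => by
      rw [length_inv_mul_letter h, cs.length_inv]; exact hx k hk h) hq.inv
  rw [← mul_inv_rev, cs.length_inv, cs.length_inv, cs.length_inv] at this
  omega

variable (cs) in
theorem exists_parabolic_right (J : Set W) (x : W) :
    ∃ y q, x = y * q ∧ cs.InPar J q ∧ ℓ x = ℓ y + ℓ q ∧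
      ∀ k ∈ J, ℓ k = 1 → ℓ y < ℓ (y * k) := by
  induction hn : ℓ x using Nat.strong_induction_on generalizing x with
  | _ n ih =>
    by_cases h : ∀ k ∈ J, ℓ k = 1 → ℓ x < ℓ (x * k)
    · exact ⟨x, 1, by simp, inPar_one J, by simp [hn], h⟩
    · push Not at h
      obtain ⟨k, hkJ, hk, h⟩ := h
      have h1 := length_mul_letter hk x
      obtain ⟨y, q, h2, h3, h4, h5⟩ := ih (ℓ (x * k)) (by omega) (x * k) rfl
      have h6 : x = y * (q * k) := by
        rw [← mul_assoc, ← h2, letter_mul_cancel_right hk]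
      refine ⟨y, q * k, h6, h3.mul (inPar_letter hk hkJ), ?_, h5⟩
      have h7 := cs.length_mul_le y (q * k)
      have h8 := cs.length_mul_le q k
      rw [← h6] at h7
      omega

variable (cs) in
theorem exists_parabolic_left (J : Set W) (x : W) :
    ∃ q y, x = q * y ∧ cs.InPar J q ∧ ℓ x = ℓ q + ℓ y ∧
      ∀ k ∈ J, ℓ k = 1 → ℓ y < ℓ (k * y) := by
  obtain ⟨y, q, h1, h2, h3, h4⟩ := exists_parabolic_right cs J x⁻¹
  refine ⟨q⁻¹, y⁻¹, by rw [← mul_inv_rev, ← h1, inv_inv], h2.inv, ?_, ?_⟩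
  · rw [cs.length_inv, cs.length_inv, ← cs.length_inv x, h3, add_comm]
  · intro k hkJ hk
    rw [length_letter_mul_inv hk, cs.length_inv]
    exact h4 k hkJ hk

theorem le_of_le_mul_parabolic {J : Set W} {a b q : W} (ha : ∀ k ∈ J, ℓ k = 1 → ℓ a < ℓ (a * k))
    (hq : cs.InPar J q) (h : a ≼ b * q) : a ≼ b := by
  obtain ⟨x, y, hx, hy, he, hl⟩ := exists_mul_of_le_mul h
  by_cases hy1 : y = 1
  · rw [he, hy1, mul_one]; exact hx
  · exfalso
    obtain ⟨k, hk, hky⟩ := exists_right_descent (cs := cs) hy1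
    have h1 := ha k ((hq.mono hy).right_mem hk hky) hk
    have h2 := cs.length_mul_le x (y * k)
    rw [← mul_assoc, ← he] at h2
    omega

/-- `u` only involves the letters `s` and `t`. -/
abbrev Dih (cs : CoxeterSystem M W) (s t u : W) : Prop := cs.InPar {s, t} u

theorem Dih.swap {s t u : W} (h : cs.Dih s t u) : cs.Dih t s u :=
  fun k hk hle => (h k hk hle).symm

/-- In a dihedral group, elements of the same length with a common left descent are equal. -/
theorem Dih.eq_of_left {s t u w k : W} (hu : cs.Dih s t u) (hw : cs.Dih s t w)
    (hl : ℓ u = ℓ w) (hk : ℓ k = 1) (hku : ℓ (k * u) < ℓ u) (hkw : ℓ (k * w) < ℓ w) : u = w := by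
  induction hn : ℓ u using Nat.strong_induction_on generalizing u w k with
  | _ n ih =>
    have h1 := length_letter_mul hk u
    have h2 := length_letter_mul hk w
    rw [← mul_right_inj k]
    by_cases h0 : ℓ (k * u) = 0
    · rw [eq_one_of_length h0, eq_one_of_length (cs := cs) (u := k * w) (by omega)]
    · have hu' : k * u ≠ 1 := by intro h; rw [h] at h0; simp at h0
      have hw' : k * w ≠ 1 := by
        intro h; rw [h] at h2; simp at h2; omega
      obtain ⟨p, hp, hpu⟩ := exists_left_descent (cs := cs) hu'
      obtain ⟨p', hp', hpw⟩ := exists_left_descent (cs := cs) hw'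
      have hdu := hu.mono (letter_mul_le hk hku)
      have hdw := hw.mono (letter_mul_le hk hkw)
      have hkmem := hu.left_mem hk hku
      have hpk : p ≠ k := by
        rintro rfl; rw [letter_mul_cancel_left hp] at hpu; omega
      have hpk' : p' ≠ k := by
        rintro rfl; rw [letter_mul_cancel_left hp'] at hpw; omega
      have hpm := hdu.left_mem hp hpu
      have hpm' := hdw.left_mem hp' hpw
      have : p = p' := by
        rcases hkmem with rfl | rfl <;> rcases hpm with rfl | rfl <;>
          rcases hpm' with rfl | rfl <;> first | rfl | contradiction
      subst this
      exact ih _ (by omega) hdu hdw (by omega) hp hpu hpw rfl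

theorem Dih.le_of_length_lt {s t u w : W} (hu : cs.Dih s t u) (hw : cs.Dih s t w)
    (hl : ℓ u < ℓ w) : u ≼ w := by
  induction hn : ℓ w using Nat.strong_induction_on generalizing u w with
  | _ n ih =>
    have hw1 : w ≠ 1 := by rintro rfl; simp at hl
    obtain ⟨k, hk, hkw⟩ := exists_left_descent (cs := cs) hw1
    have h1 := length_letter_mul hk w
    have h2 := length_letter_mul hk u
    have hdw := hw.mono (letter_mul_le hk hkw)
    have hkm := hw.left_mem hk hkw
    have hdu := (inPar_letter hk hkm).mul hu
    by_cases h3 : ℓ u < ℓ (k * w)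
    · exact (ih _ (by omega) hu hdw h3 rfl).trans (letter_mul_le hk hkw)
    · rcases h2 with h2 | h2
      · have := Dih.eq_of_left hdu hw (by omega) hk
          (by rw [letter_mul_cancel_left hk]; omega) hkw
        rw [← this]
        exact le_letter_mul hk (by omega)
      · have h4 := ih _ (by omega) (hu.mono (letter_mul_le hk (by omega))) hdw (by omega) rfl
        have h5 := letter_mul_le_of_descent hk (h4.trans (letter_mul_le hk hkw)) hkw
        rwa [letter_mul_cancel_left hk] at h5

theorem Dih.eq_of_right {s t u w k : W} (hu : cs.Dih s t u) (hw : cs.Dih s t w)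
    (hl : ℓ u = ℓ w) (hk : ℓ k = 1) (hku : ℓ (u * k) < ℓ u) (hkw : ℓ (w * k) < ℓ w) : u = w := by
  have := Dih.eq_of_left (cs := cs) (u := u⁻¹) (w := w⁻¹) hu.inv hw.inv
    (by rwa [cs.length_inv, cs.length_inv]) hk
    (by rwa [length_letter_mul_inv hk, cs.length_inv])
    (by rwa [length_letter_mul_inv hk, cs.length_inv])
  simpa using this

/-- In a dihedral group, a cover with a common left descent is a right multiplication. -/
theorem Dih.cover_right {s t u w k : W} (hu : cs.Dih s t u) (hw : cs.Dih s t w)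
    (hl : ℓ w = ℓ u + 1) (hk : ℓ k = 1) (hku : ℓ (k * u) < ℓ u) (hkw : ℓ (k * w) < ℓ w) :
    ∃ h, ℓ h = 1 ∧ h ∈ ({s, t} : Set W) ∧ w = u * h := by
  have hw1 : k * w ≠ 1 := by
    intro h
    have h1 := length_letter_mul hk w
    rw [h] at h1; simp at h1; omega
  obtain ⟨h, hh, hhw⟩ := exists_right_descent (cs := cs) hw1
  have h1 := length_letter_mul hk w
  have h2 := length_mul_letter hh w
  have h3 := length_mul_letter hh (k * w)
  have h4 := length_letter_mul hk (w * h)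
  rw [← mul_assoc] at h4
  have hhm := (hw.mono (letter_mul_le hk hkw)).right_mem hh hhw
  refine ⟨h, hh, hhm, ?_⟩
  have := Dih.eq_of_left hu (hw.mul (inPar_letter hh hhm)) (by omega) hk hku
    (by rw [← mul_assoc]; omega)
  rw [this, letter_mul_cancel_right hh]

theorem Dih.cover {s t u w : W} (hu : cs.Dih s t u) (hw : cs.Dih s t w)
    (hl : ℓ w = ℓ u + 1) :
    (∃ k, ℓ k = 1 ∧ k ∈ ({s, t} : Set W) ∧ w = k * u) ∨
      ∃ h, ℓ h = 1 ∧ h ∈ ({s, t} : Set W) ∧ w = u * h := by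
  have hw1 : w ≠ 1 := by rintro rfl; simp at hl
  obtain ⟨k, hk, hkw⟩ := exists_left_descent (cs := cs) hw1
  have hkm := hw.left_mem hk hkw
  rcases length_letter_mul hk u with h | h
  · left
    exact ⟨k, hk, hkm, Dih.eq_of_left hw ((inPar_letter hk hkm).mul hu) (by omega) hk hkw
      (by rw [letter_mul_cancel_left hk]; omega)⟩
  · exact Or.inr (Dih.cover_right hu hw hl hk (by omega) hkw)

theorem left_descent_of_coatoms {x y k : W} (hl : ℓ x = ℓ y)
    (hc : ∀ z, z ≼ x → ℓ x = ℓ z + 1 → z ≼ y) (hk : ℓ k = 1)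
    (hkx : ℓ (k * x) < ℓ x) (hky : ℓ (k * y) < ℓ y) : x = y := by
  have h1 := length_letter_mul hk x
  have h2 := length_letter_mul hk y
  have h3 := strip_left hk (hc _ (letter_mul_le hk hkx) (by omega))
    (by rw [letter_mul_cancel_left hk]; omega)
  have := eq_of_bruhatLE_of_length h3 (by omega)
  rwa [mul_right_inj] at this

/-- Distinct elements with the same coatoms lie in a common dihedral parabolic subgroup. -/
theorem exists_dih_of_coatoms {x y : W} (hne : x ≠ y) (hl : ℓ x = ℓ y)
    (h1 : x ≠ 1)
    (hc : ∀ z, z ≼ x → ℓ x = ℓ z + 1 → z ≼ y)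
    (hc' : ∀ z, z ≼ y → ℓ y = ℓ z + 1 → z ≼ x) :
    ∃ p p', ℓ p = 1 ∧ ℓ p' = 1 ∧ ℓ (x * p) < ℓ x ∧ ℓ (y * p') < ℓ y ∧
      cs.Dih p p' x ∧ cs.Dih p p' y := by
  have h1' : y ≠ 1 := by
    rintro rfl
    rw [cs.length_one] at hl
    exact h1 (eq_one_of_length hl)
  obtain ⟨p, hp, hpx⟩ := exists_right_descent (cs := cs) h1
  obtain ⟨p', hp', hpy⟩ := exists_right_descent (cs := cs) h1'
  refine ⟨p, p', hp, hp', hpx, hpy, ?_⟩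
  have hp1 := length_mul_letter hp x
  have hp2 := length_mul_letter hp' y
  obtain ⟨X, q, hX, hq, hXl, hXm⟩ := exists_parabolic_right cs {p, p'} x
  obtain ⟨Y, r, hY, hr, hYl, hYm⟩ := exists_parabolic_right cs {p, p'} y
  have hip : cs.Dih p p' p := inPar_letter hp (Or.inl rfl)
  have hip' : cs.Dih p p' p' := inPar_letter hp' (Or.inr rfl)
  have h2 : X ≼ Y := by
    refine le_of_le_mul_parabolic hXm hr ?_
    rw [← hY]
    refine bruhatLE.trans ?_ (hc _ (mul_letter_le hp hpx) (by omega))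
    rw [hX, mul_assoc]
    exact left_le_mul (additive_of_no_descent hXm (hq.mul hip))
  have h3 : Y ≼ X := by
    refine le_of_le_mul_parabolic hYm hq ?_
    rw [← hX]
    refine bruhatLE.trans ?_ (hc' _ (mul_letter_le hp' hpy) (by omega))
    rw [hY, mul_assoc]
    exact left_le_mul (additive_of_no_descent hYm (hr.mul hip'))
  have hXY := bruhatLE_antisymm h2 h3
  subst hXY
  by_cases hX1 : X = 1
  · subst hX1
    rw [one_mul] at hX hY
    rw [hX, hY]
    exact ⟨hq, hr⟩
  · exfalso
    obtain ⟨k, hk, hkX⟩ := exists_left_descent (cs := cs) hX1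
    apply hne
    refine left_descent_of_coatoms hl hc hk ?_ ?_
    · have := cs.length_mul_le (k * X) q
      rw [mul_assoc, ← hX] at this; omega
    · have := cs.length_mul_le (k * X) r
      rw [mul_assoc, ← hY] at this; omega

end

section

/-- A special matching of the lower Bruhat interval `[e, v]`. -/
structure SM (v : W) (φ : W → W) : Prop where
  le : ∀ {u}, u ≼ v → φ u ≼ v
  invol : ∀ {u}, u ≼ v → φ (φ u) = u
  adj : ∀ {u}, u ≼ v → ℓ (φ u) = ℓ u + 1 ∨ ℓ (φ u) + 1 = ℓ u
  up : ∀ {u}, u ≼ v → ℓ (φ u) = ℓ u + 1 → u ≼ φ u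
  special : ∀ {u w}, u ≼ w → w ≼ v → ℓ w = ℓ u + 1 → φ u ≠ w → φ u ≼ φ w

/-- `φ` acts at `q` by a left multiplication that is not a right multiplication. -/
def LS (φ : W → W) (q : W) : Prop :=
  (∃ j, ℓ j = 1 ∧ φ q = j * q ∧ ℓ (φ q) = ℓ q + 1) ∧ ∀ h, ℓ h = 1 → φ q ≠ q * h

/-- `φ` acts at `q` by a right multiplication that is not a left multiplication. -/
def RS (φ : W → W) (q : W) : Prop :=
  (∃ j, ℓ j = 1 ∧ φ q = q * j ∧ ℓ (φ q) = ℓ q + 1) ∧ ∀ h, ℓ h = 1 → φ q ≠ h * q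

variable {cs} {v : W} {φ : W → W}

namespace SM

theorem down (h : cs.SM v φ) {u : W} (hu : u ≼ v) (hl : ℓ (φ u) < ℓ u) : φ u ≼ u := by
  have h1 := h.adj hu
  have h2 := h.up (h.le hu) (by rw [h.invol hu]; omega)
  rwa [h.invol hu] at h2

theorem le_or (h : cs.SM v φ) {u w : W} (huw : u ≼ w) (hw : w ≼ v) : φ u ≼ w ∨ φ u ≼ φ w := by
  induction hn : ℓ w using Nat.strong_induction_on generalizing w with
  | _ n ih =>
    by_cases hne : u = w
    · subst hne; exact Or.inr (bruhatLE_refl _)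
    · obtain ⟨z, h1, h2, h3⟩ := exists_coatom_ge huw hne
      rcases ih (ℓ z) (by omega) h1 (h2.trans hw) rfl with h4 | h4
      · exact Or.inl (h4.trans h2)
      · by_cases hz : φ z = w
        · exact Or.inl (hz ▸ h4)
        · exact Or.inr (h4.trans (h.special h2 hw h3.symm hz))

theorem le_or' (h : cs.SM v φ) {u w : W} (huw : u ≼ w) (hw : w ≼ v) : u ≼ φ w ∨ φ u ≼ φ w := by
  induction hn : ℓ w - ℓ u using Nat.strong_induction_on generalizing u with
  | _ n ih =>
    by_cases hne : u = w
    · subst hne; exact Or.inr (bruhatLE_refl _)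
    · obtain ⟨z, h1, h2, h3⟩ := exists_atom_le huw hne
      have h4 := length_lt_of_bruhatLE huw hne
      rcases ih (ℓ w - ℓ z) (by omega) h2 rfl with h4 | h4
      · exact Or.inl (h1.trans h4)
      · by_cases hz : φ u = z
        · rw [← hz, h.invol (huw.trans hw)] at h4
          exact Or.inl h4
        · exact Or.inr ((h.special h1 (h2.trans hw) h3 hz).trans h4)

theorem mono_up (h : cs.SM v φ) {u w : W} (huw : u ≼ w) (hw : w ≼ v) (hl : ℓ w < ℓ (φ w)) :
    φ u ≼ φ w :=
  (h.le_or huw hw).elim (fun h1 => h1.trans (h.up hw (by have := h.adj hw; omega))) id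

theorem le_of_down (h : cs.SM v φ) {u w : W} (huw : u ≼ w) (hw : w ≼ v) (hl : ℓ (φ w) < ℓ w) :
    φ u ≼ w :=
  (h.le_or huw hw).elim id fun h1 => h1.trans (h.down hw hl)

theorem strip (h : cs.SM v φ) {u w : W} (huw : u ≼ w) (hw : w ≼ v) (hl : ℓ u < ℓ (φ u)) :
    u ≼ φ w :=
  (h.le_or' huw hw).elim id fun h1 =>
    (h.up (huw.trans hw) (by have := h.adj (huw.trans hw); omega)).trans h1

theorem strip_both (h : cs.SM v φ) {u w : W} (huw : u ≼ w) (hw : w ≼ v) (hl : ℓ (φ u) < ℓ u) :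
    φ u ≼ φ w :=
  (h.le_or' huw hw).elim (fun h1 => (h.down (huw.trans hw) hl).trans h1) id

theorem coatom_cases (h : cs.SM v φ) {u z : W} (hu : u ≼ v) (hul : ℓ u < ℓ (φ u))
    (hz : z ≼ φ u) (hzl : ℓ (φ u) = ℓ z + 1) :
    z = u ∨ ∃ d, d ≼ u ∧ ℓ u = ℓ d + 1 ∧ ℓ (φ d) = ℓ d + 1 ∧ z = φ d := by
  have h1 := h.adj hu
  have hzv := hz.trans (h.le hu)
  rcases h.adj hzv with h2 | h2
  · left
    have := h.strip hz (h.le hu) (by omega)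
    rw [h.invol hu] at this
    exact eq_of_bruhatLE_of_length this (by omega)
  · right
    have := h.strip_both hz (h.le hu) (by omega)
    rw [h.invol hu] at this
    exact ⟨φ z, this, by omega, by rw [h.invol hzv]; omega, (h.invol hzv).symm⟩

theorem length_one (h : cs.SM v φ) : ℓ (φ 1) = 1 := by
  have := h.adj (one_bruhatLE v)
  rw [cs.length_one] at this
  omega

theorem letter_le_apply (h : cs.SM v φ) {u k : W} (hu : u ≼ v) (hk : ℓ k = 1) (hle : k ≼ φ u) :
    k ≼ u ∨ k = φ 1 := by
  have hkv := hle.trans (h.le hu)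
  have h1 := h.le_or' hle (h.le hu)
  rw [h.invol hu] at h1
  rcases h1 with h1 | h1
  · exact Or.inl h1
  · rcases h.adj hkv with h2 | h2
    · exact Or.inl ((h.up hkv h2).trans h1)
    · right
      rw [← h.invol hkv, eq_one_of_length (cs := cs) (u := φ k) (by omega)]

theorem inPar_apply (h : cs.SM v φ) {J : Set W} {u : W} (hu : u ≼ v) (hs : φ 1 ∈ J)
    (hJ : cs.InPar J u) : cs.InPar J (φ u) := fun k hk hle =>
  (h.letter_le_apply hu hk hle).elim (hJ k hk) fun h => h ▸ hs

theorem restrict (h : cs.SM v φ) {w : W} (hw : w ≼ v) (hl : ℓ (φ w) < ℓ w) : cs.SM w φ where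
  le hu := h.le_of_down hu hw hl
  invol hu := h.invol (hu.trans hw)
  adj hu := h.adj (hu.trans hw)
  up hu := h.up (hu.trans hw)
  special h1 h2 := h.special h1 (h2.trans hw)

theorem inv_le_iff {u w : W} : u⁻¹ ≼ w ↔ u ≼ w⁻¹ := by
  rw [← inv_bruhatLE_inv_iff, inv_inv]

theorem inv (h : cs.SM v φ) : cs.SM v⁻¹ (fun u => (φ u⁻¹)⁻¹) where
  le hu := inv_bruhatLE_inv (h.le (inv_le_iff.2 hu))
  invol {u} hu := by simp only [inv_inv]; rw [h.invol (inv_le_iff.2 hu), inv_inv]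
  adj {u} hu := by
    rw [cs.length_inv, ← cs.length_inv u]; exact h.adj (inv_le_iff.2 hu)
  up {u} hu hl := by
    rw [cs.length_inv, ← cs.length_inv u] at hl
    have := inv_bruhatLE_inv (h.up (inv_le_iff.2 hu) hl)
    rwa [inv_inv] at this
  special {u w} h1 h2 h3 h4 := by
    refine inv_bruhatLE_inv (h.special (inv_bruhatLE_inv h1) (inv_le_iff.2 h2) ?_ ?_)
    · rwa [cs.length_inv, cs.length_inv]
    · intro h5; exact h4 (by rw [h5, inv_inv])

end SM

theorem LS.ne_one {q : W} (h : cs.LS φ q) (hs : ℓ (φ 1) = 1) : q ≠ 1 := by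
  rintro rfl
  exact h.2 _ hs (one_mul _).symm

theorem RS.ne_one {q : W} (h : cs.RS φ q) (hs : ℓ (φ 1) = 1) : q ≠ 1 := by
  rintro rfl
  exact h.2 _ hs (mul_one _).symm

theorem ls_inv_iff {q : W} : cs.LS (fun u => (φ u⁻¹)⁻¹) q⁻¹ ↔ cs.RS φ q := by
  have key : ∀ j, ℓ j = 1 → ((φ q⁻¹⁻¹)⁻¹ = j * q⁻¹ ↔ φ q = q * j) := fun j hj => by
    rw [inv_inv, ← inv_mul_letter hj, inv_inj]
  have key' : ∀ j, ℓ j = 1 → ((φ q⁻¹⁻¹)⁻¹ = q⁻¹ * j ↔ φ q = j * q) := fun j hj => by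
    rw [inv_inv, ← inv_letter_mul hj, inv_inj]
  simp only [LS, RS, cs.length_inv]
  constructor
  · rintro ⟨⟨j, hj, h1, h2⟩, h3⟩
    exact ⟨⟨j, hj, (key j hj).1 h1, by simpa using h2⟩, fun k hk h => h3 k hk ((key' k hk).2 h)⟩
  · rintro ⟨⟨j, hj, h1, h2⟩, h3⟩
    exact ⟨⟨j, hj, (key j hj).2 h1, by simpa using h2⟩, fun k hk h => h3 k hk ((key' k hk).1 h)⟩

theorem rs_inv_iff {q : W} : cs.RS (fun u => (φ u⁻¹)⁻¹) q⁻¹ ↔ cs.LS φ q := by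
  rw [← ls_inv_iff]
  simp

namespace SM

/-- Structure of the shortest failure of `φ` to commute with a left multiplication. -/
theorem left_bad (h : cs.SM v φ) {g : W} (hg : ℓ g = 1)
    (hbad : ∃ u, ℓ u < ℓ (g * u) ∧ g * u ≼ v ∧ φ (g * u) ≠ g * φ u) :
    ∃ t x, ℓ t = 1 ∧ t ≠ φ 1 ∧ (g = φ 1 ∨ g = t) ∧ cs.Dih (φ 1) t x ∧ ℓ x < ℓ (g * x) ∧
      g * x ≼ v ∧ (x = 1 ∨ cs.RS φ x) ∧ cs.LS φ (g * x) := by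
  obtain ⟨u, ⟨hgu, hguv, hne⟩, hmin'⟩ := exists_min_length cs
    (S := {u | ℓ u < ℓ (g * u) ∧ g * u ≼ v ∧ φ (g * u) ≠ g * φ u}) hbad
  have hmin : ∀ e, ℓ e < ℓ u → ℓ e < ℓ (g * e) → g * e ≼ v → φ (g * e) = g * φ e := by
    intro e h1 h2 h3
    by_contra h4
    have := hmin' e ⟨h2, h3, h4⟩
    omega
  have hmin2 : ∀ d, ℓ d ≤ ℓ u → ℓ (g * d) < ℓ d → d ≼ v → φ d = g * φ (g * d) := by
    intro d h1 h2 h3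
    have := hmin (g * d) (by omega) (by rwa [letter_mul_cancel_left hg])
      (by rwa [letter_mul_cancel_left hg])
    rwa [letter_mul_cancel_left hg] at this
  have hgl := length_letter_mul hg u
  have hugu : u ≼ g * u := le_letter_mul hg hgu
  have huv := hugu.trans hguv
  have h1 : φ u ≠ g * u := by
    intro h1
    apply hne
    rw [← h1, h.invol huv, h1, letter_mul_cancel_left hg]
  have hup : ℓ (φ u) = ℓ u + 1 := by
    rcases h.adj huv with h2 | h2
    · exact h2
    · exfalso
      have hd := h.down huv (by omega)
      rcases length_letter_mul hg (φ u) with h3 | h3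
      · have := hmin (φ u) (by omega) (by omega) ((letter_mul_mono hg hd hgu).trans hguv)
        rw [h.invol huv] at this
        apply hne
        rw [← this, h.invol ((letter_mul_mono hg hd hgu).trans hguv)]
      · have := hmin2 (φ u) (by omega) (by omega) (h.le huv)
        rw [h.invol huv] at this
        have h4 : g * u = φ (g * φ u) := by
          conv_lhs => rw [this]
          rw [letter_mul_cancel_left hg]
        have h5 := h.adj (u := g * φ u) ((letter_mul_le hg (by omega)).trans (h.le huv))
        rw [← h4] at h5
        omega
  have hup2 : ℓ (φ (g * u)) = ℓ (g * u) + 1 := by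
    rcases h.adj hguv with h2 | h2
    · exact h2
    · exfalso
      have hz := h.down hguv (by omega)
      rcases length_letter_mul hg (φ (g * u)) with h3 | h3
      · have h4 := strip_left hg hz (by omega)
        rw [letter_mul_cancel_left hg] at h4
        have h5 := eq_of_bruhatLE_of_length h4 (by omega)
        apply h1
        rw [← h5, h.invol hguv, h5]
      · have h4 := hmin2 _ (by omega) (by omega) (h.le hguv)
        rw [h.invol hguv, mul_right_inj] at h4
        have h5 := h.adj (u := g * φ (g * u))
          ((letter_mul_le hg (by omega)).trans (h.le hguv))
        have h6 := h.invol (u := g * φ (g * u))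
          ((letter_mul_le hg (by omega)).trans (h.le hguv))
        rw [← h4] at h6
        rw [h6] at hup
        omega
  have hgp : ℓ (g * φ u) = ℓ (φ u) + 1 := by
    rcases length_letter_mul hg (φ u) with h2 | h2
    · exact h2
    · exfalso
      have h3 := eq_of_bruhatLE_of_length (strip_left hg (h.up huv hup) hgu) (by omega)
      apply h1
      rw [h3, letter_mul_cancel_left hg, ← h3]
  have hc1 : ∀ z, z ≼ φ (g * u) → ℓ (φ (g * u)) = ℓ z + 1 → z ≼ g * φ u := by
    intro z hz hzl
    rcases h.coatom_cases hguv (by omega) hz hzl with rfl | ⟨d, hd, hdl, hdu, rfl⟩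
    · exact letter_mul_mono hg (h.up huv hup) (by omega)
    · rcases length_letter_mul hg d with h2 | h2
      · have h3 := strip_left hg hd (by omega)
        rw [letter_mul_cancel_left hg] at h3
        rw [eq_of_bruhatLE_of_length h3 (by omega)]
        exact le_letter_mul hg (by omega)
      · rw [hmin2 d (by omega) (by omega) (hd.trans hguv)]
        have h3 := strip_both_left hg hd (by omega)
        rw [letter_mul_cancel_left hg] at h3
        exact letter_mul_mono hg (h.mono_up h3 huv (by omega)) (by omega)
  have hc2 : ∀ z, z ≼ g * φ u → ℓ (g * φ u) = ℓ z + 1 → z ≼ φ (g * u) := by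
    intro z hz hzl
    rcases length_letter_mul hg z with h2 | h2
    · have h3 := strip_left hg hz (by omega)
      rw [letter_mul_cancel_left hg] at h3
      rw [eq_of_bruhatLE_of_length h3 (by omega)]
      exact h.mono_up hugu hguv (by omega)
    · have h3 := strip_both_left hg hz (by omega)
      rw [letter_mul_cancel_left hg] at h3
      rcases h.coatom_cases huv (by omega) h3 (by omega) with h4 | ⟨d, hd, hdl, hdu, h4⟩
      · rw [← letter_mul_cancel_left hg z, h4]
        exact h.up hguv hup2
      · have hz' : z = g * φ d := by rw [← h4, letter_mul_cancel_left hg]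
        rcases length_letter_mul hg d with h5 | h5
        · have h6 := letter_mul_mono hg hd hgu
          rw [hz', ← hmin d (by omega) (by omega) (h6.trans hguv)]
          exact h.mono_up h6 hguv (by omega)
        · exfalso
          have h6 := hmin2 d (by omega) (by omega) (hd.trans huv)
          have h7 : z = φ (g * d) := by
            rw [hz', h6, letter_mul_cancel_left hg]
          have h8 := h.adj (u := g * d)
            ((letter_mul_le hg (by omega)).trans (hd.trans huv))
          rw [← h7] at h8
          omega
  have hx1 : φ (g * u) ≠ 1 := by
    intro h2; rw [h2] at hup2; simp at hup2
  obtain ⟨p, p', hp, hp', hpx, hpy, hdx, hdy⟩ :=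
    exists_dih_of_coatoms hne (by omega) hx1 hc1 hc2
  have hpp : p ≠ p' := by
    rintro rfl
    exact hne (Dih.eq_of_right hdx hdy (by omega) hp hpx hpy)
  have hdgu : cs.Dih p p' (g * u) := hdx.mono (h.up hguv hup2)
  have hsm : φ 1 ∈ ({p, p'} : Set W) := hdx _ h.length_one
    (h.mono_up (one_bruhatLE _) hguv (by omega))
  have hgm : g ∈ ({p, p'} : Set W) := hdgu.left_mem hg
    (by rw [letter_mul_cancel_left hg]; omega)
  obtain ⟨t, ht, hts, hJ⟩ : ∃ t, ℓ t = 1 ∧ t ≠ φ 1 ∧ ({p, p'} : Set W) = {φ 1, t} := by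
    rcases hsm with h2 | h2
    · exact ⟨p', hp', by rw [h2]; exact hpp.symm, by rw [h2]⟩
    · exact ⟨p, hp, by rw [h2]; exact hpp, by rw [h2, Set.pair_comm]⟩
  rw [Dih, hJ] at hdgu hdx hdy
  rw [hJ] at hgm
  have hdu := hdgu.mono hugu
  have hdφ := hdx.mono (h.mono_up hugu hguv (by omega))
  refine ⟨t, u, ht, hts, hgm, hdu, hgu, hguv, ?_, ?_⟩
  · by_cases hu1 : u = 1
    · exact Or.inl hu1
    · right
      have hnl : ∀ j, ℓ j = 1 → φ u ≠ j * u := by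
        intro j hj h2
        obtain ⟨k, hk, hku⟩ := exists_left_descent (cs := cs) hu1
        have hkm := hdu.left_mem hk hku
        have hjm := hdφ.left_mem hj (by rw [h2, letter_mul_cancel_left hj, ← h2]; omega)
        have hjg : j ≠ g := by rintro rfl; exact h1 h2
        have hkg : k ≠ g := by rintro rfl; omega
        have hjk : j ≠ k := by rintro rfl; rw [← h2] at hku; omega
        rcases hgm with rfl | rfl <;> rcases hkm with rfl | rfl <;>
          rcases hjm with rfl | rfl <;> contradiction
      refine ⟨?_, hnl⟩
      rcases Dih.cover hdu hdφ hup with ⟨k, hk, -, h2⟩ | ⟨k, hk, -, h2⟩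
      · exact absurd h2 (hnl k hk)
      · exact ⟨k, hk, h2, hup⟩
  · have hnr : ∀ j, ℓ j = 1 → φ (g * u) ≠ g * u * j := by
      intro j hj h2
      apply hne
      refine Dih.eq_of_left hdx hdy (by omega) hg ?_ (by rw [letter_mul_cancel_left hg]; omega)
      rw [h2, mul_assoc, letter_mul_cancel_left hg, ← mul_assoc, ← h2]
      have := length_mul_letter hj u
      omega
    refine ⟨?_, hnr⟩
    rcases Dih.cover hdgu hdx hup2 with ⟨k, hk, -, h2⟩ | ⟨k, hk, -, h2⟩
    · exact ⟨k, hk, h2, hup2⟩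
    · exact absurd h2 (hnr k hk)

theorem right_bad (h : cs.SM v φ) {g : W} (hg : ℓ g = 1)
    (hbad : ∃ u, ℓ u < ℓ (u * g) ∧ u * g ≼ v ∧ φ (u * g) ≠ φ u * g) :
    ∃ t x, ℓ t = 1 ∧ t ≠ φ 1 ∧ (g = φ 1 ∨ g = t) ∧ cs.Dih (φ 1) t x ∧ ℓ x < ℓ (x * g) ∧
      x * g ≼ v ∧ (x = 1 ∨ cs.LS φ x) ∧ cs.RS φ (x * g) := by
  have hs : (φ 1⁻¹)⁻¹ = φ 1 := by rw [inv_one, letter_inv h.length_one]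
  obtain ⟨u, h1, h2, h3⟩ := hbad
  obtain ⟨t, x, ht, hts, hgt, hd, hl, hle, hx, hgx⟩ := h.inv.left_bad hg
    ⟨u⁻¹, by rwa [length_letter_mul_inv hg, cs.length_inv],
      by rw [← inv_mul_letter hg]; exact inv_bruhatLE_inv h2, by
      intro h4
      apply h3
      simp only [← inv_mul_letter hg, inv_inv, inv_inj] at h4
      exact h4⟩
  simp only [hs] at hts hgt hd
  refine ⟨t, x⁻¹, ht, hts, hgt, hd.inv, ?_, ?_, ?_, ?_⟩
  · rwa [length_inv_mul_letter hg, cs.length_inv]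
  · rw [← inv_letter_mul hg]; exact inv_le_iff.2 hle
  · rcases hx with rfl | hx
    · exact Or.inl inv_one
    · right; rw [← rs_inv_iff, inv_inv]; exact hx
  · rw [← ls_inv_iff, inv_mul_letter hg, inv_inv]; exact hgx

end SM

end

section

variable {cs} {v : W} {φ : W → W}

theorem not_mem_pair {α : Type*} {s t r : α} (hrs : r ≠ s) (hrt : r ≠ t) : r ∉ ({s, t} : Set α) := by
  simp [hrs, hrt]

theorem LS.data {q j : W} (hq : cs.LS φ q) (hj : φ q = j * q) :
    ℓ j = 1 ∧ ℓ (φ q) = ℓ q + 1 ∧ ∀ k, ℓ k = 1 → j * q ≠ q * k := by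
  obtain ⟨⟨j', hj', h1, h2⟩, h3⟩ := hq
  have : j = j' := mul_right_cancel (hj.symm.trans h1)
  subst this
  exact ⟨hj', h2, fun k hk => hj ▸ h3 k hk⟩

theorem RS.data {q j : W} (hq : cs.RS φ q) (hj : φ q = q * j) :
    ℓ j = 1 ∧ ℓ (φ q) = ℓ q + 1 ∧ ∀ k, ℓ k = 1 → q * j ≠ k * q := by
  obtain ⟨⟨j', hj', h1, h2⟩, h3⟩ := hq
  have : j = j' := mul_left_cancel (hj.symm.trans h1)
  subst this
  exact ⟨hj', h2, fun k hk => hj ▸ h3 k hk⟩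

theorem length_mul_mod (a b c : W) : (ℓ (a * c) + ℓ (c⁻¹ * b)) % 2 = ℓ (a * b) % 2 := by
  have h := cs.length_mul_mod_two (a * c) (c⁻¹ * b)
  have : a * c * (c⁻¹ * b) = a * b := by group
  rw [this] at h
  exact h.symm

/-- Refinement of `exists_transfer`: the two products may be taken to be reduced. -/
theorem exists_refactor {a b γ₁ γ₂ r : W} (hr : ℓ r = 1) (ha : ¬ r ≼ a) (hb : ¬ r ≼ b)
    (h1 : ¬ r ≼ γ₁) (h2 : ¬ r ≼ γ₂) (h : a * r * b ≼ γ₁ * r * γ₂)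
    (hl : ℓ γ₁ + ℓ γ₂ ≤ ℓ (a * b) + 1) :
    ∃ a' b', a' * b' = a * b ∧ a' * r * b' = a * r * b ∧ ℓ (a' * b') = ℓ a' + ℓ b' ∧
      a' ≼ γ₁ ∧ b' ≼ γ₂ := by
  obtain ⟨c, hc, hcr, hc1, hc2⟩ := exists_transfer hr ha hb h1 h2 h
  have h3 := commute_of_letters hcr
  have h4 : a * c * (c⁻¹ * b) = a * b := by group
  refine ⟨a * c, c⁻¹ * b, h4, ?_, ?_, hc1, hc2⟩
  · rw [mul_assoc a c r, h3]; group
  · have h5 := length_mul_mod (cs := cs) a b c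
    have h6 := length_le_of_bruhatLE hc1
    have h7 := length_le_of_bruhatLE hc2
    have h8 := cs.length_mul_le (a * c) (c⁻¹ * b)
    rw [h4] at h8 ⊢
    omega

namespace SM

theorem insert_left (h : cs.SM v φ) {s t q j α β r : W} (hs : φ 1 = s)
    (hd : cs.Dih s t q) (hq : cs.LS φ q) (hj : φ q = j * q) (hαβ : q = α * β)
    (hl : ℓ q = ℓ α + ℓ β) (hr : ℓ r = 1) (hrs : r ≠ s) (hrt : r ≠ t) (hv : α * r * β ≼ v) :
    ℓ (α * r * β) = ℓ q + 1 ∧ ℓ (φ (α * r * β)) = ℓ q + 2 ∧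
    (φ (α * r * β) = j * (α * r * β) ∨
      α * r * β = r * (α * β) ∧ φ (α * r * β) = r * (j * (α * β))) := by
  have hrn := not_mem_pair hrs hrt
  obtain ⟨hjl, hup, hnr⟩ := hq.data hj
  have hα : cs.Dih s t α := hd.mono (hαβ ▸ left_le_mul (by rw [← hαβ, hl]))
  have hβ : cs.Dih s t β := hd.mono (hαβ ▸ right_le_mul (by rw [← hαβ, hl]))
  have hrα := hα.not_le hr hrn
  have hrβ := hβ.not_le hr hrn
  obtain ⟨hul, hle⟩ := length_insert hr hrα hrβ (by rw [← hαβ, hl])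
  rw [← hαβ] at hle
  have hqv := hle.trans hv
  have hdφ : cs.Dih s t (φ q) := h.inPar_apply hqv (hs ▸ Or.inl rfl) hd
  have hrφ := hdφ.not_le hr hrn
  have hru : r ≼ α * r * β := by
    have h1 := length_insert hr hrα hrβ (by rw [← hαβ, hl])
    have h2 := length_mul_of_not_le hr hrα
    exact (right_le_mul (x := α) (y := r) (by omega)).trans (left_le_mul (by omega))
  have hul2 : ℓ (φ (α * r * β)) = ℓ q + 2 := by
    rcases h.adj hv with h1 | h1
    · omega
    · exfalso
      have h2 := eq_of_bruhatLE_of_length (h.strip hle hv (by omega)) (by omega)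
      rw [h2, h.invol hv] at hrφ
      exact hrφ hru
  refine ⟨by omega, hul2, ?_⟩
  have hm := h.mono_up hle hv (by omega)
  obtain ⟨γ₁, γ₂, hw, hz, hzl, hr1, hr2⟩ := exists_insertion_of_cover hr hm (by omega) hrφ
    (hru.trans (h.up hv (by omega)))
  have huw := h.up hv (by omega)
  rw [hw] at huw
  obtain ⟨a, b, hab, harb, habl, ha, hb⟩ := exists_refactor hr hrα hrβ hr1 hr2 huw
    (by rw [← hαβ]; omega)
  rw [hw, ← harb, ← hab]
  rw [← hαβ] at hab
  rw [hab] at habl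
  have hal := length_le_of_bruhatLE ha
  have hbl := length_le_of_bruhatLE hb
  have hda : cs.Dih s t a := hd.mono (hab ▸ left_le_mul (by rw [hab, habl]))
  have hγ : γ₁ * γ₂ = j * (a * b) := by rw [← hz, hj, hab]
  by_cases hbγ : ℓ b = ℓ γ₂
  · have := eq_of_bruhatLE_of_length hb (by omega)
    subst this
    left
    have : γ₁ = j * a := by
      rw [← mul_assoc] at hγ; exact mul_right_cancel hγ
    rw [this]; group
  · have := eq_of_bruhatLE_of_length ha (by omega)
    subst this
    have hdγ : cs.Dih s t γ₂ := hdφ.mono (hz ▸ right_le_mul (by rw [← hz]; omega))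
    have hdb : cs.Dih s t b := hdγ.mono hb
    by_cases ha1 : a = 1
    · right
      subst ha1
      rw [one_mul, one_mul] at hγ
      rw [hγ]
      simp
    · exfalso
      obtain ⟨k, hk, hka⟩ := exists_left_descent (cs := cs) ha1
      obtain ⟨k', hk', -, h1⟩ := Dih.cover_right hd hdφ hup hk
        (by
          have := cs.length_mul_le (k * a) b
          rw [mul_assoc, hab] at this; omega)
        (by
          have := cs.length_mul_le (k * a) γ₂
          rw [mul_assoc, ← hz] at this; omega)
      rw [hj] at h1
      exact hnr k' hk' h1

theorem inv_one_eq (h : cs.SM v φ) {s : W} (hs : φ 1 = s) : (fun u => (φ u⁻¹)⁻¹) 1 = s := by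
  simp only [inv_one]
  rw [letter_inv h.length_one, hs]

theorem insert_right (h : cs.SM v φ) {s t q j α β r : W} (hs : φ 1 = s)
    (hd : cs.Dih s t q) (hq : cs.RS φ q) (hj : φ q = q * j) (hαβ : q = α * β)
    (hl : ℓ q = ℓ α + ℓ β) (hr : ℓ r = 1) (hrs : r ≠ s) (hrt : r ≠ t) (hv : α * r * β ≼ v) :
    ℓ (α * r * β) = ℓ q + 1 ∧ ℓ (φ (α * r * β)) = ℓ q + 2 ∧
    (φ (α * r * β) = α * r * β * j ∨
      α * r * β = α * β * r ∧ φ (α * r * β) = α * β * j * r) := by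
  have hjl := (hq.data hj).1
  have he : (α * r * β)⁻¹ = β⁻¹ * r * α⁻¹ := by
    rw [mul_inv_rev, mul_inv_rev, letter_inv hr, mul_assoc]
  have h2 := h.inv.insert_left (h.inv_one_eq hs) hd.inv (ls_inv_iff.2 hq) (j := j)
    (by simp only [inv_inv]; rw [hj, inv_mul_letter hjl]) (α := β⁻¹) (β := α⁻¹)
    (by rw [hαβ, mul_inv_rev]) (by simp only [cs.length_inv]; omega) hr hrs hrt
    (by rw [← he]; exact inv_bruhatLE_inv hv)
  simp only [← he, inv_inv, cs.length_inv, ← mul_inv_rev] at h2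
  obtain ⟨h3, h4, h5⟩ := h2
  refine ⟨h3, h4, ?_⟩
  rcases h5 with h5 | ⟨h5, h6⟩
  · left
    rwa [← inv_mul_letter hjl, inv_inj] at h5
  · right
    rw [← inv_mul_letter hr, inv_inj] at h5
    rw [← inv_mul_letter hjl, ← inv_mul_letter hr, inv_inj] at h6
    exact ⟨h5, h6⟩

theorem mul_letters_bad (h : cs.SM v φ) {s t x g α β r : W} (hs : φ 1 = s)
    (hx : cs.RS φ x) (hgx : cs.LS φ (g * x)) (hg : ℓ g = 1) (hlt : ℓ x < ℓ (g * x))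
    (hd : cs.Dih s t (g * x)) (hαβ : x = α * β) (hl : ℓ x = ℓ α + ℓ β) (hr : ℓ r = 1)
    (hrs : r ≠ s) (hrt : r ≠ t) (hv : g * α * r * β ≼ v) (hne : r * β ≠ β * r) :
    α = 1 ∧ g * r = r * g := by
  have hrn := not_mem_pair hrs hrt
  have hgl := length_letter_mul hg x
  have hdx : cs.Dih s t x := hd.mono (le_letter_mul hg hlt)
  have hgm := hd.left_mem hg (by rw [letter_mul_cancel_left hg]; omega)
  have hα : cs.Dih s t α := hdx.mono (hαβ ▸ left_le_mul (by rw [← hαβ, hl]))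
  have hβ : cs.Dih s t β := hdx.mono (hαβ ▸ right_le_mul (by rw [← hαβ, hl]))
  obtain ⟨j, hj, hφ, hφl⟩ := hgx.1
  obtain ⟨k, hk, hψ, hψl⟩ := hx.1
  have hgα := length_letter_mul hg α
  have hgab : g * x = g * α * β := by rw [hαβ, mul_assoc]
  have hgab' := cs.length_mul_le (g * α) β
  rw [← hgab] at hgab'
  obtain ⟨h1, h2, h3⟩ := h.insert_left hs hd hgx hφ hgab (by omega) hr hrs hrt hv
  have hu : ℓ (α * r * β) = ℓ x + 1 := by
    have := (length_insert hr (hα.not_le hr hrn) (hβ.not_le hr hrn) (by rw [← hαβ, hl])).1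
    omega
  have he : g * α * r * β = g * (α * r * β) := by group
  have hle : α * r * β ≼ g * α * r * β := by
    rw [he] at h1 ⊢
    exact le_letter_mul hg (by omega)
  obtain ⟨-, h5, h6⟩ := h.insert_right hs hdx hx hψ hαβ hl hr hrs hrt (hle.trans hv)
  have h6' : φ (α * r * β) = α * r * β * k := by
    rcases h6 with h6 | ⟨h6, -⟩
    · exact h6
    · exfalso; apply hne
      rwa [mul_assoc, mul_assoc, mul_right_inj] at h6
  have hm := h.mono_up hle hv (by omega)
  have hkm : k ∈ ({s, t} : Set W) := by
    have hxv : x ≼ v := by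
      rw [hαβ]
      exact ((length_insert hr (hα.not_le hr hrn) (hβ.not_le hr hrn)
        (by rw [← hαβ, hl])).2.trans hle).trans hv
    have := h.inPar_apply hxv (hs ▸ Or.inl rfl) hdx
    refine this.right_mem hk ?_
    rw [hψ, letter_mul_cancel_right hk, ← hψ]
    omega
  have hboth : ¬ ∀ p ∈ ({s, t} : Set W), p * r = r * p := fun hc =>
    hne (commute_of_letters fun p hp hle => hc p (hβ p hp hle)).symm
  rcases h3 with h3 | ⟨h3, -⟩
  · exfalso
    rw [h6', h3, show α * r * β * k = α * r * (β * k) by group,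
      show j * (g * α * r * β) = (j * g * α) * r * β by group] at hm
    have hjm : j ∈ ({s, t} : Set W) := by
      have hxv : g * x ≼ v := by
        rw [hgab]
        exact (length_insert hr (((inPar_letter hg hgm).mul hα).not_le hr hrn)
          (hβ.not_le hr hrn) (by rw [← hgab]; omega)).2.trans hv
      have := h.inPar_apply hxv (hs ▸ Or.inl rfl) hd
      refine this.left_mem hj ?_
      rw [hφ, letter_mul_cancel_left hj, ← hφ]
      omega
    obtain ⟨c, hc, hcr, hc1, hc2⟩ := exists_transfer hr (hα.not_le hr hrn)
      ((hβ.mul (inPar_letter hk hkm)).not_le hr hrn)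
      ((((inPar_letter hj hjm).mul (inPar_letter hg hgm)).mul hα).not_le hr hrn)
      (hβ.not_le hr hrn) hm
    have hβk : ℓ (β * k) = ℓ β + 1 := by
      have h7 := length_mul_letter hk β
      have h8 := cs.length_mul_le α (β * k)
      rw [← mul_assoc, ← hαβ, ← hψ] at h8
      omega
    have hdc : cs.Dih s t c := by
      have := (hα.inv).mul (((((inPar_letter hj hjm).mul (inPar_letter hg hgm)).mul hα)).mono hc1)
      rwa [inv_mul_cancel_left] at this
    have hc1' : c ≠ 1 := by
      rintro rfl
      have := length_le_of_bruhatLE hc2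
      rw [inv_one, one_mul] at this
      omega
    obtain ⟨p, hp, hpc⟩ := exists_left_descent (cs := cs) hc1'
    have hpm := hdc.left_mem hp hpc
    have hpr := hcr p hp (left_descent_le hp hpc)
    have hcp : c = p := by
      by_contra hcp
      have h7 : p * c ≠ 1 := by
        intro h7; apply hcp; rw [← letter_mul_cancel_left hp c, h7, mul_one]
      obtain ⟨p', hp', hpc'⟩ := exists_left_descent (cs := cs) h7
      have hple := left_descent_le hp' hpc'
      have hpm' := hdc p' hp' (hple.trans (letter_mul_le hp hpc))
      have hpr' := hcr p' hp' (hple.trans (letter_mul_le hp hpc))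
      have hpp : p ≠ p' := by
        rintro rfl
        rw [letter_mul_cancel_left hp] at hpc'; omega
      apply hboth
      rintro x hx
      rcases hpm with rfl | rfl <;> rcases hpm' with rfl | rfl <;> rcases hx with rfl | rfl <;>
        first | assumption | contradiction
    subst hcp
    rw [letter_inv hp] at hc2
    have h7 := length_letter_mul hp (β * k)
    have h8 := length_le_of_bruhatLE hc2
    have h9 := eq_of_bruhatLE_of_length hc2 (by omega)
    have h10 : β * k = c * β := by rw [← h9, letter_mul_cancel_left hp, h9]
    have hβ1 : β ≠ 1 := by rintro rfl; simp at hne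
    obtain ⟨m, hm, hmβ⟩ := exists_right_descent (cs := cs) hβ1
    have hxk : x * k = α * c * β := by rw [hαβ, mul_assoc, h10, mul_assoc]
    have h11 := Dih.cover_right (cs := cs) (u := x⁻¹) (w := (x * k)⁻¹) hdx.inv
      (hdx.mul (inPar_letter hk hkm)).inv
      (by rw [cs.length_inv, cs.length_inv, ← hψ]; exact hψl) hm
      (by
        rw [length_letter_mul_inv hm, cs.length_inv, hαβ, mul_assoc, ← hαβ]
        have := cs.length_mul_le α (β * m)
        omega)
      (by
        rw [length_letter_mul_inv hm, cs.length_inv]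
        have h12 := cs.length_mul_le (α * c) (β * m)
        have h13 := cs.length_mul_le α c
        rw [← mul_assoc, ← hxk] at h12
        rw [← hψ] at h12 ⊢
        omega)
    obtain ⟨m', hm', -, h12⟩ := h11
    rw [← inv_letter_mul hm', inv_inj] at h12
    exact hx.2 m' hm' (hψ.trans h12)
  · have hga : ¬ r ≼ g * α := ((inPar_letter hg hgm).mul hα).not_le hr hrn
    have h7 : g * α * r = r * (g * α) := by
      rw [← mul_assoc r, mul_left_inj] at h3
      exact h3
    have h8 := letters_commute_of_mul_eq hr hga h7
    have h9 : g * r = r * g := h8 g hg (left_descent_le hg (by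
      rw [letter_mul_cancel_left hg]; omega))
    refine ⟨?_, h9⟩
    by_contra hα1
    obtain ⟨p, hp, hpα⟩ := exists_left_descent (cs := cs) hα1
    have hpm := hα.left_mem hp hpα
    have h10 := h8 p hp ((left_descent_le hp hpα).trans (le_letter_mul hg (by omega)))
    have hgp : g ≠ p := by rintro rfl; omega
    apply hboth
    rintro x hx
    rcases hgm with rfl | rfl <;> rcases hpm with rfl | rfl <;> rcases hx with rfl | rfl <;>
        first | assumption | contradiction

end SM

end

section

variable {cs} {v : W} {φ : W → W}

theorem not_le_letter {k k' : W} (hk : ℓ k = 1) (hk' : ℓ k' = 1) (h : k ≠ k') : ¬ k ≼ k' :=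
  fun hle => h (letter_le_letter hk hk' hle)

theorem length_mul_letters {k k' : W} (hk : ℓ k = 1) (hk' : ℓ k' = 1) (h : k ≠ k') :
    ℓ (k * k') = 2 := by
  rw [length_letter_mul_of_not_le hk (not_le_letter hk hk' h), hk']

theorem length_conj {s a : W} (hs : ℓ s = 1) (ha : ℓ a = 1) (h : s * a ≠ a * s) :
    ℓ (s * a * s) = 3 := by
  have hsa : s ≠ a := by rintro rfl; exact h rfl
  have h1 := length_mul_letters hs ha hsa
  rcases length_mul_letter hs (s * a) with h2 | h2
  · omega
  · exfalso
    have h3 : ℓ (s * a * s) = 1 := by omega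
    have h4 := mul_letter_le hs (u := s * a) (by omega)
    rcases letter_le_mul h3 h4 with h5 | h5
    · have := letter_le_letter h3 hs h5
      rw [mul_eq_right] at this
      rw [this] at h1; simp at h1
    · have := letter_le_letter h3 ha h5
      apply h
      rw [← letter_mul_cancel_right hs (s * a), this]

theorem le_of_le_mul_letter {r x y : W} (hr : ℓ r = 1) (h : x ≼ y * r) (hx : ¬ r ≼ x) : x ≼ y := by
  obtain ⟨x', r', h1, h2, rfl, hl⟩ := exists_mul_of_le_mul h
  rcases le_letter hr h2 with rfl | rfl
  · rwa [mul_one]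
  · exact absurd (right_le_mul hl) hx

theorem not_le_letter_one {r : W} (hr : ℓ r = 1) : ¬ r ≼ 1 := fun h => by
  have := length_le_of_bruhatLE h
  rw [cs.length_one] at this
  omega

theorem not_letter_mul_le {r s x : W} (hr : ℓ r = 1) (hs : ℓ s = 1) (hne : r * s ≠ s * r)
    (hx : ¬ r ≼ x) : ¬ r * s ≼ x * r := by
  intro h
  have hrs : r ≠ s := by rintro rfl; exact hne rfl
  obtain ⟨c, hc, hcr, hc1, hc2⟩ := exists_transfer (a := 1) (b := s) (γ₁ := x) (γ₂ := 1) hr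
    (not_le_letter_one hr) (not_le_letter hr hs hrs) hx (not_le_letter_one hr)
    (by simpa using h)
  have h1 := eq_one_of_length (cs := cs) (u := c⁻¹ * s)
    (by have := length_le_of_bruhatLE hc2; rw [cs.length_one] at this; omega)
  have h2 : c = s := by rwa [inv_mul_eq_one] at h1
  subst h2
  exact hne (hcr c hs (bruhatLE_refl _)).symm

theorem RS.not_ls {q : W} (h : cs.RS φ q) : ¬ cs.LS φ q := fun h' => by
  obtain ⟨⟨j, hj, h1, -⟩, -⟩ := h
  exact h'.2 j hj h1

namespace SM

/-- The possible values of a special matching at a letter. -/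
theorem letter_cases (h : cs.SM v φ) {s r : W} (hs : φ 1 = s) (hr : ℓ r = 1) (hrs : r ≠ s)
    (hrv : r ≼ v) : φ r = r * s ∨ φ r = s * r := by
  have hs1 : ℓ s = 1 := hs ▸ h.length_one
  have hup : ℓ (φ r) = 2 := by
    rcases h.adj hrv with h1 | h1
    · omega
    · exfalso
      have := eq_one_of_length (cs := cs) (u := φ r) (by omega)
      rw [← h.invol hrv, this] at hrs
      exact hrs hs
  have hsle : s ≼ φ r := hs ▸ h.mono_up (one_bruhatLE r) hrv (by omega)
  have hd : cs.Dih s r r := inPar_letter hr (Or.inr rfl)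
  have hd' : cs.Dih s r (φ r) := h.inPar_apply hrv (hs ▸ Or.inl rfl) hd
  rcases Dih.cover hd hd' (by omega) with ⟨k, hk, -, h1⟩ | ⟨k, hk, -, h1⟩
  · right
    rw [h1] at hsle ⊢
    rcases letter_le_mul hs1 hsle with h2 | h2
    · rw [letter_le_letter hs1 hk h2]
    · exact absurd (letter_le_letter hs1 hr h2).symm hrs
  · left
    rw [h1] at hsle ⊢
    rcases letter_le_mul hs1 hsle with h2 | h2
    · exact absurd (letter_le_letter hs1 hr h2).symm hrs
    · rw [letter_le_letter hs1 hk h2]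

theorem rs_ne (h : cs.SM v φ) {s r : W} (hs : φ 1 = s) (hrs : cs.RS φ r) : r ≠ s := by
  rintro rfl
  obtain ⟨⟨j, hj, h1, h2⟩, -⟩ := hrs
  rw [← hs, h.invol (one_bruhatLE v), cs.length_one] at h2
  omega

theorem ls_ne (h : cs.SM v φ) {s r : W} (hs : φ 1 = s) (hrs : cs.LS φ r) : r ≠ s := by
  rintro rfl
  obtain ⟨⟨j, hj, h1, h2⟩, -⟩ := hrs
  rw [← hs, h.invol (one_bruhatLE v), cs.length_one] at h2
  omega

theorem rs_letter (h : cs.SM v φ) {s r : W} (hs : φ 1 = s) (hr : ℓ r = 1)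
    (hrv : r ≼ v) (hrs : cs.RS φ r) : φ r = r * s ∧ r * s ≠ s * r ∧ r ≠ s := by
  have hs1 : ℓ s = 1 := hs ▸ h.length_one
  have hne := h.rs_ne hs hrs
  rcases h.letter_cases hs hr hne hrv with h1 | h1
  · exact ⟨h1, fun h2 => hrs.2 s hs1 (h1.trans h2), hne⟩
  · exact absurd h1 (hrs.2 s hs1)

theorem ls_letter (h : cs.SM v φ) {s r : W} (hs : φ 1 = s) (hr : ℓ r = 1)
    (hrv : r ≼ v) (hrs : cs.LS φ r) : φ r = s * r ∧ r * s ≠ s * r ∧ r ≠ s := by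
  have hs1 : ℓ s = 1 := hs ▸ h.length_one
  have hne := h.ls_ne hs hrs
  rcases h.letter_cases hs hr hne hrv with h1 | h1
  · exact absurd h1 (hrs.2 s hs1)
  · exact ⟨h1, fun h2 => hrs.2 s hs1 (h1.trans h2.symm), hne⟩

theorem letter_trichotomy (h : cs.SM v φ) {s r : W} (hs : φ 1 = s) (hr : ℓ r = 1) (hrs : r ≠ s)
    (hrv : r ≼ v) : cs.RS φ r ∨ cs.LS φ r ∨ r * s = s * r := by
  have hs1 : ℓ s = 1 := hs ▸ h.length_one
  by_cases hc : r * s = s * r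
  · exact Or.inr (Or.inr hc)
  have h2 : ℓ r + 1 = 2 := by omega
  have hrs2 := length_mul_letters hr hs1 hrs
  have hsr2 := length_mul_letters hs1 hr hrs.symm
  rcases h.letter_cases hs hr hrs hrv with h1 | h1
  · left
    refine ⟨⟨s, hs1, h1, by rw [h1]; omega⟩, fun k hk h3 => ?_⟩
    have h4 : s ≼ k * r := h3 ▸ h1 ▸ right_le_mul (by omega)
    rcases letter_le_mul hs1 h4 with h5 | h5
    · exact hc (by rw [← h1, h3, ← letter_le_letter hs1 hk h5])
    · exact hrs (letter_le_letter hs1 hr h5).symm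
  · right; left
    refine ⟨⟨s, hs1, h1, by rw [h1]; omega⟩, fun k hk h3 => ?_⟩
    have h4 : s ≼ r * k := h3 ▸ h1 ▸ left_le_mul (by omega)
    rcases letter_le_mul hs1 h4 with h5 | h5
    · exact hrs (letter_le_letter hs1 hr h5).symm
    · exact hc (by rw [← h1, h3, ← letter_le_letter hs1 hk h5])

end SM

end

section

variable {cs} {v : W} {φ : W → W}

namespace SM

/-- A left-acting dihedral element cannot be followed by a right-acting letter. -/
theorem ls_mul_rs_letter (h : cs.SM v φ) {s t q r : W} (hs : φ 1 = s) (hd : cs.Dih s t q)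
    (hq : cs.LS φ q) (hsq : s ≼ q) (hr : ℓ r = 1) (hrs : cs.RS φ r) (hrt : r ≠ t) :
    ¬ q * r ≼ v := by
  intro hv
  have hs1 : ℓ s = 1 := hs ▸ h.length_one
  obtain ⟨⟨j, hj, hφ, hφl⟩, -⟩ := id hq
  have hrs' := h.rs_ne hs hrs
  have hrn := not_mem_pair hrs' hrt
  have hrq := hd.not_le hr hrn
  have hqr := length_mul_of_not_le hr hrq
  have hle := right_le_mul (cs := cs) (x := q) (y := r) (by omega)
  have hqle := le_mul_letter hr (u := q) (by omega)
  obtain ⟨h1, h2, -⟩ := h.rs_letter hs hr (hle.trans hv) hrs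
  obtain ⟨h3, h4, h5⟩ := h.insert_left hs hd hq hφ (mul_one q).symm (by simp) hr hrs' hrt
    (by rwa [mul_one])
  simp only [mul_one] at h3 h4 h5
  have h6 := h.mono_up hle hv (by omega)
  rw [h1] at h6
  rcases h5 with h5 | ⟨h5, -⟩
  · rw [h5, ← mul_assoc, ← hφ] at h6
    exact not_letter_mul_le hr hs1 h2 ((h.inPar_apply (hqle.trans hv) (hs ▸ Or.inl rfl)
      hd).not_le hr hrn) h6
  · exact h2 (letters_commute_of_mul_eq hr hrq h5 s hs1 hsq).symm

/-- A left-acting letter and a right-acting letter commute. -/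
theorem ls_mul_rs (h : cs.SM v φ) {s c a : W} (hs : φ 1 = s) (hc : ℓ c = 1) (ha : ℓ a = 1)
    (hcl : cs.LS φ c) (har : cs.RS φ a) (hv : c * a ≼ v) :
    c * a = a * c ∧ φ (c * a) = a * s * c := by
  have hs1 : ℓ s = 1 := hs ▸ h.length_one
  have hca : c ≠ a := by rintro rfl; exact har.not_ls hcl
  have hl := length_mul_letters hc ha hca
  have hcle := left_le_mul (cs := cs) (x := c) (y := a) (by omega)
  have hale := right_le_mul (cs := cs) (x := c) (y := a) (by omega)
  obtain ⟨h1, h2, hcs⟩ := h.ls_letter hs hc (hcle.trans hv) hcl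
  obtain ⟨h3, h4, has⟩ := h.rs_letter hs ha (hale.trans hv) har
  obtain ⟨h5, h6, h7⟩ := h.insert_left (t := c) hs (inPar_letter hc (Or.inr rfl)) hcl h1
    (mul_one c).symm (by simp) ha has hca.symm (by rwa [mul_one])
  simp only [mul_one] at h5 h6 h7
  rcases h7 with h7 | ⟨h7, h8⟩
  · exfalso
    have h8 := h.mono_up hale hv (by omega)
    rw [h3, h7, ← mul_assoc] at h8
    exact not_letter_mul_le ha hs1 h4 (not_letter_le_mul ha (not_le_letter ha hs1 has)
      (not_le_letter ha hc hca.symm)) h8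
  · exact ⟨h7, by rw [h8, mul_assoc]⟩

theorem not_ls_one_rs (h : cs.SM v φ) {s c a : W} (hs : φ 1 = s) (hc : ℓ c = 1) (ha : ℓ a = 1)
    (hcl : cs.LS φ c) (har : cs.RS φ a) : ¬ c * s * a ≼ v := by
  intro hv
  have hs1 : ℓ s = 1 := hs ▸ h.length_one
  have hca : c ≠ a := by rintro rfl; exact har.not_ls hcl
  have hac := hca.symm
  have ha' : ¬ a ≼ c := not_le_letter ha hc hac
  have hcs := h.ls_ne hs hcl
  have has := h.rs_ne hs har
  have hcsl := length_mul_letters hc hs1 hcs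
  have hacs : ¬ a ≼ c * s := not_letter_le_mul ha ha' (not_le_letter ha hs1 has)
  have hasc : ¬ a ≼ s * c := not_letter_le_mul ha (not_le_letter ha hs1 has) ha'
  have hl3 := length_mul_of_not_le ha hacs
  have hcale : c * a ≼ c * s * a := mul_le_mul_of_additive
    (left_le_mul (by omega)) (bruhatLE_refl a) (by omega)
  obtain ⟨h1, h2⟩ := h.ls_mul_rs hs hc ha hcl har (hcale.trans hv)
  have hcal := length_mul_letters hc ha hca
  have hcle := left_le_mul (cs := cs) (x := c) (y := a) (by omega)
  have hale := right_le_mul (cs := cs) (x := c) (y := a) (by omega)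
  obtain ⟨h3, h4, -⟩ := h.ls_letter hs hc ((hcle.trans hcale).trans hv) hcl
  obtain ⟨h5, h6, -⟩ := h.rs_letter hs ha ((hale.trans hcale).trans hv) har
  have hscl := length_mul_letters hs1 hc hcs.symm
  have hl3' := length_letter_mul_of_not_le ha hasc
  rw [mul_assoc] at h2
  have hne : c * s * a ≠ a * (s * c) := by
    intro h7
    have : a * s ≼ c * s * a := by
      rw [h7, ← mul_assoc]
      refine left_le_mul ?_
      rw [mul_assoc, length_mul_letters ha hs1 has]; omega
    exact not_letter_mul_le ha hs1 h6 hacs this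
  have hcs' : c * s ≠ s * c := h4
  have hup : ℓ (φ (c * s * a)) = 4 := by
    rcases h.adj hv with h7 | h7
    · omega
    · exfalso
      have h8 := eq_of_bruhatLE_of_length (h.strip hcale hv (by rw [h2]; omega)) (by omega)
      apply hne
      rw [← h2, h8, h.invol hv]
  have hw := h.up hv (by omega)
  have hw2 := h.mono_up hcale hv (by omega)
  rw [h2] at hw2
  set w := φ (c * s * a) with hwdef
  obtain ⟨k, hk, hkw⟩ := exists_left_descent (cs := cs) (u := w)
    (by rintro h7; rw [h7] at hup; simp at hup)
  have hkl := length_letter_mul hk w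
  have hkm : k = s ∨ k = c ∨ k = a := by
    rcases h.letter_le_apply hv hk (left_descent_le hk hkw) with h7 | h7
    · rcases letter_le_mul hk h7 with h7 | h7
      · rcases letter_le_mul hk h7 with h7 | h7
        · exact Or.inr (Or.inl (letter_le_letter hk hc h7))
        · exact Or.inl (letter_le_letter hk hs1 h7)
      · exact Or.inr (Or.inr (letter_le_letter hk ha h7))
    · exact Or.inl (h7.trans hs)
  have hconj := length_conj hs1 hc hcs'.symm
  have hconj2 := length_conj hs1 ha h6.symm
  have hconj3 := length_conj ha hs1 h6
  have hconj4 := length_conj hc hs1 hcs'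
  rcases hkm with rfl | rfl | rfl
  · have e1 : ℓ (k * (c * k * a)) = 4 := by
      rw [← mul_assoc, ← mul_assoc, length_mul_of_not_le ha, hconj]
      exact not_letter_le_mul ha hasc (not_le_letter ha hk has)
    have e2 : ℓ (k * (a * (k * c))) = 4 := by
      rw [← mul_assoc, ← mul_assoc, length_mul_of_not_le hc, hconj2]
      have := not_le_letter hc hk hcs
      exact not_letter_le_mul hc (not_letter_le_mul hc this (not_le_letter hc ha hca)) this
    have e3 := eq_of_bruhatLE_of_length (strip_left hk hw (by omega)) (by omega)
    have e4 := eq_of_bruhatLE_of_length (strip_left hk hw2 (by omega)) (by omega)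
    exact hne (e3.trans e4.symm)
  · have e2 : ℓ (k * (a * (s * k))) = 4 := by
      rw [← mul_assoc, h1, mul_assoc, length_letter_mul_of_not_le ha, ← mul_assoc, hconj4]
      exact not_letter_le_mul ha ha' hasc
    have e3 := eq_of_bruhatLE_of_length (strip_left hk hw2 (by omega)) (by omega)
    have e1 : ℓ (k * (k * s * a)) = 2 := by
      rw [mul_assoc, letter_mul_cancel_left hk, length_mul_letters hs1 ha has.symm]
    have e4 := strip_both_left hk hw (by omega)
    rw [mul_assoc, letter_mul_cancel_left hk, ← e3, ← mul_assoc] at e4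
    have e5 := le_of_le_mul_letter hk e4 (not_letter_le_mul hk (not_le_letter hk hs1 hcs)
      (not_le_letter hk ha hca))
    exact h6 (eq_of_bruhatLE_of_length e5 (by
      rw [length_mul_letters hs1 ha has.symm, length_mul_letters ha hs1 has])).symm
  · have e2 : ℓ (k * (c * s * k)) = 4 := by
      rw [mul_assoc, ← mul_assoc, ← h1, mul_assoc, length_letter_mul_of_not_le hc,
        ← mul_assoc, hconj3]
      have := not_le_letter hc ha hca
      exact not_letter_le_mul hc this (not_letter_le_mul hc (not_le_letter hc hs1 hcs) this)
    have e3 := eq_of_bruhatLE_of_length (strip_left hk hw (by omega)) (by omega)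
    have e4 := strip_both_left hk hw2 (by rw [letter_mul_cancel_left hk]; omega)
    rw [letter_mul_cancel_left hk, ← e3] at e4
    have e5 := le_of_le_mul_letter hk e4 hasc
    exact hcs' (eq_of_bruhatLE_of_length e5 (by omega)).symm

end SM

end

section

/-- `q` is a shortest left-acting element of the dihedral subgroup of `s` and the right-acting
letter `t`. -/
structure MinLS (v : W) (φ : W → W) (s t q : W) : Prop where
  letter : ℓ t = 1
  rs : cs.RS φ t
  dih : cs.Dih s t q
  le : q ≼ v
  ls : cs.LS φ q
  min : ∀ z, cs.Dih s t z → z ≼ v → cs.LS φ z → ℓ q ≤ ℓ z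

variable {cs} {v : W} {φ : W → W}

theorem InPar.eq_of_singleton {s y : W} (h : cs.InPar {s} y) : y = 1 ∨ y = s := by
  by_cases hy : y = 1
  · exact Or.inl hy
  right
  obtain ⟨k, hk, hky⟩ := exists_left_descent (cs := cs) hy
  obtain rfl : k = s := h.left_mem hk hky
  by_cases hz : k * y = 1
  · rw [← letter_mul_cancel_left hk y, hz, mul_one]
  · obtain ⟨p, hp, hpy⟩ := exists_left_descent (cs := cs) hz
    obtain rfl : p = k := (h.mono (letter_mul_le hk hky)).left_mem hp hpy
    rw [letter_mul_cancel_left hp] at hpy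
    omega

theorem Dih.inter {s t r y : W} (h : cs.Dih s t y) (h' : cs.Dih s r y) (htr : t ≠ r) :
    y = 1 ∨ y = s := by
  refine InPar.eq_of_singleton (cs := cs) fun k hk hle => ?_
  rcases h k hk hle with h1 | h1
  · exact h1
  · rcases h' k hk hle with h2 | h2
    · exact h2
    · exact absurd (h1.symm.trans h2) htr

theorem exists_minLS {s t q : W} (ht : ℓ t = 1) (hrt : cs.RS φ t)
    (hd : cs.Dih s t q) (hq : q ≼ v) (hls : cs.LS φ q) : ∃ q₀, q₀ ≼ q ∧ cs.MinLS v φ s t q₀ := by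
  obtain ⟨q₀, ⟨h1, h2, h3⟩, h4⟩ := exists_min_length cs
    (S := {z | cs.Dih s t z ∧ z ≼ v ∧ cs.LS φ z}) ⟨q, hd, hq, hls⟩
  by_cases hlt : ℓ q₀ < ℓ q
  · exact ⟨q₀, h1.le_of_length_lt hd hlt, ht, hrt, h1, h2, h3, fun z a b c => h4 z ⟨a, b, c⟩⟩
  · exact ⟨q, bruhatLE_refl q, ht, hrt, hd, hq, hls, fun z a b c =>
      (not_lt.1 hlt).trans (h4 z ⟨a, b, c⟩)⟩

namespace MinLS

variable {s t q : W}

theorem apply_of_lt (hm : cs.MinLS v φ s t q) (h : cs.SM v φ) (hs : φ 1 = s) {z : W}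
    (hz : cs.Dih s t z) (hl : ℓ z < ℓ q) : φ z = z * s := by
  have hs1 : ℓ s = 1 := hs ▸ h.length_one
  induction hn : ℓ z using Nat.strong_induction_on generalizing z with
  | _ n ih =>
    have hzv := (hz.le_of_length_lt hm.dih hl).trans hm.le
    rcases length_mul_letter hs1 z with h1 | h1
    · by_cases hz1 : z = 1
      · rw [hz1, one_mul, hs]
      have hdφ := h.inPar_apply hzv (hs ▸ Or.inl rfl) hz
      rcases h.adj hzv with h2 | h2
      · rcases Dih.cover hz hdφ h2 with ⟨k, hk, hkm, h3⟩ | ⟨k, hk, hkm, h3⟩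
        · by_contra h4
          refine absurd (hm.min z hz hzv ⟨⟨k, hk, h3, h2⟩, fun p hp h5 => ?_⟩) (by omega)
          rcases hdφ.right_mem hp (by rw [h5, letter_mul_cancel_right hp, ← h5]; omega)
            with rfl | hpt
          · exact h4 h5
          · obtain ⟨p', hp', h6⟩ := exists_right_descent (cs := cs) hz1
            rcases hz.right_mem hp' h6 with rfl | h7
            · omega
            · rw [h7, ← hpt, ← h5] at h6; omega
        · rcases hkm with rfl | hkm
          · exact h3
          · obtain ⟨p', hp', h6⟩ := exists_right_descent (cs := cs) hz1
            rcases hz.right_mem hp' h6 with rfl | h7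
            · omega
            · rw [h7, ← hkm, ← h3] at h6; omega
      · have h3 := ih (ℓ (φ z)) (by omega) hdφ (by omega) rfl
        rw [h.invol hzv] at h3
        rw [h3, letter_mul_cancel_right hs1, ← h3] at h1
        omega
    · have h2 := ih (ℓ (z * s)) (by omega) (hz.mono (mul_letter_le hs1 (by omega))) (by omega) rfl
      rw [letter_mul_cancel_right hs1] at h2
      rw [← h2, h.invol ((mul_letter_le hs1 (by omega)).trans hzv), h2]

theorem lt_mul (hm : cs.MinLS v φ s t q) (h : cs.SM v φ) (hs : φ 1 = s) : ℓ q < ℓ (q * s) := by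
  have hs1 : ℓ s = 1 := hs ▸ h.length_one
  by_contra h1
  have h2 := length_mul_letter hs1 q
  have h3 := mul_letter_le hs1 (u := q) (by omega)
  have h4 := hm.apply_of_lt h hs (hm.dih.mono h3) (by omega)
  rw [letter_mul_cancel_right hs1] at h4
  have h5 := h.invol (h3.trans hm.le)
  rw [h4] at h5
  obtain ⟨⟨j, -, -, h6⟩, -⟩ := hm.ls
  rw [h5] at h6
  omega

theorem ne_one (hm : cs.MinLS v φ s t q) (h : cs.SM v φ) : q ≠ 1 := hm.ls.ne_one h.length_one

theorem mul_lt (hm : cs.MinLS v φ s t q) (h : cs.SM v φ) (hs : φ 1 = s) : ℓ (q * t) < ℓ q := by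
  obtain ⟨k, hk, hkq⟩ := exists_right_descent (cs := cs) (hm.ne_one h)
  have h1 := hm.lt_mul h hs
  rcases hm.dih.right_mem hk hkq with rfl | rfl
  · omega
  · exact hkq

theorem s_le (hm : cs.MinLS v φ s t q) (h : cs.SM v φ) (hs : φ 1 = s) : s ≼ q := by
  have hs1 : ℓ s = 1 := hs ▸ h.length_one
  by_contra h1
  have h2 : cs.InPar {t} q := fun k hk hle => by
    rcases hm.dih k hk hle with rfl | h3
    · exact absurd hle h1
    · exact h3
  rcases h2.eq_of_singleton with h3 | h3
  · exact hm.ne_one h h3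
  · exact (h3 ▸ hm.rs : cs.RS φ q).not_ls hm.ls

end MinLS

namespace SM

theorem not_two_minLS (h : cs.SM v φ) {s t r q q' : W} (hs : φ 1 = s) (htr : t ≠ r)
    (hm : cs.MinLS v φ s t q) (hm' : cs.MinLS v φ s r q') {u : W} (hu : u ≼ v) (hqu : q ≼ u) :
    ¬ q' ≼ u := by
  intro hqu'
  have aux : ∀ {t r q q' u : W}, t ≠ r → cs.MinLS v φ s t q → cs.MinLS v φ s r q' → u ≼ v →
      q' ≼ u → ℓ (u * t) < ℓ u → False := by
    intro t r q q' u htr hm hm' hu hqu' hl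
    have h1 := hm'.dih.not_le hm.letter (not_mem_pair (h.rs_ne hs hm.rs) htr)
    have h2 := strip_right hm.letter hqu' (by
      rw [length_mul_of_not_le hm.letter h1]; omega)
    have h3 := mul_letter_mono hm.letter h2 (by rwa [letter_mul_cancel_right hm.letter])
    rw [letter_mul_cancel_right hm.letter] at h3
    exact h.ls_mul_rs_letter hs hm'.dih hm'.ls (hm'.s_le h hs) hm.letter hm.rs htr (h3.trans hu)
  have aux2 : ∀ {t q u k : W}, cs.MinLS v φ s t q → q ≼ u → ℓ k = 1 → k ≠ t → q ≼ u * k := by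
    intro t q u k hm hqu hk hkt
    refine strip_right hk hqu ?_
    by_cases hks : k = s
    · rw [hks]; exact hm.lt_mul h hs
    · rw [length_mul_of_not_le hk (hm.dih.not_le hk (not_mem_pair hks hkt))]; omega
  induction hn : ℓ u using Nat.strong_induction_on generalizing u with
  | _ n ih =>
    have hu1 : u ≠ 1 := by
      rintro rfl
      exact hm.ne_one h (bruhatLE_antisymm hqu (one_bruhatLE q))
    obtain ⟨k, hk, hku⟩ := exists_right_descent (cs := cs) hu1
    by_cases hkt : k = t
    · exact aux htr hm hm' hu hqu' (hkt ▸ hku)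
    by_cases hkr : k = r
    · exact aux htr.symm hm' hm hu hqu (hkr ▸ hku)
    exact ih (ℓ (u * k)) (by omega) ((mul_letter_le hk hku).trans hu) (aux2 hm hqu hk hkt)
      (aux2 hm' hqu' hk hkr) rfl

end SM

/-- A product of two dihedral elements lies below any common upper bound that avoids
certain short elements. -/
theorem dih_mul_le {s t r q q' u : W} (hs : ℓ s = 1) (ht : ℓ t = 1) (hr : ℓ r = 1)
    (hts : t ≠ s) (hrs : r ≠ s) (hrt : r ≠ t) (hq1 : q ≠ 1) (hd : cs.Dih s t q)
    (hqs : ℓ q < ℓ (q * s)) (hd' : cs.Dih s r q') (hq' : ℓ (r * q') < ℓ q')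
    (hsq' : ℓ q' < ℓ (s * q')) (hrt_comm : r * t ≼ u → r * t = t * r) (hrst : ¬ r * s * t ≼ u)
    (hqu : q ≼ u) (hqu' : q' ≼ u) : q * q' ≼ u := by
  induction hn : ℓ u using Nat.strong_induction_on generalizing u q with
  | _ n ih =>
    have hu1 : u ≠ 1 := by
      rintro rfl
      exact hq1 (bruhatLE_antisymm hqu (one_bruhatLE q))
    obtain ⟨k, hk, hku⟩ := exists_left_descent (cs := cs) hu1
    have hku' : ℓ (k * u) < ℓ (k * (k * u)) := by rwa [letter_mul_cancel_left hk]
    have hkle := letter_mul_le hk hku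
    have hqt : ℓ (q * t) < ℓ q := by
      obtain ⟨p, hp, hpq⟩ := exists_right_descent (cs := cs) hq1
      rcases hd.right_mem hp hpq with rfl | rfl
      · omega
      · exact hpq
    by_cases hkr : k = r
    · subst hkr
      have h1 : q ≼ k * u := strip_left hk hqu (by
        rw [length_letter_mul_of_not_le hk (hd.not_le hk (not_mem_pair hrs hrt))]; omega)
      have h2 := strip_both_left hk hqu' hq'
      have htle := (right_descent_le ht hqt).trans h1
      have h3 := letter_mul_mono hk htle hku'
      rw [letter_mul_cancel_left hk] at h3
      have hcomm := hrt_comm h3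
      have hst : ¬ s * t ≼ k * u := fun h4 => by
        have h5 := letter_mul_mono hk h4 hku'
        rw [letter_mul_cancel_left hk, ← mul_assoc] at h5
        exact hrst h5
      have hqt' : q = t := by
        by_cases h4 : q * t = 1
        · rw [← letter_mul_cancel_right ht q, h4, one_mul]
        · exfalso
          obtain ⟨p, hp, hpq⟩ := exists_right_descent (cs := cs) h4
          rcases (hd.mono (mul_letter_le ht hqt)).right_mem hp hpq with rfl | rfl
          · apply hst
            refine bruhatLE.trans ?_ h1
            have h5 : q = q * t * p * (p * t) := by
              rw [← mul_assoc, letter_mul_cancel_right hp, letter_mul_cancel_right ht]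
            have h6 := length_mul_letter ht q
            have h7 := length_mul_letter hp (q * t)
            rw [h5]
            refine right_le_mul (cs := cs) ?_
            rw [← h5, length_mul_letters hp ht hts.symm]
            omega
          · rw [letter_mul_cancel_right hp] at hpq; omega
      subst hqt'
      have hdβ : cs.Dih s k (k * q') := hd'.mono (letter_mul_le hk hq')
      have hqβ := hdβ.not_le ht (not_mem_pair hts hrt.symm)
      obtain ⟨α, β, h4, h5, h6⟩ := exists_insertion ht h2 htle hqβ
      by_cases hα : α = 1
      · subst hα
        rw [one_mul] at h4 h6
        rw [← h4] at h6
        have h7 := letter_mul_mono hk h6 hku'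
        rwa [letter_mul_cancel_left hk, ← mul_assoc, hcomm, mul_assoc,
          letter_mul_cancel_left hk] at h7
      · exfalso
        obtain ⟨p, hp, hpα⟩ := exists_left_descent (cs := cs) hα
        have h7 : ℓ (p * (k * q')) < ℓ (k * q') := by
          have := cs.length_mul_le (p * α) β
          rw [mul_assoc, ← h4] at this
          omega
        have hps : p = s := by
          rcases hdβ.left_mem hp h7 with h8 | h8
          · exact h8
          · rw [h8, letter_mul_cancel_left hk] at h7; omega
        subst hps
        have hqα : ¬ q ≼ α := fun h8 => hqβ (h4 ▸ h8.trans (left_le_mul (by rw [← h4, h5])))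
        have hqβ' : ¬ q ≼ β := fun h8 => hqβ (h4 ▸ h8.trans (right_le_mul (by rw [← h4, h5])))
        have h8 := (length_insert ht hqα hqβ' (by rw [← h4, h5])).1
        have h9 := length_mul_of_not_le ht hqα
        apply hst
        exact ((mul_le_mul_of_additive (left_descent_le hp hpα) (bruhatLE_refl q)
          (by omega)).trans (left_le_mul (by omega))).trans h6
    · have hkq' : ℓ q' < ℓ (k * q') := by
        by_cases hks : k = s
        · rwa [hks]
        · rw [length_letter_mul_of_not_le hk (hd'.not_le hk (not_mem_pair hks hkr))]; omega
      have h1 := strip_left hk hqu' hkq'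
      rcases length_letter_mul hk q with h2 | h2
      · exact (ih (ℓ (k * u)) (by omega) hq1 hd hqs (fun h3 => hrt_comm (h3.trans hkle))
          (fun h3 => hrst (h3.trans hkle)) (strip_left hk hqu (by omega)) h1 rfl).trans hkle
      · by_cases hkq : k * q = 1
        · have := letter_mul_mono hk h1 hku'
          rw [letter_mul_cancel_left hk] at this
          rwa [← letter_mul_cancel_left hk q, hkq, mul_one]
        · have h3 := ih (ℓ (k * u)) (by omega) hkq (hd.mono (letter_mul_le hk (by omega))) (by
            have h4 := length_letter_mul hk (q * s)
            have h5 := length_mul_letter hs q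
            rw [mul_assoc]
            omega) (fun h3 => hrt_comm (h3.trans hkle))
            (fun h3 => hrst (h3.trans hkle)) (strip_both_left hk hqu (by omega)) h1 rfl
          have := letter_mul_mono hk h3 hku'
          rwa [letter_mul_cancel_left hk, mul_assoc, letter_mul_cancel_left hk] at this

end

section

variable {cs} {v : W} {φ : W → W}

namespace SM

theorem right_descent_of_ls (h : cs.SM v φ) {q k : W} (hqv : q ≼ v) (hq : cs.LS φ q) (hk : ℓ k = 1)
    (hd : ℓ (φ q * k) < ℓ (φ q)) : ℓ (q * k) < ℓ q := by
  obtain ⟨⟨j, hj, h1, h2⟩, h3⟩ := hq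
  by_contra h4
  have h5 := length_mul_letter hk q
  have h6 := strip_right hk (h.up hqv h2) (by omega)
  have h7 := length_mul_letter hk (φ q)
  have h8 := eq_of_bruhatLE_of_length h6 (by omega)
  exact h3 k hk (by rw [← letter_mul_cancel_right hk (φ q), ← h8])

theorem left_descent_of_rs (h : cs.SM v φ) {q k : W} (hqv : q ≼ v) (hq : cs.RS φ q) (hk : ℓ k = 1)
    (hd : ℓ (k * φ q) < ℓ (φ q)) : ℓ (k * q) < ℓ q := by
  obtain ⟨⟨j, hj, h1, h2⟩, h3⟩ := hq
  by_contra h4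
  have h5 := length_letter_mul hk q
  have h6 := strip_left hk (h.up hqv h2) (by omega)
  have h7 := length_letter_mul hk (φ q)
  have h8 := eq_of_bruhatLE_of_length h6 (by omega)
  exact h3 k hk (by rw [← letter_mul_cancel_left hk (φ q), ← h8])

theorem not_ls_apply_le (h : cs.SM v φ) {s t r q q' : W} (hs : φ 1 = s) (hd : cs.Dih s t q)
    (hq : cs.LS φ q) (hqv : q ≼ v) (htr : t ≠ r) (hd' : cs.Dih s r q') : ¬ φ q ≼ q * q' := by
  intro h1
  have hs1 : ℓ s = 1 := hs ▸ h.length_one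
  obtain ⟨⟨j, hj, h3, h2⟩, h4⟩ := hq
  obtain ⟨x, y, hx, hy, hxy, hl⟩ := exists_mul_of_le_mul h1
  have hdφ : cs.Dih s t (φ q) := h.inPar_apply hqv (hs ▸ Or.inl rfl) hd
  have hyy : y = 1 ∨ y = s :=
    Dih.inter (hdφ.mono (hxy ▸ right_le_mul (by rw [← hxy, hl]))) (hd'.mono hy) htr
  have hxl := length_le_of_bruhatLE hx
  rcases hyy with rfl | rfl
  · rw [cs.length_one] at hl; omega
  · rw [hs1] at hl
    have := eq_of_bruhatLE_of_length hx (by omega)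
    subst this
    exact h4 y hs1 hxy

theorem not_rs_apply_le (h : cs.SM v φ) {s t r q q' : W} (hs : φ 1 = s) (hd : cs.Dih s t q)
    (htr : t ≠ r) (hd' : cs.Dih s r q') (hq' : cs.RS φ q') (hqv : q' ≼ v) : ¬ φ q' ≼ q * q' := by
  intro h1
  refine h.inv.not_ls_apply_le (h.inv_one_eq hs) hd'.inv (ls_inv_iff.2 hq') (inv_bruhatLE_inv hqv)
    htr.symm hd.inv ?_
  simp only [inv_inv]
  rw [← mul_inv_rev]
  exact inv_bruhatLE_inv h1

theorem not_minLS_minRS (h : cs.SM v φ) {s t r q q' : W} (hs : φ 1 = s)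
    (hm : cs.MinLS v φ s t q) : ¬ cs.MinLS v⁻¹ (fun u => (φ u⁻¹)⁻¹) s r q'⁻¹ := by
  intro hm'
  have hs1 : ℓ s = 1 := hs ▸ h.length_one
  have hi := h.inv_one_eq hs
  have ht := hm.letter
  have hr := hm'.letter
  have hrl : cs.LS φ r := by rw [← rs_inv_iff, letter_inv hr]; exact hm'.rs
  have htr := hm.rs
  have hrt : r ≠ t := by rintro rfl; exact htr.not_ls hrl
  have hts := h.rs_ne hs htr
  have hrs := h.ls_ne hs hrl
  have hd := hm.dih
  have hd' : cs.Dih s r q' := by have := hm'.dih.inv; rwa [inv_inv] at this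
  have hqv := hm.le
  have hqv' : q' ≼ v := inv_bruhatLE_inv_iff.1 hm'.le
  have hrs' : cs.RS φ q' := ls_inv_iff.1 hm'.ls
  have hrq' : ℓ (r * q') < ℓ q' := by
    have := hm'.mul_lt h.inv hi
    rwa [length_inv_mul_letter hr, cs.length_inv] at this
  have hsq' : ℓ q' < ℓ (s * q') := by
    have := hm'.lt_mul h.inv hi
    rwa [length_inv_mul_letter hs1, cs.length_inv] at this
  have hsq := hm.lt_mul h hs
  have hq1 := hm.ne_one h
  have hrq := hd.not_le hr (not_mem_pair hrs hrt)
  have htq' := hd'.not_le ht (not_mem_pair hts hrt.symm)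
  have key : ∀ u, u ≼ v → q ≼ u → q' ≼ u → q * q' ≼ u := fun u hu h1 h2 =>
    dih_mul_le hs1 ht hr hts hrs hrt hq1 hd hsq hd' hrq' hsq'
      (fun h3 => (h.ls_mul_rs hs hr ht hrl htr (h3.trans hu)).1)
      (fun h3 => h.not_ls_one_rs hs hr ht hrl htr (h3.trans hu)) h1 h2
  have hQv := key v (bruhatLE_refl v) hqv hqv'
  have hQl : ℓ (q * q') = ℓ q + ℓ q' := by
    refine additive_of_no_descent_left (cs := cs) (J := {s, t}) ?_ hd
    rintro k (rfl | rfl) hk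
    · exact hsq'
    · rw [length_letter_mul_of_not_le hk htq']; omega
  have hqQ := left_le_mul hQl
  have hqQ' := right_le_mul hQl
  have hn1 := h.not_ls_apply_le hs hd hm.ls hqv hrt.symm hd'
  have hn2 := h.not_rs_apply_le hs hd hrt.symm hd' hrs' hqv'
  obtain ⟨⟨j, hj, hφ, hφl⟩, hnr⟩ := id hm.ls
  obtain ⟨⟨j', hj', hφ', hφl'⟩, hnl'⟩ := id hrs'
  have hup : ℓ (φ (q * q')) = ℓ (q * q') + 1 := by
    rcases h.adj hQv with h1 | h1
    · exact h1
    · exact absurd (h.le_of_down hqQ hQv (by omega)) hn1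
  have hw1 := h.mono_up hqQ hQv (by omega)
  have hw2 := h.mono_up hqQ' hQv (by omega)
  have tool : ∀ z, z ≼ φ (q * q') → ℓ (φ (q * q')) = ℓ z + 1 → z ≠ q * q' → q ≼ z →
      φ q' ≼ z → False := by
    intro z hz hzl hzQ h2 h3
    have hzv := hz.trans (h.le hQv)
    rcases h.coatom_cases hQv (by omega) hz hzl with h1 | ⟨d, hd1, hd2, hd3, rfl⟩
    · exact hzQ h1
    · have hdv := hd1.trans hQv
      have h4 := h.strip h2 hzv (by omega)
      have h5 := h.strip_both h3 hzv (by rw [h.invol hqv']; omega)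
      rw [h.invol hdv] at h4 h5
      rw [h.invol hqv'] at h5
      have := length_le_of_bruhatLE (key d hdv h4 h5)
      omega
  obtain ⟨k, hk, hkw⟩ := exists_left_descent (cs := cs) (u := φ (q * q'))
    (by intro h1; rw [h1] at hup; simp at hup)
  have hkl := length_letter_mul hk (φ (q * q'))
  have hzle := letter_mul_le hk hkw
  have hkφ' : k ≠ r → ℓ (φ q') < ℓ (k * φ q') := by
    intro hkr
    by_contra h1
    have h2 := length_letter_mul hk (φ q')
    have h3 := h.left_descent_of_rs hqv' hrs' hk (by omega)
    rcases hd'.left_mem hk h3 with rfl | h4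
    · omega
    · exact hkr h4
  by_cases hkr : k = r
  · subst hkr
    have hdφ : cs.Dih s t (φ q) := h.inPar_apply hqv (hs ▸ Or.inl rfl) hd
    have h1 : φ q ≼ k * φ (q * q') := strip_left hk hw1 (by
      rw [length_letter_mul_of_not_le hk (hdφ.not_le hk (not_mem_pair hrs hrt))]; omega)
    have h2 : k * φ (q * q') ≠ q * q' := fun h3 => hn1 (h3 ▸ h1)
    have h3 : ℓ (k * (q * q')) < ℓ (q * q') := by
      by_contra h4
      have h5 := length_letter_mul hk (q * q')
      exact h2 (eq_of_bruhatLE_of_length (strip_left hk (h.up hQv hup) (by omega))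
        (by omega)).symm
    have h4 := letter_mul_le_of_descent hk hqQ h3
    have hrql := length_letter_mul_of_not_le hk hrq
    obtain ⟨x, y, hx, hy, hxy, hl⟩ := exists_mul_of_le_mul h4
    have hy1 : y ≠ 1 := by
      rintro rfl
      rw [cs.length_one] at hl
      have := length_le_of_bruhatLE hx
      omega
    obtain ⟨p, hp, hpy⟩ := exists_right_descent (cs := cs) hy1
    have h5 : ℓ (k * q * p) < ℓ (k * q) := by
      have := cs.length_mul_le x (y * p)
      rw [← mul_assoc, ← hxy] at this
      omega
    rcases (hd'.mono hy).right_mem hp hpy with rfl | rfl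
    · rw [mul_assoc, length_letter_mul_of_not_le hk] at h5
      · omega
      · exact not_letter_le_mul hk hrq (not_le_letter hk hp hrs)
    · have h6 := length_mul_of_not_le hk hrq
      have h7 := strip_right hk (le_letter_mul hk (u := q) (by omega)) (by omega)
      have h8 := length_mul_letter hk (p * q)
      have h9 := eq_of_bruhatLE_of_length h7 (by omega)
      have h10 : q * p = p * q := by rw [← letter_mul_cancel_right hk (p * q), ← h9]
      have h11 := letters_commute_of_mul_eq hk hrq h10 s hs1 (hm.s_le h hs)
      have h12 := h.ls_letter hs hk ((left_descent_le hk hrq').trans hqv') hrl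
      exact h12.2.1 h11.symm
  have h2 := strip_left hk hw2 (hkφ' hkr)
  have h3 : k * φ (q * q') ≠ q * q' := fun h3 => hn2 (h3 ▸ h2)
  refine tool _ hzle (by omega) h3 ?_ h2
  by_cases hkj : k = j
  · subst hkj
    have := strip_both_left hk hw1 (by rw [hφ, letter_mul_cancel_left hk, ← hφ]; omega)
    rwa [hφ, letter_mul_cancel_left hk] at this
  · refine (h.up hqv hφl).trans (strip_left hk hw1 ?_)
    by_contra h4
    have h5 := length_letter_mul hk (φ q)
    have hdφ : cs.Dih s t (φ q) := h.inPar_apply hqv (hs ▸ Or.inl rfl) hd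
    obtain ⟨p, hp, hpq⟩ := exists_left_descent (cs := cs) hq1
    have hpm := hd.left_mem hp hpq
    have hkm := hdφ.left_mem hk (by omega)
    have hjφ : j * φ q = q := by rw [hφ, letter_mul_cancel_left hj]
    have hjm := hdφ.left_mem hj (by rw [hjφ]; omega)
    have hpj : p ≠ j := by rintro rfl; rw [← hφ] at hpq; omega
    have hpk : p = k := by
      rcases hpm with rfl | rfl <;> rcases hkm with rfl | rfl <;> rcases hjm with rfl | rfl <;>
        first | rfl | contradiction
    subst hpk
    obtain ⟨p', hp', -, h6⟩ := Dih.cover_right hd hdφ hφl hp hpq (by omega)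
    exact hnr p' hp' h6

end SM

end

section

variable {cs} {v : W} {φ : W → W}

/-- `exists_transfer` for dihedral factors and a letter `r` not commuting with `t`. -/
theorem Dih.transfer {s t r a b γ₁ γ₂ : W} (hs : ℓ s = 1) (hr : ℓ r = 1)
    (hrs : r ≠ s) (hrt : r ≠ t) (hne : r * t ≠ t * r) (ha : cs.Dih s t a) (hb : cs.Dih s t b)
    (h1 : cs.Dih s t γ₁) (h2 : cs.Dih s t γ₂) (h : a * r * b ≼ γ₁ * r * γ₂) :
    (a ≼ γ₁ ∧ b ≼ γ₂) ∨ (a * s ≼ γ₁ ∧ s * b ≼ γ₂) := by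
  have hrn := not_mem_pair hrs hrt
  obtain ⟨c, hc, hcr, hc1, hc2⟩ := exists_transfer hr (ha.not_le hr hrn) (hb.not_le hr hrn)
    (h1.not_le hr hrn) (h2.not_le hr hrn) h
  have hdc : cs.Dih s t c := by
    have := ha.inv.mul (h1.mono hc1)
    rwa [inv_mul_cancel_left] at this
  have hcs : cs.InPar {s} c := fun k hk hle => by
    rcases hdc k hk hle with h3 | h3
    · exact h3
    · exact absurd (hcr k hk hle) (h3 ▸ hne.symm)
  rcases hcs.eq_of_singleton with rfl | rfl
  · left; simpa using And.intro hc1 hc2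
  · right; rw [letter_inv hs] at hc2; exact ⟨hc1, hc2⟩

theorem Dih.le_of_descents {s t u x : W} (hs : ℓ (u * s) < ℓ u) (ht : ℓ (u * t) < ℓ u)
    (hx : cs.Dih s t x) : x ≼ u := by
  induction x using right_induction (cs := cs) with
  | h1 => exact one_bruhatLE u
  | hs k x hk hl ih =>
    have h1 := ih (hx.mono (le_mul_letter hk (by omega)))
    refine mul_letter_le_of_descent hk h1 ?_
    rcases hx.right_mem hk (by rw [letter_mul_cancel_right hk]; omega) with rfl | rfl
    · exact hs
    · exact ht

theorem not_letter_mul_mul_le {s t r x : W} (hs : ℓ s = 1) (hr : ℓ r = 1) (ht : ℓ t = 1)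
    (hrs : r ≠ s) (hrt : r ≠ t) (hne : r * t ≠ t * r) (hst : s * t ≠ t * s)
    (hx : cs.Dih s t x) : ¬ r * (t * s) ≼ x * r * t := by
  intro h
  have hsm : cs.Dih s t s := inPar_letter hs (Or.inl rfl)
  have htm : cs.Dih s t t := inPar_letter ht (Or.inr rfl)
  have hst' : t ≠ s := by rintro rfl; exact hst rfl
  rcases Dih.transfer hs hr hrs hrt hne (inPar_one _) (htm.mul hsm) hx htm
    (by rwa [one_mul]) with ⟨-, h1⟩ | ⟨-, h1⟩
  · have := length_le_of_bruhatLE h1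
    rw [length_mul_letters ht hs hst', ht] at this
    omega
  · have := length_le_of_bruhatLE h1
    rw [← mul_assoc, length_conj hs ht hst, ht] at this
    omega

namespace SM

/-- A left-acting element followed by a left-acting letter and by `s`. -/
theorem not_ls_ls_one (h : cs.SM v φ) {s t r x : W} (hs : φ 1 = s) (ht : ℓ t = 1)
    (htr : cs.RS φ t) (hr : ℓ r = 1) (hrt : r ≠ t) (hne : r * s ≠ s * r) (hd : cs.Dih s t x)
    (hx : cs.LS φ x) (hxs : cs.RS φ (x * s)) (hlt : ℓ x < ℓ (x * s)) : ¬ x * r * s ≼ v := by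
  intro hv
  have hs1 : ℓ s = 1 := hs ▸ h.length_one
  have hrs : r ≠ s := by rintro rfl; exact hne rfl
  have hrn := not_mem_pair hrs hrt
  have hrx := hd.not_le hr hrn
  obtain ⟨⟨j, hj, hφ, hφl⟩, hnr⟩ := id hx
  obtain ⟨⟨p, hp, hψ, hψl⟩, -⟩ := id hxs
  have hl := length_mul_letter hs1 x
  have hsm : cs.Dih s t s := inPar_letter hs1 (Or.inl rfl)
  obtain ⟨h1, h2, h3⟩ := h.insert_right hs (hd.mul hsm) hxs hψ rfl (by omega) hr hrs hrt hv
  have hins := length_insert hr hrx (not_le_letter hr hs1 hrs) (by omega)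
  have hxr := length_mul_of_not_le hr hrx
  have hle : x * r ≼ x * r * s := left_le_mul (by omega)
  obtain ⟨h4, h5, h6⟩ := h.insert_left hs hd hx hφ (mul_one x).symm (by simp) hr hrs hrt
    (by rw [mul_one]; exact hle.trans hv)
  simp only [mul_one] at h4 h5 h6
  have hm := h.mono_up hle hv (by omega)
  rcases h3 with h3 | ⟨h3, -⟩
  · have hxv : x ≼ v := (le_mul_letter hr (by omega)).trans (hle.trans hv)
    rcases h6 with h6 | ⟨h6, -⟩
    · rw [h3, h6, ← mul_assoc, mul_assoc _ s p] at hm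
      have hdφ := h.inPar_apply hxv (hs ▸ Or.inl rfl) hd
      have hxsv := hins.2.trans hv
      have hdψ := h.inPar_apply hxsv (hs ▸ Or.inl rfl) (hd.mul hsm)
      have hpm := hdψ.right_mem hp (by rw [hψ, letter_mul_cancel_right hp, ← hψ]; omega)
      rw [hφ] at hdφ
      have hsp : cs.Dih s t (s * p) := hsm.mul (inPar_letter hp hpm)
      rw [← mul_one (j * x * r)] at hm
      rcases Dih.transfer ht hr hrt hrs hne (Dih.swap hdφ) (inPar_one _) (Dih.swap hd)
        (Dih.swap hsp) hm
        with ⟨h7, -⟩ | ⟨h7, -⟩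
      · have := length_le_of_bruhatLE h7
        rw [← hφ] at this; omega
      · have h8 := length_le_of_bruhatLE h7
        have h9 := length_mul_letter ht (φ x)
        rw [← hφ] at h8 h7
        have h10 := eq_of_bruhatLE_of_length h7 (by omega)
        exact hnr t ht (by rw [← letter_mul_cancel_right ht (φ x), h10])
    · have h7 := letters_commute_of_mul_eq hr hrx h6
      have h8 : cs.InPar {t} x := fun k hk hkx => by
        rcases hd k hk hkx with h9 | h9
        · exact absurd (h9 ▸ h7 k hk hkx).symm hne
        · exact h9
      rcases h8.eq_of_singleton with rfl | rfl
      · exact hx.ne_one h.length_one rfl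
      · exact htr.not_ls hx
  · rw [mul_assoc, mul_assoc, mul_right_inj] at h3
    exact hne h3

theorem ls_t_le (h : cs.SM v φ) {s t q : W} (hs : φ 1 = s) (hd : cs.Dih s t q)
    (hq : cs.LS φ q) (ht : ℓ t = 1) : t ≼ q := by
  by_contra h1
  have h2 : cs.InPar {s} q := fun k hk hle => by
    rcases hd k hk hle with h3 | rfl
    · exact h3
    · exact absurd hle h1
  rcases h2.eq_of_singleton with h3 | h3
  · exact hq.ne_one h.length_one h3
  · exact h.ls_ne hs hq h3

theorem apply_letter_mul (h : cs.SM v φ) {s t r : W} (hs : φ 1 = s) (ht : ℓ t = 1)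
    (htr : cs.RS φ t) (hr : ℓ r = 1) (hrs : r ≠ s) (hne : r * t ≠ t * r) (hv : r * t ≼ v) :
    ℓ (φ (r * t)) = 3 ∧ φ (r * t) = r * (t * s) := by
  have hrt : r ≠ t := by rintro rfl; exact hne rfl
  have htv : t ≼ v := (right_le_mul (cs := cs) (by rw [length_mul_letters hr ht hrt, hr, ht])).trans hv
  obtain ⟨h1, h2, h3⟩ := h.insert_right (t := t) (α := 1) hs (inPar_letter ht (Or.inr rfl)) htr
    (h.rs_letter hs ht htv htr).1 (one_mul t).symm (by simp) hr hrs hrt (by rwa [one_mul])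
  rw [one_mul] at h2 h3
  refine ⟨by omega, ?_⟩
  rcases h3 with h3 | ⟨h3, -⟩
  · rw [h3, mul_assoc]
  · rw [one_mul] at h3; exact absurd h3 hne

theorem not_ls_mul_mul (h : cs.SM v φ) {s t r q : W} (hs : φ 1 = s) (ht : ℓ t = 1)
    (htr : cs.RS φ t) (hr : ℓ r = 1) (hrs : r ≠ s) (hcomm : r * s = s * r)
    (hne : r * t ≠ t * r) (hd : cs.Dih s t q) (hq : cs.LS φ q) (hqv : q ≼ v)
    (hqs : ℓ (q * s) < ℓ q) :
    ¬ q * (r * t) ≼ v := by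
  intro hv
  have hs1 : ℓ s = 1 := hs ▸ h.length_one
  have hts := h.rs_ne hs htr
  have hrt : r ≠ t := by rintro rfl; exact hne rfl
  have hrn := not_mem_pair hrs hrt
  have hrq := hd.not_le hr hrn
  obtain ⟨⟨j, hj, hφ, hφl⟩, hnr⟩ := id hq
  have add : ∀ x p, cs.Dih s t x → ℓ x < ℓ (x * t) → cs.InPar {r, t} p →
      ℓ (x * p) = ℓ x + ℓ p := by
    intro x p hx hxt hp
    refine additive_of_no_descent (cs := cs) (J := {r, t}) ?_ hp
    rintro k (rfl | rfl) hk
    · rw [length_mul_of_not_le hk (hx.not_le hr hrn)]; omega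
    · exact hxt
  have hir : cs.InPar {r, t} r := inPar_letter hr (Or.inl rfl)
  have hit : cs.InPar {r, t} t := inPar_letter ht (Or.inr rfl)
  have htm : cs.Dih s t t := inPar_letter ht (Or.inr rfl)
  have hsm : cs.Dih s t s := inPar_letter hs1 (Or.inl rfl)
  have hrt2 := length_mul_letters hr ht hrt
  have hrtr := length_conj hr ht hne
  have hqr : ℓ (q * r) = ℓ q + 1 := length_mul_of_not_le hr hrq
  have hqt : ℓ q < ℓ (q * t) := by
    by_contra h1
    have h2 := length_mul_letter ht q
    have := length_le_of_bruhatLE (Dih.le_of_descents hqs (by omega)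
      (h.inPar_apply hqv (hs ▸ Or.inl rfl) hd))
    omega
  have hul := add q _ hd hqt (hir.mul hit)
  have hle : q * r ≼ q * (r * t) := by
    rw [← mul_assoc]; exact le_mul_letter ht (by rw [mul_assoc]; omega)
  have hrtu : r * t ≼ q * (r * t) := right_le_mul hul
  have hst := (h.rs_letter hs ht (((right_le_mul (cs := cs) (x := r) (y := t)
    (by rw [hrt2, hr, ht])).trans hrtu).trans hv) htr).2.1
  obtain ⟨h1, h2⟩ := h.apply_letter_mul hs ht htr hr hrs hne (hrtu.trans hv)
  have hT : ∀ x, cs.Dih s t x → ¬ r * (t * s) ≼ x * (r * t) := fun x hx => by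
    rw [← mul_assoc x]; exact not_letter_mul_mul_le hs1 hr ht hrs hrt hne hst.symm hx
  obtain ⟨-, h4, h5⟩ := h.insert_left hs hd hq hφ (mul_one q).symm (by simp) hr hrs hrt
    (by rw [mul_one]; exact hle.trans hv)
  simp only [mul_one] at h4 h5
  replace h5 : φ (q * r) = j * q * r := by
    rcases h5 with h5 | ⟨h5, -⟩
    · rw [h5, mul_assoc]
    · exact absurd (letters_commute_of_mul_eq hr hrq h5 t ht (h.ls_t_le hs hd hq ht)) hne.symm
  have hup : ℓ (φ (q * (r * t))) = ℓ (q * (r * t)) + 1 := by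
    rcases h.adj hv with h6 | h6
    · exact h6
    · exact absurd (h2 ▸ h.le_of_down hrtu hv (by omega)) (hT q hd)
  have hw1 := h.up hv hup
  have hw2 := h5 ▸ h.mono_up hle hv (by omega)
  have hw3 := h2 ▸ h.mono_up hrtu hv (by omega)
  have hwr : r * (t * s) * r = r * t * r * s := by simp only [mul_assoc, hcomm]
  obtain ⟨k, hk, hkw⟩ := exists_right_descent (cs := cs) (u := φ (q * (r * t))) (by
    intro h6; rw [h6, cs.length_one] at hup; omega)
  have hkl := length_mul_letter hk (φ (q * (r * t)))
  have hjq : cs.Dih s t (j * q) := hφ ▸ h.inPar_apply hqv (hs ▸ Or.inl rfl) hd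
  have hjql : ℓ (j * q) = ℓ q + 1 := hφ ▸ hφl
  have hkm : k = s ∨ k = t ∨ k = r := by
    rcases h.letter_le_apply hv hk (right_descent_le hk hkw) with h6 | h6
    · rcases letter_le_mul hk h6 with h6 | h6
      · rcases hd k hk h6 with h6 | h6
        · exact Or.inl h6
        · exact Or.inr (Or.inl h6)
      · rcases hir.mul hit k hk h6 with h6 | h6
        · exact Or.inr (Or.inr h6)
        · exact Or.inr (Or.inl h6)
    · exact Or.inl (h6.trans hs)
  rw [hrt2] at hul
  rcases hkm with rfl | rfl | rfl
  · have hks := length_mul_letter hk (q * (r * t))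
    by_cases h6 : ℓ (q * (r * t) * k) < ℓ (q * (r * t))
    · have h7 := mul_letter_le_of_descent hk hrtu h6
      rw [mul_assoc] at h7
      exact hT q hd h7
    · have h7 := eq_of_bruhatLE_of_length (strip_right hk hw1 (by omega)) (by omega)
      have h8 : φ (q * (r * t)) = q * r * (t * k) := by
        rw [← letter_mul_cancel_right hk (φ (q * (r * t))), ← h7]; simp only [mul_assoc]
      rw [h8, ← mul_one (j * q * r)] at hw2
      rcases Dih.transfer hk hr hrs hrt hne hjq (inPar_one _) hd (htm.mul hsm) hw2
        with ⟨h9, -⟩ | ⟨h9, -⟩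
      · have := length_le_of_bruhatLE h9; omega
      · have h10 := length_mul_letter hk (j * q)
        have h11 := eq_of_bruhatLE_of_length h9 (by omega)
        exact hnr k hk (by rw [hφ, ← letter_mul_cancel_right hk (j * q), h11])
  · have h6 : ℓ (j * q) < ℓ (j * q * k) := by
      by_contra h6
      have h7 := length_mul_letter hk (j * q)
      have := h.right_descent_of_ls hqv hq hk (by rw [hφ]; omega)
      omega
    have h7 := add _ _ hjq h6 hir
    have h8 := add _ _ hjq h6 (hir.mul hit)
    rw [← mul_assoc, hrt2] at h8
    have h9 := eq_of_bruhatLE_of_length (strip_right hk hw2 (by omega)) (by omega)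
    apply hT _ hjq
    rwa [← mul_assoc (j * q), h9, letter_mul_cancel_right hk]
  · have h6 := add q _ hd hqt ((hir.mul hit).mul hir)
    rw [hrtr, ← mul_assoc] at h6
    have h7 := eq_of_bruhatLE_of_length (strip_right hk hw1 (by omega)) (by omega)
    have h8 := length_mul_of_not_le hs1 (x := k * t * k)
      ((hir.mul hit).mul hir |>.not_le hs1 (not_mem_pair hrs.symm hts.symm))
    have h9 := strip_right hk hw3 (by rw [hwr, ← h2]; omega)
    rw [← h7] at h9
    exact hT q hd h9

end SM

end

section

variable {cs} {v : W} {φ : W → W}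

namespace SM

theorem not_conj_mul_mul (h : cs.SM v φ) {s t r : W} (hs : φ 1 = s) (ht : ℓ t = 1)
    (htr : cs.RS φ t) (hr : ℓ r = 1) (hrs : r ≠ s) (hcomm : r * s = s * r)
    (hne : r * t ≠ t * r) (hq : cs.LS φ (s * t)) (hψ : φ (s * t * s) = s * t * s * t)
    (hψl : ℓ (s * t * s * t) = 4) (hxv : s * t * s ≼ v) :
    ¬ s * t * s * (r * t) ≼ v := by
  intro hv
  have hs1 : ℓ s = 1 := hs ▸ h.length_one
  have hts := h.rs_ne hs htr
  have hrt : r ≠ t := by rintro rfl; exact hne rfl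
  have hrn := not_mem_pair hrs hrt
  have htm : cs.Dih s t t := inPar_letter ht (Or.inr rfl)
  have hsm : cs.Dih s t s := inPar_letter hs1 (Or.inl rfl)
  have hir : cs.InPar {r, t} r := inPar_letter hr (Or.inl rfl)
  have hit : cs.InPar {r, t} t := inPar_letter ht (Or.inr rfl)
  have hrt2 := length_mul_letters hr ht hrt
  have hrtr := length_conj hr ht hne
  have hst2 := length_mul_letters hs1 ht hts.symm
  have hdx := (hsm.mul htm).mul hsm
  obtain ⟨⟨j, hj, hφ, hφl⟩, hnr⟩ := id hq
  have hnc : t * s ≠ s * t := fun hc => by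
    rw [mul_assoc, hc, letter_mul_cancel_left hs1] at hxv
    exact (h.rs_letter hs ht hxv htr).2.1 hc
  have hx3 := length_conj hs1 ht hnc.symm
  have hqv : s * t ≼ v := (le_mul_letter hs1 (by omega)).trans hxv
  have hqx : s * t ≼ s * t * s := le_mul_letter hs1 (by omega)
  have hdφ := h.inPar_apply hqv (hs ▸ Or.inl rfl) (hsm.mul htm)
  replace hφ : φ (s * t) = t * s * t := by
    rcases hdφ.left_mem hj (by rw [hφ, letter_mul_cancel_left hj, ← hφ]; omega) with rfl | rfl
    · rw [letter_mul_cancel_left hs1] at hφ; rw [hφ] at hφl; omega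
    · rw [hφ, mul_assoc]
  rw [hφ, hst2] at hφl
  have hxt : ℓ (s * t * s) < ℓ (s * t * s * t) := by omega
  have add : ∀ p, cs.InPar {r, t} p → ℓ (s * t * s * p) = 3 + ℓ p := by
    intro p hp
    rw [← hx3]
    refine additive_of_no_descent (cs := cs) (J := {r, t}) ?_ hp
    rintro k (rfl | rfl) hk
    · rw [length_mul_of_not_le hk (hdx.not_le hr hrn)]; omega
    · exact hxt
  have hul := add _ (hir.mul hit)
  rw [hrt2] at hul
  have hle : s * t * s * r ≼ s * t * s * (r * t) := by
    rw [← mul_assoc _ r]; exact le_mul_letter ht (by rw [mul_assoc _ r, hul, add r hir]; omega)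
  have hle' : s * t * r ≼ s * t * s * r :=
    mul_le_mul_of_additive hqx (bruhatLE_refl _) (by rw [add r hir, hx3, hr])
  have hsrt : s * (r * t) ≼ s * t * s * (r * t) :=
    mul_le_mul_of_additive ((left_le_mul (by rw [hst2, hs1, ht])).trans hqx) (bruhatLE_refl _)
      (by rw [hul, hx3, hrt2])
  have hrtu : r * t ≼ s * t * s * (r * t) := right_le_mul (by rw [hul, hx3, hrt2])
  obtain ⟨h1, h2⟩ := h.apply_letter_mul hs ht htr hr hrs hne (hrtu.trans hv)
  have hT : ∀ x, cs.Dih s t x → ¬ r * (t * s) ≼ x * (r * t) := fun x hx => by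
    rw [← mul_assoc x]; exact not_letter_mul_mul_le hs1 hr ht hrs hrt hne hnc.symm hx
  have hntsx : t * s * t ≠ s * t * s := fun h3 => by
    rw [← h3, letter_mul_cancel_right ht] at hψl
    have := length_mul_letters ht hs1 hts
    omega
  have hcomm' : ∀ x, cs.Dih s t x → t ≼ x → x * r ≠ r * x := fun x hx htx h3 =>
    hne (letters_commute_of_mul_eq hr (hx.not_le hr hrn) h3 t ht htx).symm
  -- images of the subwords of `s * t * s * r * t`
  obtain ⟨-, ha1, ha2⟩ := h.insert_left (j := t) hs (hsm.mul htm) hq (by rw [hφ, mul_assoc])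
    (mul_one _).symm (by simp) hr hrs hrt (by rw [mul_one]; exact hle'.trans (hle.trans hv))
  simp only [mul_one] at ha1 ha2
  replace ha2 : φ (s * t * r) = t * s * t * r := by
    rcases ha2 with ha2 | ⟨ha2, -⟩
    · rw [ha2]; simp only [mul_assoc]
    · exact absurd ha2 (hcomm' _ (hsm.mul htm) (right_le_mul (by rw [hst2, hs1, ht])))
  have hb3 : s * t * s ≼ s * t * s * r := le_mul_letter hr (by rw [add r hir, hx3]; omega)
  have hb1 : ℓ (φ (s * t * s * r)) = ℓ (s * t * s) + 2 := by
    rcases h.adj (hle.trans hv) with h3 | h3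
    · rw [h3, add r hir, hx3, hr]
    · exfalso
      have h4 := hψ ▸ h.le_of_down hb3 (hle.trans hv) (by omega)
      have := length_le_of_bruhatLE (le_of_le_mul_letter hr h4 ((hdx.mul htm).not_le hr hrn))
      omega
  have hb2 : φ (s * t * s * r) = s * t * s * t * r := by
    have hl4 := add r hir
    have hm := h.mono_up hle' (hle.trans hv) (by omega)
    have hm' := h.mono_up hb3 (hle.trans hv) (by omega)
    have hm'' := h.up (hle.trans hv) (by omega)
    rw [hψ] at hm'
    obtain ⟨γ₁, γ₂, h3, h4, h5, h6, h7⟩ := exists_insertion_of_cover hr hm' (by omega)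
      ((hdx.mul htm).not_le hr hrn) ((right_le_mul (cs := cs) (x := s * t * s) (y := r)
        (by omega)).trans hm'')
    rw [ha2, h3, ← mul_one (t * s * t * r)] at hm
    have hd1 : cs.Dih s t γ₁ := (hdx.mul htm).mono (h4 ▸ left_le_mul (h4 ▸ h5))
    have hd2 : cs.Dih s t γ₂ := (hdx.mul htm).mono (h4 ▸ right_le_mul (h4 ▸ h5))
    have h8 : t * s * t ≼ γ₁ := by
      rcases Dih.transfer hs1 hr hrs hrt hne ((htm.mul hsm).mul htm) (inPar_one _) hd1 hd2 hm
        with ⟨h3, -⟩ | ⟨h3, h9⟩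
      · exact h3
      · exfalso
        have h10 := length_le_of_bruhatLE h3
        have h11 : (s * t * s * t)⁻¹ = t * s * t * s := by
          simp only [mul_inv_rev, letter_inv hs1, letter_inv ht, mul_assoc]
        rw [← h11, cs.length_inv] at h10
        rw [mul_one] at h9
        have := length_le_of_bruhatLE h9
        omega
    have h9 := length_le_of_bruhatLE h8
    by_cases h10 : ℓ γ₂ = 0
    · rw [eq_one_of_length h10, mul_one] at h3 h4
      rw [h3, h4]
    · have h11 := eq_of_bruhatLE_of_length h8 (by omega)
      have h12 : γ₂ = s := by
        rcases hd2 γ₂ (by omega) (bruhatLE_refl _) with h12 | h12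
        · exact h12
        · exfalso
          rw [h12, ← h11, letter_mul_cancel_right ht] at h4
          rw [h4, length_mul_letters ht hs1 hts] at hψl
          omega
      rw [h3, h4, h12, mul_assoc, hcomm, ← mul_assoc]
  obtain ⟨hc0, hc1, hc2⟩ := h.insert_left (j := t) hs (hsm.mul htm) hq (by rw [hφ, mul_assoc])
    rfl (by rw [hst2, hs1, ht]) hr hrs hrt (by rw [mul_assoc]; exact hsrt.trans hv)
  rw [mul_assoc s r t] at hc0 hc1 hc2
  have hup : ℓ (φ (s * t * s * (r * t))) = ℓ (s * t * s * (r * t)) + 1 := by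
    rcases h.adj hv with h6 | h6
    · exact h6
    · exact absurd (h2 ▸ h.le_of_down hrtu hv (by omega)) (hT _ hdx)
  replace hc2 : φ (s * (r * t)) = r * t * s * t := by
    rcases hc2 with hc2 | ⟨-, hc2⟩
    · exfalso
      have hm := h.mono_up (right_le_mul (cs := cs) (x := s) (y := r * t) (by omega))
        (hsrt.trans hv) (by omega)
      rw [h2, hc2, ← mul_assoc t s] at hm
      exact hT _ (htm.mul hsm) hm
    · rw [hc2]; simp only [mul_assoc]
  rw [hc2] at hc1
  rw [hb2] at hb1
  rw [h2, ← mul_assoc] at h1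
  have hw1 := h.up hv hup
  have hw2 := hb2 ▸ h.mono_up hle hv (by omega)
  have hw3 := hc2 ▸ h.mono_up hsrt hv (by omega)
  have hw4 := h2 ▸ h.mono_up hrtu hv (by omega)
  obtain ⟨k, hk, hkw⟩ := exists_right_descent (cs := cs) (u := φ (s * t * s * (r * t))) (by
    intro h6; rw [h6, cs.length_one] at hup; omega)
  have hkl := length_mul_letter hk (φ (s * t * s * (r * t)))
  have hkm : k = s ∨ k = t ∨ k = r := by
    rcases h.letter_le_apply hv hk (right_descent_le hk hkw) with h6 | h6
    · rcases letter_le_mul hk h6 with h6 | h6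
      · rcases hdx k hk h6 with h6 | h6
        · exact Or.inl h6
        · exact Or.inr (Or.inl h6)
      · rcases hir.mul hit k hk h6 with h6 | h6
        · exact Or.inr (Or.inr h6)
        · exact Or.inr (Or.inl h6)
    · exact Or.inl (h6.trans hs)
  rcases hkm with rfl | rfl | rfl
  · have hks := length_mul_letter hk (k * t * k * (r * t))
    by_cases h6 : ℓ (k * t * k * (r * t) * k) < ℓ (k * t * k * (r * t))
    · have h7 := mul_letter_le_of_descent hk hrtu h6
      rw [mul_assoc] at h7
      exact hT _ hdx h7
    · have h7 := eq_of_bruhatLE_of_length (strip_right hk hw1 (by omega)) (by omega)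
      have h8 : φ (k * t * k * (r * t)) = k * t * k * r * (t * k) := by
        rw [← letter_mul_cancel_right hk (φ (k * t * k * (r * t))), ← h7]; simp only [mul_assoc]
      rw [h8, ← mul_one (k * t * k * t * r)] at hw2
      rcases Dih.transfer hk hr hrs hrt hne (hdx.mul htm) (inPar_one _) hdx (htm.mul hsm) hw2
        with ⟨h9, -⟩ | ⟨h9, -⟩
      · have := length_le_of_bruhatLE h9; omega
      · have h10 := length_mul_letter hk (k * t * k * t)
        have h11 := eq_of_bruhatLE_of_length h9 (by omega)
        rw [mul_assoc _ t k, mul_eq_left] at h11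
        have := length_mul_letters ht hk hts
        rw [h11, cs.length_one] at this; omega
  · have h8 := add _ ((hit.mul hir).mul hit)
    rw [length_conj hk hr hne.symm] at h8
    have h7 : s * k * s * k * r * k = s * k * s * (k * r * k) := by simp only [mul_assoc]
    rw [← h7] at h8
    have h9 := eq_of_bruhatLE_of_length (strip_right hk hw2 (by omega)) (by omega)
    apply hT _ (hdx.mul htm)
    rwa [← mul_assoc _ r k, h9, letter_mul_cancel_right hk]
  · have h6 := add _ ((hir.mul hit).mul hir)
    rw [hrtr, ← mul_assoc _ (k * t)] at h6
    have h7 := eq_of_bruhatLE_of_length (strip_right hk hw1 (by omega)) (by omega)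
    have h5 : ℓ (k * (t * s)) = 3 := by rw [← mul_assoc, h1]
    have h8 : ℓ (k * (t * s) * (t * k)) = ℓ (k * (t * s)) + ℓ (t * k) := by
      refine additive_of_no_descent (cs := cs) (J := {k, t}) ?_ (hit.mul hir)
      rintro p (rfl | rfl) -
      · rw [show p * (t * s) * p = p * t * p * s by simp only [mul_assoc, hcomm],
          length_mul_of_not_le hs1 ((hir.mul hit).mul hir |>.not_le hs1
            (not_mem_pair hrs.symm hts.symm))]
        omega
      · rw [show k * (p * s) * p = k * p * s * p by simp only [mul_assoc]]; omega
    rw [h5, length_mul_letters ht hk hrt.symm, ← mul_assoc _ t, ← mul_assoc k] at h8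
    have h9 := strip_right hk hw3 (by omega)
    rw [← h7] at h9
    exact hT _ hdx ((by rw [← mul_assoc]; exact le_mul_letter ht (by omega) :
      k * (t * s) ≼ k * t * s * t).trans h9)

end SM

end

section

variable {cs} {v : W} {φ : W → W}

namespace SM

/-- At elements not above `φ 1`, the matching `φ` inserts `φ 1` into a reduced factorization. -/
theorem exists_insert (h : cs.SM v φ) {s u : W} (hs : φ 1 = s) (hu : u ≼ v) (hsu : ¬ s ≼ u) :
    ℓ (φ u) = ℓ u + 1 ∧ ∃ a b, u = a * b ∧ ℓ u = ℓ a + ℓ b ∧ φ u = a * s * b ∧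
      ¬ s ≼ a ∧ ¬ s ≼ b := by
  have hs1 : ℓ s = 1 := hs ▸ h.length_one
  have hup : ℓ (φ u) = ℓ u + 1 := by
    rcases h.adj hu with h1 | h1
    · exact h1
    · exact absurd (hs ▸ h.le_of_down (one_bruhatLE u) hu (by omega)) hsu
  obtain ⟨a, b, h1, h2, h3, h4, h5⟩ := exists_insertion_of_cover hs1 (h.up hu hup) hup hsu
    (hs ▸ h.mono_up (one_bruhatLE u) hu (by omega))
  exact ⟨hup, a, b, h2, h3, h1, h4, h5⟩

theorem apply_insert_peel (h : cs.SM v φ) {s a b k : W} (hs : φ 1 = s) (hu : a * b ≼ v)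
    (hsu : ¬ s ≼ a * b) (hl : ℓ (a * b) = ℓ a + ℓ b) (hφ : φ (a * b) = a * s * b)
    (hk : ℓ k = 1) (hka : ℓ (k * a) < ℓ a) : φ (k * a * b) = k * a * s * b := by
  have hs1 : ℓ s = 1 := hs ▸ h.length_one
  have h1 := length_letter_mul hk a
  have h2 := length_letter_mul hk (a * b)
  have h3 := cs.length_mul_le (k * a) b
  rw [mul_assoc] at h3
  have hle : k * (a * b) ≼ a * b := letter_mul_le hk (by omega)
  obtain ⟨hup, γ₁, γ₂, h4, h5, h6, h7, h8⟩ := h.exists_insert hs (hle.trans hu)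
    (fun h9 => hsu (h9.trans hle))
  obtain ⟨hup', -⟩ := h.exists_insert hs hu hsu
  have hm := h.mono_up hle hu (by omega)
  rw [h6, hφ] at hm
  obtain ⟨a', b', e1, e2, e3, e4, e5⟩ := exists_refactor hs1 h7 h8
    (fun h9 => hsu (h9.trans (left_le_mul hl))) (fun h9 => hsu (h9.trans (right_le_mul hl))) hm
    (by rw [← h4]; omega)
  have hla := length_le_of_bruhatLE e4
  have hlb := length_le_of_bruhatLE e5
  rw [e1, ← h4] at e3
  rw [mul_assoc, h6, ← e2]
  by_cases h9 : ℓ b ≤ ℓ b'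
  · have := eq_of_bruhatLE_of_length e5 h9
    subst this
    rw [← h4, ← mul_assoc, mul_left_inj] at e1
    rw [e1]
  · exfalso
    have := eq_of_bruhatLE_of_length e4 (by omega)
    subst this
    rw [← h4] at e1
    have h10 := cs.length_mul_le (k * a') b'
    rw [mul_assoc, e1, letter_mul_cancel_left hk] at h10
    omega

theorem apply_right_of_insert (h : cs.SM v φ) {s a b : W} (hs : φ 1 = s) (hu : a * b ≼ v)
    (hsu : ¬ s ≼ a * b) (hl : ℓ (a * b) = ℓ a + ℓ b) (hφ : φ (a * b) = a * s * b) :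
    φ b = s * b := by
  induction a using left_induction (cs := cs) with
  | h1 => simpa using hφ
  | hs k a hk hla ih =>
    have h1 := h.apply_insert_peel hs hu hsu hl hφ hk (by rw [letter_mul_cancel_left hk]; omega)
    rw [letter_mul_cancel_left hk] at h1
    have h2 := length_letter_mul hk (a * b)
    have h3 := cs.length_mul_le a b
    rw [mul_assoc] at hl hu hsu
    have hle : a * b ≼ k * (a * b) := le_letter_mul hk (by omega)
    exact ih (hle.trans hu) (fun h9 => hsu (h9.trans hle)) (by omega) h1

theorem apply_eq_of_le (h : cs.SM v φ) {s a x : W} (hs : φ 1 = s) (hu : a ≼ v)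
    (hsu : ¬ s ≼ a) (hφ : φ a = a * s) (hx : x ≼ a) : φ x = x * s := by
  have hs1 : ℓ s = 1 := hs ▸ h.length_one
  obtain ⟨hup, γ₁, γ₂, h4, h5, h6, h7, h8⟩ := h.exists_insert hs (hx.trans hu)
    (fun h9 => hsu (h9.trans hx))
  obtain ⟨hup', -⟩ := h.exists_insert hs hu hsu
  have hm := h.mono_up hx hu (by omega)
  rw [h6, hφ, ← mul_one (a * s)] at hm
  obtain ⟨c, -, hc, -, hc1⟩ := exists_transfer hs1 h7 h8 hsu (not_le_letter_one hs1) hm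
  have h9 := eq_one_of_length (cs := cs) (u := c⁻¹ * γ₂) (by
    have := length_le_of_bruhatLE hc1
    rw [cs.length_one] at this; omega)
  have h10 : γ₂ = c := by rw [inv_mul_eq_one] at h9; exact h9.symm
  rw [h6, h4, h10, mul_assoc, ← commute_of_letters hc, ← mul_assoc]

/-- The structure of a special matching at an element not above `φ 1`. -/
theorem exists_insert_apply (h : cs.SM v φ) {s u : W} (hs : φ 1 = s) (hu : u ≼ v)
    (hsu : ¬ s ≼ u) :
    ∃ a b, u = a * b ∧ ℓ u = ℓ a + ℓ b ∧ φ u = a * s * b ∧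
      (∀ x, x ≼ a → φ x = x * s) ∧ ∀ x, x ≼ b → φ x = s * x := by
  have hs1 : ℓ s = 1 := hs ▸ h.length_one
  obtain ⟨hup, a, b, h4, h5, h6, h7, h8⟩ := h.exists_insert hs hu hsu
  subst h4
  have hb := h.apply_right_of_insert hs hu hsu h5 h6
  have ha := h.inv.apply_right_of_insert (a := b⁻¹) (b := a⁻¹) (h.inv_one_eq hs)
    (by rw [← mul_inv_rev]; exact inv_bruhatLE_inv hu)
    (by rw [← mul_inv_rev, letter_le_inv hs1]; exact hsu)
    (by rw [← mul_inv_rev]; simp only [cs.length_inv]; omega)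
    (by simp only [mul_inv_rev, inv_inv]; rw [h6]; simp only [mul_inv_rev, mul_assoc, letter_inv hs1])
  simp only [inv_inv] at ha
  refine ⟨a, b, rfl, h5, h6, fun x hx => ?_, fun x hx => ?_⟩
  · refine h.apply_eq_of_le hs ((left_le_mul h5).trans hu) h7 ?_ hx
    rw [← inv_inv (φ a), ha, mul_inv_rev, inv_inv, letter_inv hs1]
  · have := h.inv.apply_eq_of_le (x := x⁻¹) (a := b⁻¹) (h.inv_one_eq hs)
      (inv_bruhatLE_inv ((right_le_mul h5).trans hu)) (by rwa [letter_le_inv hs1])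
      (by simp only [inv_inv]; rw [hb, inv_letter_mul hs1]) (inv_bruhatLE_inv hx)
    simp only [inv_inv] at this
    rw [← inv_inv (φ x), this, mul_inv_rev, inv_inv, letter_inv hs1]

end SM

end

section

variable {cs} {v : W} {φ : W → W}

theorem not_conj_le_letter_mul {s t y : W} (hs : ℓ s = 1) (ht : ℓ t = 1) (hne : t * s ≠ s * t)
    (hy : ¬ s ≼ y) : ¬ t * s * t ≼ s * y := by
  intro h
  have hst : s ≠ t := by rintro rfl; exact hne rfl
  have h1 := not_le_letter hs ht hst
  obtain ⟨c, -, hc, hc1, -⟩ := exists_transfer hs h1 h1 (not_le_letter_one hs) hy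
    (show t * s * t ≼ 1 * s * y by rwa [one_mul])
  have h2 := eq_one_of_length (cs := cs) (u := t * c) (by
    have := length_le_of_bruhatLE hc1
    rw [cs.length_one] at this; omega)
  have h3 : c = t := by rw [← letter_mul_cancel_left ht c, h2, mul_one]
  exact hne (hc t ht (h3 ▸ bruhatLE_refl _))

theorem not_conj_le_mul_letter {s t y : W} (hs : ℓ s = 1) (ht : ℓ t = 1) (hne : t * s ≠ s * t)
    (hy : ¬ s ≼ y) : ¬ t * s * t ≼ y * s := fun h => by
  refine not_conj_le_letter_mul (y := y⁻¹) hs ht hne (by rwa [letter_le_inv hs]) ?_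
  have := inv_bruhatLE_inv h
  rwa [mul_inv_rev, mul_inv_rev, mul_inv_rev, letter_inv hs, letter_inv ht, ← mul_assoc] at this

namespace SM

theorem letters_commute_of_letter_mul (h : cs.SM v φ) {s t u : W} (hs : φ 1 = s) (ht : ℓ t = 1)
    (htr : cs.RS φ t) (hq : cs.LS φ (s * t)) (hφq : φ (s * t) = t * s * t) (hsu : ¬ s ≼ u)
    (hu : ∀ k, ℓ k = 1 → k ≼ u → k = t ∨ k * s = s * k) (htu : t ≼ u)
    (hdu : ∀ k, ℓ k = 1 → ℓ (k * u) < ℓ u → k * s ≠ s * k) (hv : s * u ≼ v) :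
    ∀ k, ℓ k = 1 → k ≼ t * u → k * s = s * k := by
  have hs1 : ℓ s = 1 := hs ▸ h.length_one
  have hts := h.rs_ne hs htr
  have hsul : ℓ (s * u) = ℓ u + 1 := length_letter_mul_of_not_le hs1 hsu
  have husl : ℓ (u * s) = ℓ u + 1 := length_mul_of_not_le hs1 hsu
  have hle : u ≼ s * u := le_letter_mul hs1 (by omega)
  have huv := hle.trans hv
  obtain ⟨hφt, hne, -⟩ := h.rs_letter hs ht (htu.trans huv) htr
  have hst2 := length_mul_letters hs1 ht hts.symm
  have hst : s * t ≼ s * u := mul_le_mul_of_additive (bruhatLE_refl _) htu (by omega)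
  have hφu : φ u = u * s := by
    obtain ⟨a, b, h1, h2, h3, -, h4⟩ := h.exists_insert_apply hs huv hsu
    have htb : ¬ t ≼ b := fun h5 => hne (hφt.symm.trans (h4 t h5))
    have hbs := commute_of_letters (cs := cs) (q := b) (j := s) fun k hk hkb =>
      (hu k hk (hkb.trans (h1 ▸ right_le_mul (h1 ▸ h2)))).resolve_left
        (fun h5 => htb (h5 ▸ hkb))
    rw [h3, h1, mul_assoc, ← hbs, mul_assoc]
  have hneu : u * s ≠ s * u := fun h1 => hne (letters_commute_of_mul_eq hs1 hsu h1 t ht htu)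
  have hq3 := hq.data (j := t) (by rw [hφq, mul_assoc])
  have htst := length_conj ht hs1 hne
  have hup : ℓ (φ (s * u)) = ℓ (s * u) + 1 := by
    rcases h.adj hv with h1 | h1
    · exact h1
    · exact absurd (hφq ▸ h.le_of_down hst hv (by omega)) (not_conj_le_letter_mul hs1 ht hne hsu)
  have hw1 := h.up hv hup
  have hw2 := hφu ▸ h.mono_up hle hv (by omega)
  have hw3 := hφq ▸ h.mono_up hst hv (by omega)
  obtain ⟨k, hk, hkw⟩ := exists_left_descent (cs := cs) (u := φ (s * u)) (by
    intro h6; rw [h6, cs.length_one] at hup; omega)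
  have hkl := length_letter_mul hk (φ (s * u))
  have hkm : k = s ∨ k = t ∨ k ≠ s ∧ k * s = s * k := by
    by_cases h7 : k = s
    · exact Or.inl h7
    rcases h.letter_le_apply hv hk (left_descent_le hk hkw) with h6 | h6
    · rcases letter_le_mul hk h6 with h6 | h6
      · exact absurd (letter_le_letter hk hs1 h6) h7
      · rcases hu k hk h6 with h8 | h8
        · exact Or.inr (Or.inl h8)
        · exact Or.inr (Or.inr ⟨h7, h8⟩)
    · exact Or.inl (h6.trans hs)
  rcases hkm with h6 | h6 | ⟨h6, h7⟩
  · rw [h6] at hkw hkl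
    exfalso
    have h7 : ℓ (u * s) < ℓ (s * (u * s)) := by
      by_contra h8
      have h9 := length_letter_mul hs1 (u * s)
      have h10 := letter_mul_le_of_descent hs1 (le_mul_letter (cs := cs) (u := u) hs1 (by omega))
        (by omega)
      exact hneu (eq_of_bruhatLE_of_length h10 (by omega)).symm
    have h8 := eq_of_bruhatLE_of_length (strip_left hs1 hw2 h7) (by omega)
    have h9 : ℓ (t * s * t) < ℓ (s * (t * s * t)) := by
      by_contra h8
      have h9 := length_letter_mul hs1 (t * s * t)
      have h10 := letter_mul_le_of_descent hs1
        (le_mul_letter (cs := cs) (u := t * s) ht (by rw [htst, length_mul_letters ht hs1 hts]; omega))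
        (by omega)
      rw [← mul_assoc] at h10
      have h11 := eq_of_bruhatLE_of_length h10 (by rw [htst, length_conj hs1 ht hne.symm])
      exact hq3.2.2 s hs1 (by rw [h11, ← mul_assoc])
    have h10 := strip_left hs1 hw3 h9
    rw [← h8] at h10
    exact not_conj_le_mul_letter hs1 ht hne hsu h10
  · rw [h6] at hkw hkl
    have h7 : ℓ (s * u) < ℓ (t * (s * u)) := by
      by_contra h8
      have h9 := length_letter_mul ht (s * u)
      have h10 := letter_mul_le_of_descent ht hst (by omega)
      rw [← mul_assoc] at h10
      exact not_conj_le_letter_mul hs1 ht hne hsu h10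
    have h8 := eq_of_bruhatLE_of_length (strip_left ht hw1 h7) (by omega)
    have htul : ℓ (t * u) < ℓ u := by
      obtain ⟨g, hg, hgu⟩ := exists_left_descent (cs := cs) (u := u) (by
        rintro rfl; exact not_le_letter_one ht htu)
      rcases hu g hg (left_descent_le hg hgu) with rfl | h9
      · exact hgu
      · exact absurd h9 (hdu g hg hgu)
    have hstu : ¬ s ≼ t * u := fun h9 => hsu (h9.trans (letter_mul_le ht htul))
    have h9 := strip_both_left ht hw2 (by
      rw [← mul_assoc, length_mul_of_not_le hs1 hstu]; omega)
    rw [← h8, ← mul_assoc, ← mul_one (t * u * s), ← one_mul s] at h9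
    obtain ⟨c, -, hc, hc1, -⟩ := exists_transfer hs1 hstu (not_le_letter_one hs1)
      (not_le_letter_one hs1) hsu (by simpa using h9)
    have h2 := eq_one_of_length (cs := cs) (u := t * u * c) (by
      have := length_le_of_bruhatLE hc1
      rw [cs.length_one] at this; omega)
    intro k hk hkt
    rw [mul_eq_one_iff_eq_inv.1 h2, letter_le_inv hk] at hkt
    exact hc k hk hkt
  · exfalso
    have h8 : ℓ (k * u) = ℓ u + 1 := by
      have := length_letter_mul hk u
      have : ¬ ℓ (k * u) < ℓ u := fun h9 => hdu k hk h9 h7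
      omega
    have hsk : ¬ s ≼ k * u := not_letter_le_mul hs1 (not_le_letter hs1 hk (Ne.symm h6)) hsu
    have h9 := eq_of_bruhatLE_of_length (strip_left hk hw1 (by
      rw [← mul_assoc, h7, mul_assoc, length_letter_mul_of_not_le hs1 hsk]; omega)) (by omega)
    have h10 := strip_left hk hw2 (by
      rw [← mul_assoc, length_mul_of_not_le hs1 hsk]; omega)
    rw [← h9] at h10
    exact hneu (eq_of_bruhatLE_of_length h10 (by omega))

end SM

end

section

/-- The data remaining in the main case: every left descent of `y` is left-bad inside the dihedral
subgroup `⟨s, t⟩` and every right descent of `y` is right-bad inside it. -/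
structure Main (v : W) (φ : W → W) (s t y : W) : Prop where
  sm : cs.SM v φ
  one : φ 1 = s
  letter : ℓ t = 1
  rs : cs.RS φ t
  t_le : t ≼ v
  le : y ≼ v
  up : ∀ {u}, u ≼ v → ℓ u < ℓ (φ u) → u ≼ y
  left : ∀ {g}, ℓ g = 1 → ℓ (g * y) < ℓ y → (g = s ∨ g = t) ∧
    ∃ x, cs.Dih s t x ∧ cs.RS φ x ∧ ℓ x < ℓ (g * x) ∧ g * x ≼ v ∧ cs.LS φ (g * x)
  right : ∀ {a}, ℓ a = 1 → ℓ (y * a) < ℓ y → a = t ∨ a = s ∧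
    ∃ x, cs.Dih s t x ∧ cs.LS φ x ∧ cs.RS φ (x * s) ∧ ℓ x < ℓ (x * s) ∧ x * s ≼ v

variable {cs} {v : W} {φ : W → W}

theorem LS.lt {q : W} (h : cs.LS φ q) : ℓ q < ℓ (φ q) := by
  obtain ⟨⟨j, _, _, hl⟩, _⟩ := h
  omega

theorem RS.lt {q : W} (h : cs.RS φ q) : ℓ q < ℓ (φ q) := by
  obtain ⟨⟨j, _, _, hl⟩, _⟩ := h
  omega

theorem Dih.letter_mul {s t g x : W} (hx : cs.Dih s t x) (hg : ℓ g = 1) (h : g = s ∨ g = t) :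
    cs.Dih s t (g * x) :=
  (inPar_letter hg h).mul hx

/-- Commuting left multiplications transport descents. -/
theorem descent_of_commute {t k y : W} (ht : ℓ t = 1) (hc : t * k = k * t)
    (hty : ℓ (t * y) < ℓ y) (hk : ℓ k = 1) (hd : ℓ (k * (t * y)) < ℓ (t * y)) :
    ℓ (k * y) < ℓ y := by
  have e : k * y = t * (k * (t * y)) := by
    rw [← mul_assoc t k, hc, mul_assoc, letter_mul_cancel_left ht]
  rw [e]
  have := length_letter_mul (cs := cs) ht (k * (t * y))
  have := length_letter_mul (cs := cs) ht y
  have := length_letter_mul (cs := cs) hk (t * y)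
  omega

namespace Main

variable {s t y : W}

theorem s_letter (m : cs.Main v φ s t y) : ℓ s = 1 := m.one ▸ m.sm.length_one

theorem apply_t (m : cs.Main v φ s t y) : φ t = t * s :=
  (m.sm.rs_letter m.one m.letter m.t_le m.rs).1

theorem comm_ne (m : cs.Main v φ s t y) : t * s ≠ s * t :=
  (m.sm.rs_letter m.one m.letter m.t_le m.rs).2.1

theorem ne (m : cs.Main v φ s t y) : t ≠ s :=
  (m.sm.rs_letter m.one m.letter m.t_le m.rs).2.2

theorem apply_s (m : cs.Main v φ s t y) : φ s = 1 := by
  rw [← m.one]; exact m.sm.invol (one_bruhatLE _)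

theorem apply_ts (m : cs.Main v φ s t y) : φ (t * s) = t := by
  rw [← m.apply_t]; exact m.sm.invol m.t_le

theorem ne_s_of_rs (m : cs.Main v φ s t y) {x : W} (hx : cs.RS φ x) : x ≠ s := by
  rintro rfl
  have := hx.lt
  rw [m.apply_s, length_one, m.s_letter] at this
  omega

theorem ne_ts_of_rs (m : cs.Main v φ s t y) {x : W} (hx : cs.RS φ x) : x ≠ t * s := by
  rintro rfl
  have := hx.lt
  rw [m.apply_ts, length_mul_letters m.letter m.s_letter m.ne, m.letter] at this
  omega

theorem ne_one_of_rs (m : cs.Main v φ s t y) {x : W} (hx : cs.RS φ x) : x ≠ 1 :=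
  hx.ne_one m.sm.length_one

theorem t_le_of_rs (m : cs.Main v φ s t y) {x : W} (hd : cs.Dih s t x) (hx : cs.RS φ x) :
    t ≼ x := by
  by_contra hn
  have : cs.InPar {s} x := fun k hk hle => by
    rcases hd k hk hle with h | h
    · exact h
    · exact absurd (h ▸ hle) hn
  rcases this.eq_of_singleton with h | h
  · exact m.ne_one_of_rs hx h
  · exact m.ne_s_of_rs hx h

theorem not_rs_letter (m : cs.Main v φ s t y) {a : W} (ha : ℓ a = 1) (har : cs.RS φ a)
    (hat : a ≠ t) : ¬ a ≼ y := by
  intro hay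
  have hs := m.s_letter
  have ht := m.letter
  obtain ⟨-, hsa, has⟩ := m.sm.rs_letter m.one ha (hay.trans m.le) har
  have hnp : a ∉ ({s, t} : Set W) := not_mem_pair has hat
  have key : ∀ z, a ≼ z → a ≼ s * z := fun z hz =>
    strip_left hs hz (by rw [length_mul_letters hs ha has.symm]; omega)
  have key' : ∀ z, a ≼ z → a ≼ t * z := fun z hz =>
    strip_left ht hz (by rw [length_mul_letters ht ha hat.symm]; omega)
  by_cases hsy : ℓ (s * y) < ℓ y
  · obtain ⟨-, x, hd, hx, hlt, hle, hls⟩ := m.left hs hsy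
    have hqy := m.up hle hls.lt
    have hxy : x ≼ s * y := by
      have := strip_both_left hs hqy (by rwa [letter_mul_cancel_left hs])
      rwa [letter_mul_cancel_left hs] at this
    obtain ⟨α, β, hαβ, hl, hins⟩ := exists_insertion ha hxy (key y hay) (hd.not_le ha hnp)
    have hins' := letter_mul_mono hs hins (by rwa [letter_mul_cancel_left hs])
    rw [letter_mul_cancel_left hs] at hins'
    have hdq := hd.letter_mul hs (Or.inl rfl)
    by_cases hc : a * β = β * a
    · refine m.sm.ls_mul_rs_letter m.one hdq hls (left_descent_le hs ?_) ha har hat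
        (bruhatLE.trans ?_ m.le)
      · rwa [letter_mul_cancel_left hs]
      · rw [hαβ]
        simpa only [mul_assoc, hc] using hins'
    · refine hsa (m.sm.mul_letters_bad m.one hx hls hs hlt hdq hαβ hl ha has hat ?_ hc).2.symm
      simpa only [mul_assoc] using hins'.trans m.le
  · have hy1 : y ≠ 1 := by
      rintro rfl; exact not_le_letter_one ha hay
    obtain ⟨g, hg, hgy⟩ := exists_left_descent (cs := cs) (u := y) hy1
    obtain ⟨hgst, x, hd, hx, hlt, hle, hls⟩ := m.left hg hgy
    rcases hgst with rfl | rfl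
    · exact hsy hgy
    rename' g => t
    have hqy := m.up hle hls.lt
    have hxy : x ≼ t * y := by
      have := strip_both_left ht hqy (by rwa [letter_mul_cancel_left ht])
      rwa [letter_mul_cancel_left ht] at this
    have htx := m.t_le_of_rs hd hx
    obtain ⟨k₀, hk₀, hk₀x⟩ := exists_left_descent (cs := cs) (u := x) (m.ne_one_of_rs hx)
    have hsx : ℓ (s * x) < ℓ x := by
      rcases hd.left_mem hk₀ hk₀x with h | h
      · rwa [← (h : k₀ = s)]
      · rw [(h : k₀ = t)] at hk₀x; omega
    have hdq := hd.letter_mul ht (Or.inr rfl)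
    have htty : ℓ (t * y) < ℓ (t * (t * y)) := by rwa [letter_mul_cancel_left ht]
    have hD : ∀ k, ℓ k = 1 → ℓ (k * (t * y)) < ℓ (t * y) → k = s := by
      intro k hk hkd
      by_contra hks
      have hkt : k ≠ t := by rintro rfl; omega
      have hno : t * k ≠ k * t := fun hc => by
        rcases (m.left hk (descent_of_commute ht hc hgy hk hkd)).1 with h | h
        · exact hks h
        · exact hkt h
      have hkx := letter_mul_mono ht (letter_mul_le_of_descent hk hxy hkd) htty
      rw [letter_mul_cancel_left ht] at hkx
      have hnk := hd.not_le hk (not_mem_pair hks hkt)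
      by_cases hc : k * x = x * k
      · exact hno (letters_commute_of_mul_eq hk hnk hc.symm t ht htx)
      · refine hno (m.sm.mul_letters_bad m.one hx hls ht hlt hdq (α := 1) (one_mul x).symm
          (by rw [length_one]; omega) hk hks hkt ?_ hc).2
        simpa only [mul_assoc, one_mul] using hkx.trans m.le
    have hty1 : t * y ≠ 1 := by
      intro h1
      rw [h1] at hxy
      exact m.ne_one_of_rs hx (bruhatLE_antisymm hxy (one_bruhatLE _))
    obtain ⟨k, hk, hkd⟩ := exists_left_descent (cs := cs) (u := t * y) hty1
    obtain rfl := hD k hk hkd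
    rename' k => s
    have hβ := strip_both_left hs hxy hsx
    obtain ⟨α, β, hαβ, hl, hins⟩ := exists_insertion ha hβ (key _ (key' y hay))
      (fun h => hd.not_le ha hnp (h.trans (letter_mul_le hs hsx)))
    have hins' := letter_mul_mono hs hins (by rwa [letter_mul_cancel_left hs])
    rw [letter_mul_cancel_left hs] at hins'
    have hins'' := letter_mul_mono ht hins' htty
    rw [letter_mul_cancel_left ht] at hins''
    have hx' : x = s * α * β := by rw [mul_assoc, ← hαβ, letter_mul_cancel_left hs]
    have hlx := length_letter_mul (cs := cs) hs x
    have hsα := length_letter_mul (cs := cs) hs α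
    have hle2 := cs.length_mul_le (s * α) β
    rw [← hx'] at hle2
    by_cases hc : a * β = β * a
    · refine m.sm.ls_mul_rs_letter m.one hdq hls
        ((left_descent_le hs hsx).trans (le_letter_mul ht hlt)) ha har hat
        (bruhatLE.trans ?_ m.le)
      rw [hx']
      simpa only [mul_assoc, hc] using hins''
    · have h1 := (m.sm.mul_letters_bad m.one hx hls ht hlt hdq hx' (by omega) ha has hat
        (by simpa only [mul_assoc] using hins''.trans m.le) hc).1
      rw [h1, length_one] at hsα hle2
      omega

end Main

end

section

variable {cs} {v : W} {φ : W → W}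

theorem exists_prefix_of_letter_le {k x : W} (hk : ℓ k = 1) (h : k ≼ x) :
    ∃ z w, x = z * k * w ∧ ℓ (z * k) = ℓ z + 1 ∧ ℓ x = ℓ (z * k) + ℓ w ∧ ¬ k ≼ z ∧
      ∀ k', ℓ k' = 1 → ℓ (z * k * k') < ℓ (z * k) → k' = k := by
  obtain ⟨u, ⟨hku, w, hx, hl⟩, hmin⟩ := exists_min_length cs
    (S := {u | k ≼ u ∧ ∃ w, x = u * w ∧ ℓ x = ℓ u + ℓ w}) ⟨x, h, 1, by simp, by simp⟩
  have key : ∀ k', ℓ k' = 1 → ℓ (u * k') < ℓ u → ¬ k ≼ u * k' := by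
    intro k' hk' hd hle
    have hx' : x = u * k' * (k' * w) := by
      rw [mul_assoc, letter_mul_cancel_left hk', hx]
    have h1 := length_letter_mul (cs := cs) hk' w
    have h2 := length_mul_letter (cs := cs) hk' u
    have h3 := cs.length_mul_le (u * k') (k' * w)
    rw [← hx'] at h3
    have := hmin (u * k') ⟨hle, k' * w, hx', by omega⟩
    omega
  have key' : ∀ k', ℓ k' = 1 → ℓ (u * k') < ℓ u → k' = k := by
    intro k' hk' hd
    have h1 : k ≼ u * k' * k' := by rwa [letter_mul_cancel_right hk']
    rcases letter_le_mul hk h1 with h2 | h2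
    · exact absurd h2 (key k' hk' hd)
    · exact (letter_le_letter hk hk' h2).symm
  have hu1 : u ≠ 1 := by
    rintro rfl; exact not_le_letter_one hk hku
  obtain ⟨k', hk', hd⟩ := exists_right_descent (cs := cs) (u := u) hu1
  obtain rfl := key' k' hk' hd
  have h2 := length_mul_letter (cs := cs) hk' u
  refine ⟨u * k', w, ?_, ?_, ?_, key k' hk' hd, ?_⟩ <;> rw [letter_mul_cancel_right hk']
  · exact hx
  · omega
  · exact hl
  · exact key'

theorem left_descent_of_left_factor {k u w : W} (hl : ℓ (u * w) = ℓ u + ℓ w)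
    (hd : ℓ (k * u) < ℓ u) : ℓ (k * (u * w)) < ℓ (u * w) := by
  have := cs.length_mul_le (k * u) w
  rw [mul_assoc] at this
  omega

theorem right_descent_of_suffix {k u w : W} (hl : ℓ (u * w) = ℓ u + ℓ w)
    (hd : ℓ (w * k) < ℓ w) : ℓ (u * w * k) < ℓ (u * w) := by
  have := cs.length_mul_le u (w * k)
  rw [← mul_assoc] at this
  omega

namespace Main

variable {s t y : W}

theorem exists_left_factor (m : cs.Main v φ s t y) {q Y : W} (hy : y = q * Y) (hq : cs.Dih s t q)
    (hl : ℓ y = ℓ q + ℓ Y) (hY : ∀ k ∈ ({s, t} : Set W), ℓ k = 1 → ℓ Y < ℓ (k * Y))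
    (htY : t ≼ Y) :
    ∃ z w, Y = z * t * w ∧ ℓ (z * t) = ℓ z + 1 ∧ ℓ Y = ℓ (z * t) + ℓ w ∧ z ≠ 1 ∧ ¬ s ≼ z ∧
      ¬ t ≼ z ∧ (∀ k, ℓ k = 1 → k ≼ z → k * s = s * k) ∧
      (∀ k, ℓ k = 1 → ℓ (z * k) < ℓ z → k * t ≠ t * k) ∧
      ∀ k, ℓ k = 1 → ℓ (k * z) < ℓ z → t ≼ q ∧ k * t ≠ t * k := by
  have hs := m.s_letter
  have ht := m.letter
  obtain ⟨z, w, hYz, hzt, hlY, htz, hR⟩ := exists_prefix_of_letter_le ht htY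
  have hztY : z * t ≼ Y := by
    rw [hYz] at hlY ⊢; exact left_le_mul hlY
  have hYy : Y ≼ y := by
    rw [hy] at hl ⊢; exact right_le_mul hl
  have hzzt : z ≼ z * t := le_mul_letter ht (by omega)
  have hzty := hztY.trans hYy
  have hztv := hzty.trans m.le
  have hz1 : z ≠ 1 := by
    rintro rfl
    have h1 : ℓ (t * Y) < ℓ Y := by
      rw [hYz] at hlY ⊢
      rw [one_mul] at hlY ⊢
      exact left_descent_of_left_factor hlY (by rw [letter_mul_self ht, length_one]; omega)
    have := hY t (Or.inr rfl) ht
    omega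
  have hnd : ∀ k, ℓ k = 1 → ℓ (k * z) < ℓ z → ℓ (k * Y) < ℓ Y := by
    intro k hk hd
    have h1 := left_descent_of_left_factor (cs := cs) (k := k) (u := z) (w := t) (by omega) hd
    rw [hYz] at hlY ⊢
    exact left_descent_of_left_factor hlY h1
  have hsz : ¬ s ≼ z := by
    intro hsz
    obtain ⟨z₀, w₀, hz₀, hz₀s, hlz, hsz₀, -⟩ := exists_prefix_of_letter_le hs hsz
    have hz₀z : z₀ * s ≼ z := by
      rw [hz₀] at hlz ⊢; exact left_le_mul hlz
    have hz₀l : z₀ ≼ z₀ * s := le_mul_letter hs (by omega)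
    have hcomm : s * z₀ = z₀ * s := by
      refine (commute_of_letters (cs := cs) fun k hk hkz => ?_).symm
      have hks : k ≠ s := by rintro rfl; exact hsz₀ hkz
      have hkz' := hkz.trans (hz₀l.trans hz₀z)
      rcases m.sm.letter_trichotomy m.one hk hks (hkz'.trans (hzzt.trans hztv)) with h | h | h
      · exact absurd (hkz'.trans (hzzt.trans hzty))
          (m.not_rs_letter hk h (by rintro rfl; exact htz hkz'))
      · have h1 := mul_letter_mono hs hkz (by omega)
        have h2 := mul_letter_mono ht (h1.trans hz₀z) (by omega)
        exact absurd (h2.trans hztv) (m.sm.not_ls_one_rs m.one hk ht h m.rs)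
      · exact h
    have h1 := hnd s hs (by
      rw [hz₀] at hlz ⊢
      exact left_descent_of_left_factor hlz (by rw [← hcomm, letter_mul_cancel_left hs, hcomm]; omega))
    have := hY s (Or.inl rfl) hs
    omega
  have hszt : ¬ s ≼ z * t := not_letter_le_mul hs hsz (not_le_letter hs ht m.ne.symm)
  obtain ⟨a, b, hab, hlab, -, ha, hb⟩ := m.sm.exists_insert_apply m.one hztv hszt
  have hb1 : b = 1 := by
    by_contra hb1
    obtain ⟨k, hk, hkd⟩ := exists_right_descent (cs := cs) (u := b) hb1
    have h1 := hR k hk (by rw [hab] at hlab ⊢; exact right_descent_of_suffix hlab hkd)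
    subst h1
    exact m.comm_ne (m.apply_t.symm.trans (hb k (right_descent_le hk hkd)))
  rw [hb1, mul_one] at hab
  have hcs : ∀ k, ℓ k = 1 → k ≼ z → k * s = s * k := by
    intro k hk hkz
    have hks : k ≠ s := by rintro rfl; exact hsz hkz
    rcases m.sm.letter_trichotomy m.one hk hks (hkz.trans (hzzt.trans hztv)) with h | h | h
    · exact absurd (hkz.trans (hzzt.trans hzty))
        (m.not_rs_letter hk h (by rintro rfl; exact htz hkz))
    · have h1 := m.sm.ls_letter m.one hk (hkz.trans (hzzt.trans hztv)) h
      exact (ha k (hab ▸ hkz.trans hzzt)).symm.trans h1.1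
    · exact h
  refine ⟨z, w, hYz, hzt, hlY, hz1, hsz, htz, hcs, ?_, ?_⟩
  · intro k hk hkd hc
    have h1 := hR k hk (by
      rw [mul_assoc, ← hc, ← mul_assoc]
      have := length_mul_letter (cs := cs) ht (z * k)
      omega)
    subst h1
    exact htz (right_descent_le hk hkd)
  · intro k hk hkd
    have hkz := left_descent_le hk hkd
    have hks : k ≠ s := by rintro rfl; exact hsz hkz
    have hkt : k ≠ t := by rintro rfl; exact htz hkz
    by_contra hno
    have hc : k * q = q * k := by
      refine (commute_of_letters (cs := cs) fun l hl hlq => ?_).symm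
      rcases hq l hl hlq with rfl | rfl
      · exact (hcs k hk hkz).symm
      · by_contra hne
        exact hno ⟨hlq, fun h => hne h.symm⟩
    have h1 : ℓ (k * y) < ℓ y := by
      rw [hy, ← mul_assoc, hc, mul_assoc]
      have := cs.length_mul_le q (k * Y)
      have := hnd k hk hkd
      rw [← hy]
      omega
    rcases (m.left hk h1).1 with h | h
    · exact hks h
    · exact hkt h

end Main

end

section

variable {cs} {v : W} {φ : W → W}

theorem apply_of_ls_mul (h : cs.SM v φ) {s t : W} (hs : φ 1 = s) (ht : ℓ t = 1)
    (hst : cs.LS φ (s * t)) (hv : s * t ≼ v) : φ (s * t) = t * s * t := by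
  have hsl : ℓ s = 1 := hs ▸ h.length_one
  have hds : cs.Dih s t s := inPar_letter hsl (Or.inl rfl)
  have hdt : cs.Dih s t t := inPar_letter ht (Or.inr rfl)
  obtain ⟨⟨j, hj, hφ, hjl⟩, -⟩ := id hst
  have hd := h.inPar_apply hv (hs ▸ Or.inl rfl) (hds.mul hdt)
  have hjd : ℓ (j * φ (s * t)) < ℓ (φ (s * t)) := by
    rw [hφ, letter_mul_cancel_left hj, ← hφ]; omega
  rcases hd.left_mem hj hjd with rfl | h1
  · rw [hφ, letter_mul_cancel_left hj] at hjl
    exact absurd (cs.length_eq_zero_iff.1 (by omega)) (hst.ne_one h.length_one)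
  · rw [hφ, (h1 : j = t), mul_assoc]

theorem exists_ls_conj (h : cs.SM v φ) {s t : W} (hs : φ 1 = s) (ht : ℓ t = 1) (hts : t ≠ s)
    (hl : ℓ (s * t * s) = 3) (hv : s * t * s ≼ v) (hst : cs.LS φ (s * t))
    (hφt : φ (t * s) = t) :
    φ (s * t) = t * s * t ∧
      (cs.LS φ (s * t * s) ∨ φ (s * t * s) = s * t * s * t ∧ ℓ (s * t * s * t) = 4) := by
  have hsl : ℓ s = 1 := hs ▸ h.length_one
  have hds : cs.Dih s t s := inPar_letter hsl (Or.inl rfl)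
  have hdt : cs.Dih s t t := inPar_letter ht (Or.inr rfl)
  have hls2 := length_mul_letters hsl ht hts.symm
  have hstv : s * t ≼ v := (le_mul_letter hsl (by omega)).trans hv
  have hφ := apply_of_ls_mul h hs ht hst hstv
  refine ⟨hφ, ?_⟩
  have hd3 : cs.Dih s t (s * t * s) := (hds.mul hdt).mul hds
  have hd4 := h.inPar_apply hv (hs ▸ Or.inl rfl) hd3
  rcases h.adj hv with hup | hdown
  · rw [hl] at hup
    by_cases hh : ∃ k, ℓ k = 1 ∧ φ (s * t * s) = s * t * s * k
    · obtain ⟨k, hk, hk'⟩ := hh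
      have hkd : ℓ (φ (s * t * s) * k) < ℓ (φ (s * t * s)) := by
        rw [hup, hk', letter_mul_cancel_right hk]; omega
      rcases hd4.right_mem hk hkd with rfl | h1
      · rw [letter_mul_cancel_right hk] at hk'
        rw [hk'] at hup; omega
      · rw [(h1 : k = t)] at hk'
        exact Or.inr ⟨hk', hk' ▸ hup⟩
    · left
      push Not at hh
      rcases hd3.cover hd4 (by omega) with ⟨k, hk, -, hk'⟩ | ⟨k, hk, -, hk'⟩
      · exact ⟨⟨k, hk, hk', by omega⟩, hh⟩
      · exact absurd hk' (hh k hk)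
  · exfalso
    have h1 : φ (s * t * s) ≠ 1 := by
      intro h1; rw [h1, length_one] at hdown; omega
    obtain ⟨k, hk, hkd⟩ := exists_left_descent (cs := cs) (u := φ (s * t * s)) h1
    rcases hd4.left_mem hk hkd with rfl | h2
    · have h3 : φ (k * t * k) = k * t := Dih.eq_of_left hd4 (hds.mul hdt) (by omega) hk hkd
        (by rw [letter_mul_cancel_left hk]; omega)
      have h4 := h.invol hv
      rw [h3, hφ] at h4
      exact hst.2 k hk (by rw [hφ, h4])
    · rw [(h2 : k = t)] at hkd
      have h3 : φ (s * t * s) = t * s := Dih.eq_of_left hd4 (hdt.mul hds)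
        (by rw [length_mul_letters ht hsl hts]; omega) ht hkd
        (by rw [letter_mul_cancel_left ht, length_mul_letters ht hsl hts]; omega)
      have h4 := h.invol hv
      rw [h3, hφt] at h4
      rw [← h4] at hl; omega

namespace Main

variable {s t y : W}

theorem not_short (m : cs.Main v φ s t y) {p z g x : W} (hp : cs.Dih s t p)
    (hzt : ℓ (z * t) = ℓ z + 1) (hz1 : z ≠ 1) (hsz : ¬ s ≼ z) (htz : ¬ t ≼ z)
    (hcs : ∀ k, ℓ k = 1 → k ≼ z → k * s = s * k)
    (hR : ∀ k, ℓ k = 1 → ℓ (z * k) < ℓ z → k * t ≠ t * k)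
    (hadd : ℓ (p * (z * t)) = ℓ p + ℓ (z * t)) (hv : p * (z * t) ≼ v)
    (hD : ∀ k, ℓ k = 1 → ℓ (k * (p * (z * t))) < ℓ (p * (z * t)) → k = s ∨ k = t)
    (hg : ℓ g = 1) (hgst : g = s ∨ g = t) (hgp : ℓ (g * p) < ℓ p)
    (hd : cs.Dih s t x) (hx : cs.RS φ x) (hlt : ℓ x < ℓ (g * x)) (hls : cs.LS φ (g * x)) :
    ℓ p < ℓ (g * x) := by
  by_contra hlen
  have hs := m.s_letter
  have ht := m.letter
  obtain ⟨r, hr, hrz⟩ := exists_right_descent (cs := cs) (u := z) hz1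
  have hrle := right_descent_le hr hrz
  have hrs : r ≠ s := by rintro rfl; exact hsz hrle
  have hrt : r ≠ t := by rintro rfl; exact htz hrle
  have hrt' := hR r hr hrz
  have hrs' := hcs r hr hrle
  have hrtz := mul_letter_mono ht hrle (show ℓ z < ℓ (z * t) by omega)
  have hdq := hd.letter_mul hg hgst
  have hmul : ∀ a, a ≼ p → a * (r * t) ≼ v := fun a ha =>
    (mul_le_mul_of_additive ha hrtz hadd).trans hv
  have hle : ∀ u, cs.Dih s t u → ℓ (g * u) < ℓ u → ℓ u ≤ ℓ p → u ≼ p := by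
    intro u hu hgu hlu
    rcases hlu.lt_or_eq with h | h
    · exact Dih.le_of_length_lt hu hp h
    · rw [Dih.eq_of_left hu hp h hg hgu hgp]; exact bruhatLE_refl _
  have hqp := hle _ hdq (by rwa [letter_mul_cancel_left hg]) (by omega)
  have hpv : p ≼ v := (left_le_mul hadd).trans hv
  obtain ⟨k, hk, hkx⟩ := exists_right_descent (cs := cs) (u := x) (m.ne_one_of_rs hx)
  have hlg := length_letter_mul (cs := cs) hg x
  rcases hd.right_mem hk hkx with rfl | h1
  · exact m.sm.not_ls_mul_mul m.one ht m.rs hr hrs hrs' hrt' hdq hls (hqp.trans hpv)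
      (right_descent_of_suffix (by omega) hkx) (hmul _ hqp)
  obtain rfl : k = t := h1
  rename' k => t
  have hxt := length_mul_letter (cs := cs) ht x
  have hxt' : x * t ≼ x := mul_letter_le ht hkx
  by_cases hα : x * t = 1
  · have hxe : x = t := by
      rw [← letter_mul_cancel_right ht x, hα, one_mul]
    subst hxe
    rename' x => t
    rcases hgst with rfl | rfl
    swap
    · rw [letter_mul_self hg, length_one] at hlt; omega
    rename' g => s
    have hl2 := length_mul_letters hs ht m.ne.symm
    have hl3 := length_conj hs ht m.comm_ne.symm
    rcases (show ℓ p = 2 ∨ 3 ≤ ℓ p by omega) with hp2 | hp3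
    · have hpe : p = s * t := Dih.eq_of_left hp hdq (by omega) hs hgp
        (by rwa [letter_mul_cancel_left hs])
      have hts := m.comm_ne
      have he : p * (z * t) = s * (t * z * t) := by rw [hpe]; simp only [mul_assoc]
      have hst := not_le_letter hs ht m.ne.symm
      have hlu := cs.length_mul_le t (z * t)
      rw [← mul_assoc] at hlu
      refine hts (m.sm.letters_commute_of_letter_mul (u := t * z * t) m.one ht m.rs hls
        (apply_of_ls_mul m.sm m.one ht hls (hqp.trans hpv))
        (not_letter_le_mul hs (not_letter_le_mul hs hst hsz) hst) ?_ ?_ ?_ (he ▸ hv) t ht ?_)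
      · intro k hk hkle
        rcases letter_le_mul hk hkle with h | h
        · rcases letter_le_mul hk h with h | h
          · exact Or.inl (letter_le_letter hk ht h)
          · exact Or.inr (hcs k hk h)
        · exact Or.inl (letter_le_letter hk ht h)
      · rw [mul_assoc]
        refine left_le_mul ?_
        have h2 := cs.length_mul_le s (t * z * t)
        rw [mul_assoc t] at h2 he hlu
        rw [he] at hadd
        omega
      · intro k hk hkd hc
        have h1 : ℓ (k * (p * (z * t))) < ℓ (p * (z * t)) := by
          have h2 := cs.length_mul_le s (k * (t * z * t))
          rw [hadd, he, ← mul_assoc k, hc, mul_assoc]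
          omega
        rcases hD k hk h1 with rfl | rfl
        · exact absurd (left_descent_le hk hkd)
            (not_letter_le_mul hk (not_letter_le_mul hk hst hsz) hst)
        · exact hts hc
      · rw [mul_assoc, letter_mul_cancel_left ht]
        exact right_le_mul (by omega)
    · have hsts : s * t * s ≼ p :=
        hle _ (hdq.mul (inPar_letter hs (Or.inl rfl)))
          (by rw [mul_assoc, letter_mul_cancel_left hs, length_mul_letters ht hs m.ne, ← mul_assoc]
              omega) (by omega)
      obtain ⟨hφ, h2 | ⟨h2, h3⟩⟩ := exists_ls_conj m.sm m.one ht m.ne hl3 (hsts.trans hpv) hls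
        m.apply_ts
      · exact m.sm.not_ls_mul_mul m.one ht m.rs hr hrs hrs' hrt'
          (hdq.mul (inPar_letter hs (Or.inl rfl))) h2 (hsts.trans hpv)
          (by rw [letter_mul_cancel_right hs]; omega) (hmul _ hsts)
      · exact m.sm.not_conj_mul_mul m.one ht m.rs hr hrs hrs' hrt' hls h2 h3 (hsts.trans hpv)
          (hmul _ hsts)
  · have hgα : g * (x * t) ≼ p := by
      rw [← mul_assoc]
      refine bruhatLE.trans (mul_letter_le ht ?_) hqp
      exact right_descent_of_suffix (by omega) hkx
    refine hα (m.sm.mul_letters_bad m.one hx hls hg hlt hdq (letter_mul_cancel_right ht x).symm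
      (by omega) hr hrs hrt ?_ hrt').1
    simpa only [mul_assoc] using hmul _ hgα

end Main

end

section

variable {cs} {v : W} {φ : W → W}

theorem Dih.eq_one_or_eq_of_not_le {s t x : W} (hd : cs.Dih s t x) (ht : ¬ t ≼ x) :
    x = 1 ∨ x = s := by
  refine InPar.eq_of_singleton (cs := cs) fun k hk hle => ?_
  rcases hd k hk hle with h | h
  · exact h
  · exact absurd (h ▸ hle) ht

namespace Main

variable {s t y : W}

theorem length_apply_le (m : cs.Main v φ s t y) {p Y z w k g x : W} (hp : cs.Dih s t p)
    (hy : y = p * Y) (hl : ℓ y = ℓ p + ℓ Y) (hYz : Y = z * t * w) (hzt : ℓ (z * t) = ℓ z + 1)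
    (hlY : ℓ Y = ℓ (z * t) + ℓ w) (hsz : ¬ s ≼ z) (htz : ¬ t ≼ z)
    (hcs : ∀ k, ℓ k = 1 → k ≼ z → k * s = s * k)
    (hk : ℓ k = 1) (hkz : ℓ (k * z) < ℓ z) (htp : t ≼ p) (hkt : k * t ≠ t * k)
    (hg : ℓ g = 1) (hgst : g = s ∨ g = t) (hgp : ℓ (g * p) < ℓ p)
    (hd : cs.Dih s t x) (hx : cs.RS φ x) (hlt : ℓ x < ℓ (g * x)) (hle : g * x ≼ v)
    (hls : cs.LS φ (g * x)) : ℓ (g * x) ≤ ℓ p := by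
  by_contra hlen
  have hs := m.s_letter
  have ht := m.letter
  have hkle := left_descent_le hk hkz
  have hks : k ≠ s := by rintro rfl; exact hsz hkle
  have hknt : k ≠ t := by rintro rfl; exact htz hkle
  have hcomm := hcs k hk hkle
  have hdq := hd.letter_mul hg hgst
  have hlg := length_letter_mul (cs := cs) hg x
  have hlgp := length_letter_mul (cs := cs) hg p
  have hmul : ∀ a b, a ≼ p → b ≼ Y → a * b ≼ v := fun a b ha hb => by
    refine bruhatLE.trans ?_ m.le
    rw [hy] at hl ⊢
    exact mul_le_mul_of_additive ha hb hl
  have hkY : ℓ (k * Y) < ℓ Y := by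
    rw [hYz] at hlY ⊢
    exact left_descent_of_left_factor hlY (left_descent_of_left_factor (by omega) hkz)
  have hgy : ℓ (g * y) < ℓ y := by
    rw [hy] at hl ⊢
    exact left_descent_of_left_factor hl hgp
  have hxy : x ≼ g * p * Y := by
    have := strip_both_left hg (m.up hle hls.lt) (by rwa [letter_mul_cancel_left hg])
    rwa [letter_mul_cancel_left hg, hy, ← mul_assoc] at this
  obtain ⟨α, β, hα, hβ, hxe, hlx⟩ := exists_mul_of_le_mul hxy
  have hgα : ∀ a, a ≼ g * p → g * a ≼ p := fun a ha => by
    have := letter_mul_mono hg ha (by rwa [letter_mul_cancel_left hg])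
    rwa [letter_mul_cancel_left hg] at this
  have hβ1 : β ≠ 1 := by
    rintro rfl
    rw [length_one] at hlx
    have := length_le_of_bruhatLE hα
    omega
  have hkcomm : ∀ b, cs.Dih s t b → t ≼ b → k * b ≠ b * k := fun b hb htb hc =>
    hkt (letters_commute_of_mul_eq hk (hb.not_le hk (not_mem_pair hks hknt)) hc.symm t ht
      htb).symm
  have hbad : ∀ a b, g * a ≼ p → k * b ≼ Y → x = a * b → ℓ x = ℓ a + ℓ b →
      k * b ≠ b * k → a = 1 ∧ g * k = k * g := fun a b ha hb h1 h2 h3 => by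
    refine m.sm.mul_letters_bad m.one hx hls hg hlt hdq h1 h2 hk hks hknt ?_ h3
    have := hmul _ _ ha hb
    rwa [← mul_assoc] at this
  have hlts := length_mul_letters ht hs m.ne
  have hdβ : cs.Dih s t β := hd.mono (by rw [hxe] at hlx ⊢; exact right_le_mul hlx)
  by_cases htβ : t ≼ β
  · obtain ⟨rfl, hgk⟩ := hbad α β (hgα _ hα) (letter_mul_le_of_descent hk hβ hkY) hxe hlx
      (hkcomm β hdβ htβ)
    rw [one_mul] at hxe
    subst hxe
    obtain rfl : g = s := by
      rcases hgst with h | h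
      · exact h
      · rw [h] at hgk; exact absurd hgk.symm hkt
    rename' g => s, x => x
    have htx : ℓ (t * x) < ℓ x := by
      obtain ⟨c, hc, hcx⟩ := exists_left_descent (cs := cs) (u := x) hβ1
      rcases hd.left_mem hc hcx with h | h
      · rw [(h : c = s)] at hcx; omega
      · rwa [(h : c = t)] at hcx
    have hltx := length_letter_mul (cs := cs) ht x
    have hstp : s * t ≼ p := by
      refine hgα t ?_
      have h1 : t ≼ s * (s * p) := by rwa [letter_mul_cancel_left hs]
      exact (letter_le_mul ht h1).resolve_left (not_le_letter ht hs m.ne)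
    have hxt : x = t * (t * x) := (letter_mul_cancel_left ht x).symm
    have hdtx : cs.Dih s t (t * x) := hd.letter_mul ht (Or.inr rfl)
    by_cases h2 : t ≼ t * x
    · have h3 := (hbad t (t * x) hstp (letter_mul_le_of_descent hk
        ((letter_mul_le ht htx).trans hβ) hkY) hxt (by omega) (hkcomm _ hdtx h2)).1
      exact letter_ne_one ht h3
    · rcases hdtx.eq_one_or_eq_of_not_le h2 with h3 | h3
      · rw [h3, mul_one] at hxt
        have h4 := length_le_of_bruhatLE hstp
        rw [length_mul_letters hs ht m.ne.symm] at h4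
        rw [hxt, length_mul_letters hs ht m.ne.symm] at hlen
        omega
      · exact m.ne_ts_of_rs hx (by rw [hxt, h3])
  · obtain rfl := (hdβ.eq_one_or_eq_of_not_le htβ).resolve_left hβ1
    rename' β => s
    have hα1 : α ≠ 1 := by
      rintro rfl; exact m.ne_s_of_rs hx (by rw [hxe, one_mul])
    have hdα : cs.Dih s t α := hd.mono (by rw [hxe] at hlx ⊢; exact left_le_mul hlx)
    have htα : ℓ (α * t) < ℓ α := by
      obtain ⟨c, hc, hcx⟩ := exists_right_descent (cs := cs) (u := α) hα1
      rcases hdα.right_mem hc hcx with h | h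
      · rw [(h : c = s), ← hxe] at hcx; omega
      · rwa [(h : c = t)] at hcx
    have hlαt := length_mul_letter (cs := cs) ht α
    have hsw : s ≼ w := by
      rw [hYz] at hβ
      exact (letter_le_mul hs hβ).resolve_left
        (not_letter_le_mul hs hsz (not_le_letter hs ht m.ne.symm))
    have hkts : k * (t * s) ≼ Y := by
      rw [hYz] at hlY ⊢
      rw [← mul_assoc]
      exact mul_le_mul_of_additive (mul_letter_mono ht hkle (by omega)) hsw hlY
    have h1 := (hbad (α * t) (t * s) (hgα _ ((mul_letter_le ht htα).trans hα)) hkts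
      (by rw [hxe, ← mul_assoc, letter_mul_cancel_right ht]) (by omega)
      (hkcomm _ ((inPar_letter ht (Or.inr rfl)).mul (inPar_letter hs (Or.inl rfl)))
        (left_le_mul (by omega)))).1
    refine m.ne_ts_of_rs hx ?_
    rw [hxe, ← letter_mul_cancel_right ht α, h1, one_mul]

theorem not_t_le (m : cs.Main v φ s t y) {p Y : W} (hp : cs.Dih s t p) (hy : y = p * Y)
    (hl : ℓ y = ℓ p + ℓ Y) (hY : ∀ k ∈ ({s, t} : Set W), ℓ k = 1 → ℓ Y < ℓ (k * Y))
    (hp1 : p ≠ 1) : ¬ t ≼ Y := by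
  intro htY
  obtain ⟨z, w, hYz, hzt, hlY, hz1, hsz, htz, hcs, hR, hL⟩ := m.exists_left_factor hy hp hl hY htY
  obtain ⟨k, hk, hkz⟩ := exists_left_descent (cs := cs) (u := z) hz1
  obtain ⟨htp, hkt⟩ := hL k hk hkz
  obtain ⟨g, hg, hgp⟩ := exists_left_descent (cs := cs) (u := p) hp1
  have hgy : ℓ (g * y) < ℓ y := by
    rw [hy] at hl ⊢
    exact left_descent_of_left_factor hl hgp
  obtain ⟨hgst, x, hd, hx, hlt, hle, hls⟩ := m.left hg hgy
  have h1 := m.length_apply_le hp hy hl hYz hzt hlY hsz htz hcs hk hkz htp hkt hg hgst hgp hd hx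
    hlt hle hls
  have hyw : y = p * (z * t) * w := by rw [hy, hYz, mul_assoc p]
  have h2 := cs.length_mul_le p (z * t)
  have h3 := cs.length_mul_le (p * (z * t)) w
  rw [← hyw] at h3
  have hadd : ℓ (p * (z * t)) = ℓ p + ℓ (z * t) := by omega
  have hadd' : ℓ (p * (z * t) * w) = ℓ (p * (z * t)) + ℓ w := by rw [← hyw]; omega
  have h4 := m.not_short hp hzt hz1 hsz htz hcs hR hadd
    ((left_le_mul hadd').trans (hyw ▸ m.le))
    (fun c hc hcd => (m.left hc (by rw [hyw]; exact left_descent_of_left_factor hadd' hcd)).1)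
    hg hgst hgp hd hx hlt hls
  omega

theorem dih (m : cs.Main v φ s t y) : cs.Dih s t y := by
  by_contra hnd
  have hs := m.s_letter
  have ht := m.letter
  obtain ⟨p, Y, hy, hp, hl, hY⟩ := exists_parabolic_left cs {s, t} y
  have hy1 : y ≠ 1 := by
    rintro rfl; exact hnd (inPar_one _)
  have hYy : Y ≼ y := by
    rw [hy] at hl ⊢; exact right_le_mul hl
  have hp1 : p ≠ 1 := by
    rintro rfl
    rw [one_mul] at hy
    obtain ⟨g, hg, hgy⟩ := exists_left_descent (cs := cs) (u := y) hy1
    have := hY g (m.left hg hgy).1 hg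
    rw [← hy] at this
    omega
  have htY := m.not_t_le hp hy hl hY hp1
  have hY1 : Y ≠ 1 := by
    rintro rfl
    rw [mul_one] at hy
    exact hnd (hy ▸ hp)
  have hRY : ∀ k, ℓ k = 1 → ℓ (Y * k) < ℓ Y → ℓ (y * k) < ℓ y := fun k hk hkd => by
    rw [hy] at hl ⊢
    exact right_descent_of_suffix hl hkd
  have hR : ∀ k, ℓ k = 1 → ℓ (Y * k) < ℓ Y → k = s := fun k hk hkd => by
    rcases m.right hk (hRY k hk hkd) with h | h
    · exact absurd (h ▸ right_descent_le hk hkd) htY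
    · exact h.1
  obtain ⟨k, hk, hkd⟩ := exists_right_descent (cs := cs) (u := Y) hY1
  obtain rfl := hR k hk hkd
  rename' k => s
  have hlYs := length_mul_letter (cs := cs) hs Y
  have hYs1 : Y * s ≠ 1 := by
    intro h1
    have h2 : Y = s := by rw [← letter_mul_cancel_right hs Y, h1, one_mul]
    have := hY s (Or.inl rfl) hs
    rw [h2, letter_mul_self hs, length_one] at this
    omega
  obtain ⟨r, hr, hrd⟩ := exists_right_descent (cs := cs) (u := Y * s) hYs1
  have hrY := (right_descent_le hr hrd).trans (mul_letter_le hs hkd)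
  have hrt : r ≠ t := by rintro rfl; exact htY hrY
  have hrs : r ≠ s := by rintro rfl; rw [letter_mul_cancel_right hs] at hrd; omega
  have hne : r * s ≠ s * r := by
    intro hc
    refine hrs (hR r hr ?_)
    have e : Y * r = Y * s * r * s := by
      rw [mul_assoc (Y * s), hc, ← mul_assoc, letter_mul_cancel_right hs]
    rw [e]
    have := length_mul_letter (cs := cs) hs (Y * s * r)
    omega
  rcases m.right hs (hRY s hs hkd) with h | ⟨-, x, hd, hx, hxs, hlt, hle⟩
  · exact m.ne h.symm
  have hys := hRY s hs hkd
  have hxy : x ≼ y * s := by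
    have := strip_both_right hs (m.up hle hxs.lt) (by rwa [letter_mul_cancel_right hs])
    rwa [letter_mul_cancel_right hs] at this
  have hyse : y * s = p * (Y * s) := by rw [hy, mul_assoc]
  have hlys := length_mul_letter (cs := cs) hs y
  have hadd : ℓ (p * (Y * s)) = ℓ p + ℓ (Y * s) := by rw [← hyse]; omega
  rw [hyse] at hxy
  obtain ⟨a, b, ha, hb, hxe, hlx⟩ := exists_mul_of_le_mul hxy
  have hbr := mul_letter_le_of_descent hr hb hrd
  have hxr := mul_le_mul_of_additive ha hbr hadd
  rw [← mul_assoc, ← hxe, ← hyse] at hxr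
  have hxrs := mul_letter_mono hs hxr (by rwa [letter_mul_cancel_right hs])
  rw [letter_mul_cancel_right hs] at hxrs
  exact m.sm.not_ls_ls_one m.one ht m.rs hr hrt hne hd hx hxs hlt (hxrs.trans m.le)

end Main

end

section

/-- Data witnessing that left multiplication by the letter `g` fails to commute with `φ`. -/
def LBad (v : W) (φ : W → W) (g : W) : Prop :=
  ∃ t x, ℓ t = 1 ∧ t ≠ φ 1 ∧ (g = φ 1 ∨ g = t) ∧ cs.Dih (φ 1) t x ∧ ℓ x < ℓ (g * x) ∧
    g * x ≼ v ∧ (x = 1 ∨ cs.RS φ x) ∧ cs.LS φ (g * x)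

/-- Data witnessing that right multiplication by the letter `g` fails to commute with `φ`. -/
def RBad (v : W) (φ : W → W) (g : W) : Prop :=
  ∃ t x, ℓ t = 1 ∧ t ≠ φ 1 ∧ (g = φ 1 ∨ g = t) ∧ cs.Dih (φ 1) t x ∧ ℓ x < ℓ (x * g) ∧
    x * g ≼ v ∧ (x = 1 ∨ cs.LS φ x) ∧ cs.RS φ (x * g)

/-- The dihedral subgroup `⟨φ 1, t⟩` contains both kinds of one-sided elements. -/
structure Mixed (v : W) (φ : W → W) (t : W) : Prop where
  letter : ℓ t = 1
  ne : t ≠ φ 1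
  ls : ∃ q, cs.Dih (φ 1) t q ∧ q ≼ v ∧ cs.LS φ q
  rs : ∃ q, cs.Dih (φ 1) t q ∧ q ≼ v ∧ cs.RS φ q

/-- Every descent of `y` is bad. -/
structure AllBad (v : W) (φ : W → W) (y : W) : Prop where
  sm : cs.SM v φ
  le : y ≼ v
  up : ∀ {u}, u ≼ v → ℓ u < ℓ (φ u) → u ≼ y
  left : ∀ {g}, ℓ g = 1 → ℓ (g * y) < ℓ y → cs.LBad v φ g
  right : ∀ {g}, ℓ g = 1 → ℓ (y * g) < ℓ y → cs.RBad v φ g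

variable {cs} {v : W} {φ : W → W}

theorem SM.inv_one (h : cs.SM v φ) : (fun u => (φ u⁻¹)⁻¹) 1 = φ 1 := h.inv_one_eq rfl

theorem SM.inv_apply_one (h : cs.SM v φ) : (φ 1⁻¹)⁻¹ = φ 1 := h.inv_one_eq rfl

theorem SM.apply_one (h : cs.SM v φ) : φ (φ 1) = 1 := h.invol (one_bruhatLE _)

theorem RBad.inv (h : cs.SM v φ) {g : W} (hg : ℓ g = 1) (hb : cs.RBad v φ g) :
    cs.LBad v⁻¹ (fun u => (φ u⁻¹)⁻¹) g := by
  obtain ⟨t, x, ht, hts, hgt, hd, hlt, hle, hx, hr⟩ := hb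
  refine ⟨t, x⁻¹, ht, ?_, ?_, ?_, ?_, ?_, ?_, ?_⟩
  · rwa [h.inv_one]
  · rwa [h.inv_one]
  · rw [h.inv_one]; exact InPar.inv hd
  · rwa [length_letter_mul_inv hg, cs.length_inv]
  · rw [← inv_mul_letter hg]; exact inv_bruhatLE_inv hle
  · exact hx.imp (fun h => by rw [h, inv_one]) rs_inv_iff.2
  · rw [← inv_mul_letter hg]; exact ls_inv_iff.2 hr

theorem LBad.inv (h : cs.SM v φ) {g : W} (hg : ℓ g = 1) (hb : cs.LBad v φ g) :
    cs.RBad v⁻¹ (fun u => (φ u⁻¹)⁻¹) g := by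
  obtain ⟨t, x, ht, hts, hgt, hd, hlt, hle, hx, hr⟩ := hb
  refine ⟨t, x⁻¹, ht, ?_, ?_, ?_, ?_, ?_, ?_, ?_⟩
  · rwa [h.inv_one]
  · rwa [h.inv_one]
  · rw [h.inv_one]; exact InPar.inv hd
  · rwa [length_inv_mul_letter hg, cs.length_inv]
  · rw [← inv_letter_mul hg]; exact inv_bruhatLE_inv hle
  · exact hx.imp (fun h => by rw [h, inv_one]) ls_inv_iff.2
  · rw [← inv_letter_mul hg]; exact rs_inv_iff.2 hr

theorem Mixed.inv (h : cs.SM v φ) {t : W} (hm : cs.Mixed v φ t) :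
    cs.Mixed v⁻¹ (fun u => (φ u⁻¹)⁻¹) t where
  letter := hm.letter
  ne := by rw [h.inv_apply_one]; exact hm.ne
  ls := by
    obtain ⟨q, hd, hq, hr⟩ := hm.rs
    exact ⟨q⁻¹, by rw [h.inv_apply_one]; exact InPar.inv hd, inv_bruhatLE_inv hq, ls_inv_iff.2 hr⟩
  rs := by
    obtain ⟨q, hd, hq, hr⟩ := hm.ls
    exact ⟨q⁻¹, by rw [h.inv_apply_one]; exact InPar.inv hd, inv_bruhatLE_inv hq, rs_inv_iff.2 hr⟩

theorem AllBad.inv {y : W} (h : cs.AllBad v φ y) :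
    cs.AllBad v⁻¹ (fun u => (φ u⁻¹)⁻¹) y⁻¹ where
  sm := h.sm.inv
  le := inv_bruhatLE_inv h.le
  up hu hl := by
    rw [cs.length_inv] at hl
    exact SM.inv_le_iff.1 (h.up (SM.inv_le_iff.2 hu) (by rwa [cs.length_inv]))
  left hg hd := RBad.inv h.sm hg (h.right hg (by
    rwa [length_letter_mul_inv hg, cs.length_inv] at hd))
  right hg hd := LBad.inv h.sm hg (h.left hg (by
    rwa [length_inv_mul_letter hg, cs.length_inv] at hd))

theorem LBad.cases (h : cs.SM v φ) {g : W} (hb : cs.LBad v φ g) : cs.LS φ g ∨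
    ∃ t x, cs.Mixed v φ t ∧ (g = φ 1 ∨ g = t) ∧ cs.Dih (φ 1) t x ∧ cs.RS φ x ∧
      ℓ x < ℓ (g * x) ∧ g * x ≼ v ∧ cs.LS φ (g * x) := by
  obtain ⟨t, x, ht, hts, hgt, hd, hlt, hle, rfl | hx, hr⟩ := hb
  · left; rwa [mul_one] at hr
  · right
    have hg : ℓ g = 1 := by
      rcases hgt with rfl | rfl
      · exact h.length_one
      · exact ht
    exact ⟨t, x, ⟨ht, hts, ⟨_, hd.letter_mul hg hgt, hle, hr⟩,
      ⟨x, hd, (le_letter_mul hg hlt).trans hle, hx⟩⟩, hgt, hd, hx, hlt, hle, hr⟩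

theorem RBad.cases (h : cs.SM v φ) {g : W} (hb : cs.RBad v φ g) : cs.RS φ g ∨
    ∃ t x, cs.Mixed v φ t ∧ (g = φ 1 ∨ g = t) ∧ cs.Dih (φ 1) t x ∧ cs.LS φ x ∧
      ℓ x < ℓ (x * g) ∧ x * g ≼ v ∧ cs.RS φ (x * g) := by
  obtain ⟨t, x, ht, hts, hgt, hd, hlt, hle, rfl | hx, hr⟩ := hb
  · left; rwa [one_mul] at hr
  · right
    have hg : ℓ g = 1 := by
      rcases hgt with rfl | rfl
      · exact h.length_one
      · exact ht
    exact ⟨t, x, ⟨ht, hts, ⟨x, hd, (le_mul_letter hg hlt).trans hle, hx⟩,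
      ⟨_, hd.mul (inPar_letter hg hgt), hle, hr⟩⟩, hgt, hd, hx, hlt, hle, hr⟩

theorem Mixed.t_le (h : cs.SM v φ) {t : W} (hm : cs.Mixed v φ t) : t ≼ v := by
  obtain ⟨q, hd, hq, hr⟩ := hm.ls
  exact (h.ls_t_le rfl hd hr hm.letter).trans hq

theorem Mixed.rs_or_ls (h : cs.SM v φ) {t : W} (hm : cs.Mixed v φ t) :
    cs.RS φ t ∨ cs.LS φ t := by
  rcases h.letter_trichotomy rfl hm.letter hm.ne (hm.t_le h) with h1 | h1 | hc
  · exact Or.inl h1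
  · exact Or.inr h1
  · right
    obtain ⟨q, hd, hq, hr⟩ := hm.ls
    have h2 := length_mul_letters h.length_one hm.letter hm.ne.symm
    have h3 : φ q ≼ φ 1 * t := Dih.le_of_descents (s := φ 1) (t := t)
      (by rw [← hc, letter_mul_cancel_right h.length_one, hm.letter, hc, h2]; omega)
      (by rw [letter_mul_cancel_right hm.letter, h.length_one, h2]; omega)
      (h.inPar_apply hq (Or.inl rfl) hd)
    have h4 := length_le_of_bruhatLE h3
    have h5 := hr.lt
    have hq1 : ℓ q = 1 := by
      have := mt cs.length_eq_zero_iff.1 (hr.ne_one h.length_one)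
      omega
    rcases hd q hq1 (bruhatLE_refl _) with h6 | h6
    · exact absurd h6 (h.ls_ne rfl hr)
    · rwa [← (h6 : q = t)]

theorem Mixed.unique (h : cs.SM v φ) {t t' q y : W} (hm : cs.MinLS v φ (φ 1) t q)
    (hqy : q ≼ y) (hy : y ≼ v) (hup : ∀ {u}, u ≼ v → ℓ u < ℓ (φ u) → u ≼ y)
    (ht' : cs.Mixed v φ t') : t' = t := by
  by_contra hne
  rcases ht'.rs_or_ls h with h1 | h1
  · obtain ⟨q', hd, hq', hr⟩ := ht'.ls
    obtain ⟨q₁, hq₁, hm₁⟩ := exists_minLS ht'.letter h1 hd hq' hr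
    exact h.not_two_minLS rfl (Ne.symm hne) hm hm₁ hy hqy (hq₁.trans (hup hq' hr.lt))
  · obtain ⟨q', hd, hq', hr⟩ := (ht'.inv h).ls
    rw [h.inv_apply_one] at hd
    obtain ⟨q₁, -, hm₁⟩ := exists_minLS ht'.letter (by
      rw [← letter_inv ht'.letter]; exact rs_inv_iff.2 h1) hd hq' hr
    rw [← inv_inv q₁] at hm₁
    exact h.not_minLS_minRS rfl hm hm₁

theorem AllBad.main {y t : W} (h : cs.AllBad v φ y) (hm : cs.Mixed v φ t) (hrs : cs.RS φ t) :
    cs.Main v φ (φ 1) t y := by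
  obtain ⟨q', hd', hq', hr'⟩ := hm.ls
  obtain ⟨q, hqq', hq⟩ := exists_minLS hm.letter hrs hd' hq' hr'
  have hqy := h.up hq.le hq.ls.lt
  have huniq : ∀ t', cs.Mixed v φ t' → t' = t := fun t' ht' =>
    Mixed.unique h.sm hq hqy h.le h.up ht'
  refine ⟨h.sm, rfl, hm.letter, hrs, hm.t_le h.sm, h.le, h.up, ?_, ?_⟩
  · intro g hg hgy
    rcases (h.left hg hgy).cases h.sm with h1 | ⟨t', x, ht', hgt, hd, hx, hlt, hle, hls⟩
    · have h2 := mul_letter_le_of_descent hm.letter (hq.s_le h.sm rfl) (hq.mul_lt h.sm rfl)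
      have h3 := letter_mul_le_of_descent hg (h2.trans hqy) hgy
      rw [← mul_assoc] at h3
      exact absurd (h3.trans h.le) (h.sm.not_ls_one_rs rfl hg hm.letter h1 hrs)
    · obtain rfl := huniq t' ht'
      exact ⟨hgt, x, hd, hx, hlt, hle, hls⟩
  · intro a ha hay
    rcases (h.right ha hay).cases h.sm with h1 | ⟨t', x, ht', hgt, hd, hx, hlt, hle, hls⟩
    · left
      by_contra hne
      exact h.sm.ls_mul_rs_letter rfl hq.dih hq.ls (hq.s_le h.sm rfl) ha h1 hne
        ((mul_letter_le_of_descent ha hqy hay).trans h.le)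
    · obtain rfl := huniq t' ht'
      rcases hgt with rfl | rfl
      · exact Or.inr ⟨rfl, x, hd, hx, hls, hlt, hle⟩
      · exact Or.inl rfl

theorem AllBad.eq_one {y : W} (h : cs.AllBad v φ y) (hm : ∀ t, ¬ cs.Mixed v φ t) : y = 1 := by
  by_contra hy1
  have hs := h.sm.length_one
  have hL : ∀ {g}, ℓ g = 1 → ℓ (g * y) < ℓ y → cs.LS φ g := fun hg hgy => by
    rcases (h.left hg hgy).cases h.sm with h1 | ⟨t, x, ht, -⟩
    · exact h1
    · exact absurd ht (hm t)
  have hR : ∀ {g}, ℓ g = 1 → ℓ (y * g) < ℓ y → cs.RS φ g := fun hg hgy => by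
    rcases (h.right hg hgy).cases h.sm with h1 | ⟨t, x, ht, -⟩
    · exact h1
    · exact absurd ht (hm t)
  obtain ⟨c, hc, hcy⟩ := exists_left_descent (cs := cs) (u := y) hy1
  obtain ⟨a, ha, hay⟩ := exists_right_descent (cs := cs) (u := y) hy1
  by_cases hsy : φ 1 ≼ y
  · have h1 := mul_letter_le_of_descent ha (letter_mul_le_of_descent hc hsy hcy) hay
    exact h.sm.not_ls_one_rs rfl hc ha (hL hc hcy) (hR ha hay) (h1.trans h.le)
  · obtain ⟨a', b', hy, hl, -, ha', hb'⟩ := h.sm.exists_insert_apply rfl h.le hsy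
    by_cases ha1 : a' = 1
    · rw [ha1, one_mul] at hy
      have hab : a ≼ b' := hy ▸ right_descent_le ha hay
      have h1 := h.sm.rs_letter rfl ha ((right_descent_le ha hay).trans h.le) (hR ha hay)
      exact h1.2.1 (h1.1.symm.trans (hb' a hab))
    · obtain ⟨k, hk, hka⟩ := exists_left_descent (cs := cs) (u := a') ha1
      have hky : ℓ (k * y) < ℓ y := by
        rw [hy] at hl ⊢; exact left_descent_of_left_factor hl hka
      have h1 := h.sm.ls_letter rfl hk ((left_descent_le hk hky).trans h.le) (hL hk hky)
      exact h1.2.1 ((ha' k (left_descent_le hk hka)).symm.trans h1.1)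

theorem AllBad.dih {y : W} (h : cs.AllBad v φ y) : ∃ t, cs.Dih (φ 1) t y := by
  by_cases hm : ∃ t, cs.Mixed v φ t
  · obtain ⟨t, ht⟩ := hm
    refine ⟨t, ?_⟩
    rcases ht.rs_or_ls h.sm with h1 | h1
    · exact (h.main ht h1).dih
    · have h2 := (h.inv.main (ht.inv h.sm) (by
        rw [← letter_inv ht.letter]; exact rs_inv_iff.2 h1)).dih
      rw [h.sm.inv_apply_one] at h2
      have h3 := InPar.inv h2
      rwa [inv_inv] at h3
  · push Not at hm
    exact ⟨1, by rw [h.eq_one hm]; exact inPar_one _⟩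

/-- Either some descent of `φ v` commutes with `φ` or `v` lies in a dihedral subgroup. -/
theorem SM.exists_descent (h : cs.SM v φ) :
    (∃ g, ℓ g = 1 ∧ ℓ (g * φ v) < ℓ (φ v) ∧
      ∀ u, ℓ u < ℓ (g * u) → g * u ≼ v → φ (g * u) = g * φ u) ∨
    (∃ g, ℓ g = 1 ∧ ℓ (φ v * g) < ℓ (φ v) ∧
      ∀ u, ℓ u < ℓ (u * g) → u * g ≼ v → φ (u * g) = φ u * g) ∨
    ∃ t, cs.Dih (φ 1) t v := by
  by_contra hno
  push Not at hno
  obtain ⟨h1, h2, h3⟩ := hno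
  have hvv := bruhatLE_refl (cs := cs) v
  have hb : cs.AllBad v φ (φ v) :=
    ⟨h, h.le hvv, fun hu hl => h.strip hu hvv hl,
      fun hg hd => h.left_bad hg (h1 _ hg hd), fun hg hd => h.right_bad hg (h2 _ hg hd)⟩
  obtain ⟨t, ht⟩ := hb.dih
  have h4 := h.inPar_apply (h.le hvv) (Or.inl rfl) ht
  rw [h.invol hvv] at h4
  exact h3 t h4

end

section

/-- The recursion for `R`-polynomials with respect to the matching `φ`. -/
def Calc (R : W → W → ℤ[X]) (φ : W → W) (u v : W) : Prop :=
  (ℓ (φ u) < ℓ u → R u v = R (φ u) (φ v)) ∧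
  (ℓ u < ℓ (φ u) → R u v = (X - 1) * R u (φ v) + X * R (φ u) (φ v))

/-- The `R`-polynomials of intervals of positive length in dihedral groups. -/
noncomputable def dihR : ℕ → ℤ[X]
  | 0 => 1
  | 1 => X - 1
  | 2 => (X - 1) ^ 2
  | n + 3 => (X - 1) * dihR (n + 2) + X * dihR (n + 1)

variable {cs} {v : W} {φ : W → W} {R : W → W → ℤ[X]}

namespace RAxioms

theorem left (hR : RAxioms cs R) {g x y : W} (hg : ℓ g = 1) (hx : ℓ x < ℓ (g * x))
    (hy : ℓ y < ℓ (g * y)) :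
    R (g * x) (g * y) = R x y ∧ R x (g * y) = (X - 1) * R x y + X * R (g * x) y := by
  obtain ⟨i, rfl⟩ := cs.length_eq_one_iff.1 hg
  have := length_letter_mul (cs := cs) hg x
  have := length_letter_mul (cs := cs) hg y
  exact hR.2.2.1 i x y (by omega) (by omega)

theorem right (hR : RAxioms cs R) {g x y : W} (hg : ℓ g = 1) (hx : ℓ x < ℓ (x * g))
    (hy : ℓ y < ℓ (y * g)) :
    R (x * g) (y * g) = R x y ∧ R x (y * g) = (X - 1) * R x y + X * R (x * g) y := by
  obtain ⟨i, rfl⟩ := cs.length_eq_one_iff.1 hg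
  have := length_mul_letter (cs := cs) hg x
  have := length_mul_letter (cs := cs) hg y
  exact hR.2.2.2 i x y (by omega) (by omega)

theorem eq_zero (hR : RAxioms cs R) {x y : W} (h : ¬ x ≼ y) : R x y = 0 := hR.2.1 x y h

theorem inv (hR : RAxioms cs R) : RAxioms cs (fun x y => R x⁻¹ y⁻¹) := by
  refine ⟨fun u => hR.1 _, fun u v h => hR.2.1 _ _ fun h' => h ((inv_bruhatLE_inv_iff).1 h'),
    fun i x y hx hy => ?_, fun i x y hx hy => ?_⟩
  · have hi := cs.length_simple i
    simp only [inv_letter_mul hi]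
    exact hR.2.2.2 i x⁻¹ y⁻¹ (by rw [length_inv_mul_letter hi, cs.length_inv, hx])
      (by rw [length_inv_mul_letter hi, cs.length_inv, hy])
  · have hi := cs.length_simple i
    simp only [inv_mul_letter hi]
    exact hR.2.2.1 i x⁻¹ y⁻¹ (by rw [length_letter_mul_inv hi, cs.length_inv, hx])
      (by rw [length_letter_mul_inv hi, cs.length_inv, hy])

theorem dih (hR : RAxioms cs R) {s t w : W} (hw : cs.Dih s t w) :
    ∀ {u}, u ≼ w → R u w = dihR (ℓ w - ℓ u) := by
  induction w using left_induction (cs := cs) with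
  | h1 =>
    intro u hu
    obtain rfl := bruhatLE_antisymm hu (one_bruhatLE u)
    rw [hR.1, Nat.sub_self, dihR]
  | hs k w hk hl ih =>
    intro u hu
    have hlw : ℓ w < ℓ (k * w) := by omega
    have hdw := hw.mono (le_letter_mul hk hlw)
    have ih := @ih hdw
    rcases length_letter_mul (cs := cs) hk u with h1 | h1
    · have huw : u ≼ w := by
        have := strip_left hk hu (by omega)
        rwa [letter_mul_cancel_left hk] at this
      have hk' := hw.left_mem hk (by rw [letter_mul_cancel_left hk]; exact hlw)
      have hdku : cs.Dih s t (k * u) := (inPar_letter hk hk').mul (hdw.mono huw)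
      rw [(hR.left hk (by omega) hlw).2, ih huw, hl]
      obtain ⟨d, hd⟩ := Nat.exists_eq_add_of_le (length_le_of_bruhatLE huw)
      rw [hd, show ℓ u + d - ℓ u = d by omega, show ℓ u + d + 1 - ℓ u = d + 1 by omega]
      match d, hd with
      | 0, hd =>
        rw [hR.eq_zero fun h => ?_]
        · simp [dihR]
        · have := length_le_of_bruhatLE h
          omega
      | 1, hd =>
        rw [hR.eq_zero fun h => ?_]
        · simp [dihR, sq]
        · have h2 := eq_of_bruhatLE_of_length h (by omega)
          have h3 := length_letter_mul (cs := cs) hk (k * u)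
          rw [← h2] at hl
          rw [letter_mul_cancel_left hk] at hl
          omega
      | d + 2, hd =>
        rw [ih (Dih.le_of_length_lt hdku hdw (by omega)), dihR]
        congr 3
        omega
    · have h2 := hR.left (x := k * u) (y := w) hk (by rw [letter_mul_cancel_left hk]; omega) hlw
      have h3 := strip_both_left hk hu (by omega)
      rw [letter_mul_cancel_left hk] at h2 h3
      rw [h2.1, ih h3]
      congr 1
      omega

end RAxioms

namespace SM

theorem calc_of_dih (h : cs.SM v φ) (hR : RAxioms cs R) {t u : W} (hd : cs.Dih (φ 1) t v)
    (hv : ℓ (φ v) < ℓ v) (hu : u ≼ v) : cs.Calc R φ u v := by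
  have hvv := bruhatLE_refl (cs := cs) v
  have hdy := h.inPar_apply hvv (Or.inl rfl) hd
  have hlv := h.adj hvv
  have hlu := h.adj hu
  refine ⟨fun hl => ?_, fun hl => ?_⟩
  · rw [hR.dih hd hu, hR.dih hdy (h.strip_both hu hvv hl)]
    congr 1
    omega
  · have hφu := h.le_of_down hu hvv hv
    have h1 := length_le_of_bruhatLE hφu
    obtain ⟨d, hd'⟩ := Nat.exists_eq_add_of_le h1
    rw [hR.dih hd hu, hR.dih hdy (h.strip hu hvv hl),
      show ℓ v - ℓ u = d + 1 by omega, show ℓ (φ v) - ℓ u = d by omega]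
    match d, hd' with
    | 0, hd' =>
      rw [hR.eq_zero fun h2 => ?_]
      · simp [dihR]
      · have := length_le_of_bruhatLE h2
        omega
    | 1, hd' =>
      rw [hR.eq_zero fun h2 => ?_]
      · simp [dihR, sq]
      · have h3 := eq_of_bruhatLE_of_length h2 (by omega)
        have h4 := h.invol hu
        rw [h3, h.invol hvv] at h4
        subst h4
        omega
    | d + 2, hd' =>
      rw [hR.dih hdy (Dih.le_of_length_lt (h.inPar_apply hu (Or.inl rfl) (hd.mono hu)) hdy
        (by omega)), dihR]
      congr 3
      omega

theorem calc_of_forall (h : cs.SM v φ) (hR : RAxioms cs R) {w : W} (hw : w ≼ v)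
    (hl : ℓ (φ w) < ℓ w) (hc : ∀ u, u ≼ w → cs.Calc R φ u w) {u : W} (hu : u ≼ v) :
    cs.Calc R φ u w := by
  by_cases huw : u ≼ w
  · exact hc u huw
  · have h1 : ¬ u ≼ φ w := fun h1 => huw (h1.trans (h.down hw hl))
    have h2 : ¬ φ u ≼ φ w := fun h2 => huw (by
      have := h.mono_up h2 (h.le hw) (by rwa [h.invol hw])
      rwa [h.invol hu, h.invol hw] at this)
    unfold Calc
    rw [hR.eq_zero huw, hR.eq_zero h1, hR.eq_zero h2]
    simp

theorem lt_letter_mul_apply (h : cs.SM v φ) {g u : W} (hg : ℓ g = 1)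
    (hgu : g * u ≼ v) (hc : φ (g * u) = g * φ u) (hne : g * u ≠ φ u)
    (hlt : ℓ u < ℓ (g * u)) : ℓ (φ u) < ℓ (g * φ u) := by
  have h1 := length_letter_mul (cs := cs) hg u
  have h2 := h.special (le_letter_mul hg hlt) hgu (by omega) (Ne.symm hne)
  rw [hc] at h2
  have h3 := length_le_of_bruhatLE h2
  have h4 := length_letter_mul (cs := cs) hg (φ u)
  omega

theorem calc_of_left (h : cs.SM v φ) (hR : RAxioms cs R) {g : W} (hv : ℓ (φ v) < ℓ v)
    (hg : ℓ g = 1) (hgy : ℓ (g * φ v) < ℓ (φ v))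
    (hcomm : ∀ u, ℓ u < ℓ (g * u) → g * u ≼ v → φ (g * u) = g * φ u) :
    g * v ≼ v ∧ ℓ (g * v) + 1 = ℓ v ∧ ℓ (φ (g * v)) < ℓ (g * v) ∧
      ((∀ u, u ≼ g * v → cs.Calc R φ u (g * v)) → ∀ u, u ≼ v → cs.Calc R φ u v) := by
  have hvv := bruhatLE_refl (cs := cs) v
  have hy := h.le hvv
  have hc0 : φ (φ v) = g * φ (g * φ v) := by
    have := hcomm (g * φ v) (by rwa [letter_mul_cancel_left hg])
      (by rwa [letter_mul_cancel_left hg])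
    rwa [letter_mul_cancel_left hg] at this
  rw [h.invol hvv] at hc0
  have hgv : φ (g * φ v) = g * v := by
    rw [hc0, letter_mul_cancel_left hg, ← hc0]
  have hgyv : g * φ v ≼ v := (letter_mul_le hg hgy).trans hy
  have hgvv : g * v ≼ v := hgv ▸ h.le hgyv
  have hφgv : φ (g * v) = g * φ v := by rw [← hgv, h.invol hgyv]
  have l1 := length_letter_mul (cs := cs) hg v
  have l2 := length_letter_mul (cs := cs) hg (φ v)
  have l3 := h.adj hvv
  have l4 := h.adj hgyv
  rw [hgv] at l4
  have hlgv : ℓ (g * v) + 1 = ℓ v := by omega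
  have hlow : ℓ (φ (g * v)) < ℓ (g * v) := by rw [hφgv]; omega
  refine ⟨hgvv, hlgv, hlow, fun ih u hu => ?_⟩
  have hst : ∀ u, u ≼ v → g * u ≼ v := fun u hu => letter_mul_le_of_descent hg hu (by omega)
  have hcom : ∀ u, u ≼ v → φ (g * u) = g * φ u := fun u hu => by
    rcases length_letter_mul (cs := cs) hg u with h1 | h1
    · exact hcomm u (by omega) (hst u hu)
    · have := hcomm (g * u) (by rw [letter_mul_cancel_left hg]; omega)
        (by rwa [letter_mul_cancel_left hg])
      rw [letter_mul_cancel_left hg] at this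
      rw [this, letter_mul_cancel_left hg]
  have ih' : ∀ u, u ≼ v → cs.Calc R φ u (g * v) := fun u hu =>
    h.calc_of_forall hR hgvv hlow ih hu
  simp only [Calc, hφgv] at ih'
  have hup : ∀ x, ℓ x < ℓ (g * x) →
      R x v = (X - 1) * R x (g * v) + X * R (g * x) (g * v) ∧
      R x (φ v) = (X - 1) * R x (g * φ v) + X * R (g * x) (g * φ v) := fun x hx => by
    have h1 := (hR.left (x := x) (y := g * v) hg hx (by
      rw [letter_mul_cancel_left hg]; omega)).2
    have h2 := (hR.left (x := x) (y := g * φ v) hg hx (by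
      rw [letter_mul_cancel_left hg]; omega)).2
    rw [letter_mul_cancel_left hg] at h1 h2
    exact ⟨h1, h2⟩
  have hdown : ∀ x, ℓ (g * x) < ℓ x →
      R x v = R (g * x) (g * v) ∧ R x (φ v) = R (g * x) (g * φ v) := fun x hx => by
    have h1 := (hR.left (x := g * x) (y := g * v) hg (by rwa [letter_mul_cancel_left hg]) (by
      rw [letter_mul_cancel_left hg]; omega)).1
    have h2 := (hR.left (x := g * x) (y := g * φ v) hg (by rwa [letter_mul_cancel_left hg]) (by
      rw [letter_mul_cancel_left hg]; omega)).1
    rw [letter_mul_cancel_left hg, letter_mul_cancel_left hg] at h1 h2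
    exact ⟨h1, h2⟩
  have l5 := length_letter_mul (cs := cs) hg u
  by_cases hgu : g * u = φ u
  · have hgu' : g * φ u = u := by rw [← hgu, letter_mul_cancel_left hg]
    refine ⟨fun hl => ?_, fun hl => ?_⟩
    · rw [(hdown u (by rwa [hgu])).1, (hup (φ u) (by rwa [hgu'])).2, hgu, hgu',
        (ih' (φ u) (h.le hu)).2 (by rwa [h.invol hu]), h.invol hu]
    · rw [(hup u (by rwa [hgu])).1, (hup u (by rwa [hgu])).2, (hdown (φ u) (by rwa [hgu'])).2,
        hgu, hgu', (ih' u hu).2 hl, (ih' (φ u) (h.le hu)).1 (by rwa [h.invol hu]), h.invol hu]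
  · have hgu2 := hst u hu
    have l6 := h.adj hu
    have l7 := h.adj hgu2
    rw [hcom u hu] at l7
    have l8 := length_letter_mul (cs := cs) hg (φ u)
    rcases l5 with l5 | l5
    · have l9 := h.lt_letter_mul_apply hg hgu2 (hcom u hu) hgu (by omega)
      refine ⟨fun hl => ?_, fun hl => ?_⟩
      · rw [(hup u (by omega)).1, (hup (φ u) l9).2, (ih' u hu).1 hl,
          (ih' _ hgu2).1 (by rw [hcom u hu]; omega), hcom u hu]
      · rw [(hup u (by omega)).1, (hup u (by omega)).2, (hup (φ u) l9).2, (ih' u hu).2 hl,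
          (ih' _ hgu2).2 (by rw [hcom u hu]; omega), hcom u hu]
        ring
    · have l9 : ℓ (g * φ u) < ℓ (φ u) := by
        by_contra hno
        have h1 := h.lt_letter_mul_apply (u := φ u) hg (hst _ (h.le hu))
          (hcom _ (h.le hu)) (fun h2 => hgu (by
            rw [h.invol hu] at h2; rw [← h2, letter_mul_cancel_left hg, h2])) (by omega)
        rw [h.invol hu] at h1
        omega
      refine ⟨fun hl => ?_, fun hl => ?_⟩
      · rw [(hdown u (by omega)).1, (hdown (φ u) l9).2,
          (ih' _ hgu2).1 (by rw [hcom u hu]; omega), hcom u hu]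
      · rw [(hdown u (by omega)).1, (hdown u (by omega)).2, (hdown (φ u) l9).2,
          (ih' _ hgu2).2 (by rw [hcom u hu]; omega), hcom u hu]

theorem calc_of_inv {u v : W} (h : cs.Calc (fun x y => R x⁻¹ y⁻¹) (fun u => (φ u⁻¹)⁻¹) u⁻¹ v⁻¹) :
    cs.Calc R φ u v := by
  simpa only [Calc, inv_inv, cs.length_inv] using h

theorem calc_apply (h : cs.SM v φ) (hR : RAxioms cs R) (hv : ℓ (φ v) < ℓ v) :
    ∀ u, u ≼ v → cs.Calc R φ u v := by
  induction hn : ℓ v generalizing v φ R with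
  | zero => omega
  | succ n ih =>
    rcases h.exists_descent with ⟨g, hg, hgy, hcomm⟩ | ⟨g, hg, hgy, hcomm⟩ | ⟨t, ht⟩
    · obtain ⟨h1, h2, h3, h4⟩ := h.calc_of_left hR hv hg hgy hcomm
      exact h4 (ih (h.restrict h1 h3) hR h3 (by omega))
    · intro u hu
      refine calc_of_inv ?_
      obtain ⟨h1, h2, h3, h4⟩ := h.inv.calc_of_left hR.inv (g := g)
        (by rwa [inv_inv, cs.length_inv, cs.length_inv]) hg
        (by rwa [inv_inv, length_letter_mul_inv hg, cs.length_inv])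
        (fun u hu hgu => by
          rw [inv_letter_mul hg]
          have := hcomm u⁻¹ (by rwa [length_inv_mul_letter hg, cs.length_inv])
            (by rw [← inv_letter_mul hg]; exact inv_le_iff.2 hgu)
          rw [this, inv_mul_letter hg])
      rw [cs.length_inv] at h2
      exact h4 (ih (h.inv.restrict h1 h3) hR.inv h3 (by omega)) _ (inv_bruhatLE_inv hu)
    · exact fun u hu => h.calc_of_dih hR ht hv hu

end SM

end

section

variable {cs}
variable {v : W}

theorem SM.mul_right {k : W} (hk : ℓ k = 1) (hv : ℓ (v * k) < ℓ v) : cs.SM v (fun u => u * k) where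
  le hu := mul_letter_le_of_descent hk hu hv
  invol {u} _ := letter_mul_cancel_right hk u
  adj {u} _ := length_mul_letter hk u
  up _ hu := le_mul_letter hk (by omega)
  special {u w} huw _ hl hne := by
    show u * k ≼ w * k
    rcases length_mul_letter (cs := cs) hk w with hw | hw
    · exact mul_letter_mono hk huw (by omega)
    · rcases length_mul_letter (cs := cs) hk u with hu | hu
      · have h1 := strip_right hk huw (by omega)
        have h2 := eq_of_bruhatLE_of_length h1 (by omega)
        exact absurd (by rw [h2, letter_mul_cancel_right hk]) hne
      · exact strip_both_right hk huw (by omega)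

variable {B' W' : Type*} [Group W'] {M' : CoxeterMatrix B'} {cs' : CoxeterSystem M' W'}

variable (cs cs') in
/-- `ψ` restricts to an isomorphism of posets from `[1, v]` to `[1, v']`. -/
structure LowerIso (v : W) (v' : W')
    (ψ : W → W') : Prop where
  apply : ψ v = v'
  le_iff : ∀ {x y}, x ≼ v → y ≼ v → (x ≼ y ↔ bruhatLE cs' (ψ x) (ψ y))
  surj : ∀ {z}, bruhatLE cs' z v' → ∃ x, x ≼ v ∧ ψ x = z

namespace LowerIso

variable {v' : W'} {ψ : W → W'}

theorem inj (h : LowerIso cs cs' v v' ψ) {x y : W} (hx : x ≼ v) (hy : y ≼ v)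
    (hxy : ψ x = ψ y) : x = y :=
  bruhatLE_antisymm ((h.le_iff hx hy).2 (hxy ▸ bruhatLE_refl _))
    ((h.le_iff hy hx).2 (hxy ▸ bruhatLE_refl _))

theorem apply_le (h : LowerIso cs cs' v v' ψ) {x : W} (hx : x ≼ v) : bruhatLE cs' (ψ x) v' :=
  h.apply ▸ (h.le_iff hx (bruhatLE_refl _)).1 hx

theorem restrict (h : LowerIso cs cs' v v' ψ) {y : W} (hy : y ≼ v) :
    LowerIso cs cs' y (ψ y) ψ where
  apply := rfl
  le_iff hx hz := h.le_iff (hx.trans hy) (hz.trans hy)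
  surj {z} hz := by
    obtain ⟨x, hx, rfl⟩ := h.surj (hz.trans (h.apply_le hy))
    exact ⟨x, (h.le_iff hx hy).2 hz, rfl⟩

theorem map_one (h : LowerIso cs cs' v v' ψ) : ψ 1 = 1 := by
  obtain ⟨x, hx, hx1⟩ := h.surj (one_bruhatLE v')
  have h1 := (h.le_iff (one_bruhatLE v) hx).1 (one_bruhatLE x)
  rw [hx1] at h1
  exact bruhatLE_antisymm h1 (one_bruhatLE _)

theorem bCov_apply (h : LowerIso cs cs' v v' ψ) {x y : W} (hy : y ≼ v) (hxy : bCov cs x y) :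
    bCov cs' (ψ x) (ψ y) := by
  have hx := hxy.1.trans hy
  refine ⟨(h.le_iff hx hy).1 hxy.1, fun h1 => hxy.2.1 (h.inj hx hy h1), fun z hz1 hz2 => ?_⟩
  obtain ⟨z, hz, rfl⟩ := h.surj (hz2.trans (h.apply_le hy))
  exact (hxy.2.2 z ((h.le_iff hx hz).2 hz1) ((h.le_iff hz hy).2 hz2)).imp
    (congrArg ψ) (congrArg ψ)

theorem length_apply (h : LowerIso cs cs' v v' ψ) {x : W} (hx : x ≼ v) :
    cs'.length (ψ x) = ℓ x := by
  induction hn : ℓ x generalizing x with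
  | zero =>
    rw [eq_one_of_length hn, h.map_one, cs'.length_one]
  | succ n ih =>
    have hne : 1 ≠ x := by
      rintro rfl
      simp at hn
    obtain ⟨z, -, hz, hl⟩ := exists_coatom_ge (one_bruhatLE (cs := cs) x) hne
    have h1 := (bCov_iff.1 (h.bCov_apply hx (bCov_iff.2 ⟨hz, hl.symm⟩))).2
    rw [h1, ih (hz.trans hx) (by omega)]

theorem sm (h : LowerIso cs cs' v v' ψ) {φ' : W' → W'} (hφ : cs'.SM v' φ') {χ : W' → W}
    (hχ : ∀ z, bruhatLE cs' z v' → χ z ≼ v ∧ ψ (χ z) = z) : cs.SM v (fun u => χ (φ' (ψ u))) where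
  le hu := (hχ _ (hφ.le (h.apply_le hu))).1
  invol {u} hu := by
    have h1 := hχ _ (hφ.le (h.apply_le hu))
    have h2 := hφ.invol (h.apply_le hu)
    have h3 := hχ _ (h.apply_le hu)
    show χ (φ' (ψ (χ (φ' (ψ u))))) = u
    rw [h1.2, h2]
    exact h.inj h3.1 hu h3.2
  adj {u} hu := by
    have h1 := hχ _ (hφ.le (h.apply_le hu))
    rw [← h.length_apply hu, ← h.length_apply h1.1, h1.2]
    exact hφ.adj (h.apply_le hu)
  up {u} hu hl := by
    have h1 := hχ _ (hφ.le (h.apply_le hu))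
    rw [← h.length_apply hu, ← h.length_apply h1.1, h1.2] at hl
    rw [h.le_iff hu h1.1, h1.2]
    exact hφ.up (h.apply_le hu) hl
  special {u w} huw hw hl hne := by
    have hu := huw.trans hw
    have h1 := hχ _ (hφ.le (h.apply_le hu))
    have h2 := hχ _ (hφ.le (h.apply_le hw))
    rw [h.le_iff h1.1 h2.1, h1.2, h2.2]
    refine hφ.special ((h.le_iff hu hw).1 huw) (h.apply_le hw)
      (by rw [h.length_apply hu, h.length_apply hw, hl]) fun h3 => hne ?_
    exact h.inj h1.1 hw (h1.2.trans h3)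

variable {R : W → W → ℤ[X]} {R' : W' → W' → ℤ[X]}

theorem rPolynomial_eq (h : LowerIso cs cs' v v' ψ) (hR : RAxioms cs R) (hR' : RAxioms cs' R')
    {x y : W} (hx : x ≼ v) (hy : y ≼ v) : R x y = R' (ψ x) (ψ y) := by
  induction hn : ℓ y using Nat.strong_induction_on generalizing x y with
  | _ n ih =>
    subst hn
    by_cases hxy : x ≼ y
    swap
    · rw [hR.eq_zero hxy, hR'.eq_zero fun h1 => hxy ((h.le_iff hx hy).2 h1)]
    by_cases hy1 : ψ y = 1
    · obtain rfl : y = 1 := h.inj hy (one_bruhatLE v) (hy1.trans h.map_one.symm)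
      obtain rfl := bruhatLE_antisymm hxy (one_bruhatLE x)
      rw [hR.1, hR'.1]
    obtain ⟨k, hk, hky⟩ := exists_right_descent (cs := cs') hy1
    have hyy := h.restrict hy
    have hsurj : ∀ z, ∃ a, bruhatLE cs' z (ψ y) → a ≼ y ∧ ψ a = z := fun z => by
      by_cases hz : bruhatLE cs' z (ψ y)
      · exact (hyy.surj hz).imp fun _ ha _ => ha
      · exact ⟨1, fun h1 => absurd h1 hz⟩
    choose χ hχ using hsurj
    have hρ := SM.mul_right hk hky
    have hφ := hyy.sm hρ hχ
    have key : ∀ u, u ≼ y → χ (ψ u * k) ≼ y ∧ ψ (χ (ψ u * k)) = ψ u * k :=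
      fun u hu => hχ _ (hρ.le (hyy.apply_le hu))
    have hyr := bruhatLE_refl (cs := cs) y
    have hlen : ∀ u, u ≼ y → ℓ (χ (ψ u * k)) = cs'.length (ψ u * k) :=
      fun u hu => by rw [← hyy.length_apply (key u hu).1, (key u hu).2]
    have hdesc : ℓ (χ (ψ y * k)) < ℓ y := by
      rw [hlen y hyr, ← h.length_apply hy]
      exact hky
    have hc := hφ.calc_apply hR hdesc x hxy
    have ih' : ∀ u, u ≼ y → R u (χ (ψ y * k)) = R' (ψ u) (ψ y * k) := fun u hu => by
      rw [ih _ hdesc (hu.trans hy) ((key y hyr).1.trans hy) rfl, (key y hyr).2]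
    have hlx := h.length_apply hx
    have hcancel := letter_mul_cancel_right (cs := cs') hk
    rcases length_mul_letter (cs := cs') hk (ψ x) with hl | hl
    · rw [hc.2 (show ℓ x < ℓ (χ (ψ x * k)) by rw [hlen x hxy]; omega), ih' x hxy,
        ih' _ (key x hxy).1, (key x hxy).2]
      have := (hR'.right hk (x := ψ x) (y := ψ y * k) (by omega) (by rwa [hcancel])).2
      rw [hcancel] at this
      exact this.symm
    · rw [hc.1 (show ℓ (χ (ψ x * k)) < ℓ x by rw [hlen x hxy]; omega), ih' _ (key x hxy).1,
        (key x hxy).2]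
      have := (hR'.right hk (x := ψ x * k) (y := ψ y * k) (by rw [hcancel]; omega)
        (by rwa [hcancel])).1
      rw [hcancel, hcancel] at this
      exact this.symm

end LowerIso

end

end
end CoxeterSystem

open LaurentPolynomial in
theorem Polynomial.aeval_T_neg_one (p : ℤ[X]) :
    aeval (T (R := ℤ) (-1)) p = invert (toLaurent p) := by
  induction p using Polynomial.induction_on' with
  | add p q hp hq => simp only [map_add, hp, hq]
  | monomial n a =>
    rw [← C_mul_X_pow_eq_monomial]
    simp [T_pow]

theorem Polynomial.coeff_toLaurent_natCast (p : ℤ[X]) (n : ℕ) :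
    (toLaurent p).coeff (n : ℤ) = p.coeff n := by
  rw [LaurentPolynomial.coeff_toLaurent]
  exact Finsupp.mapDomain_apply Nat.castEmbedding.injective _ _

open LaurentPolynomial in
theorem Polynomial.eq_zero_of_T_mul_aeval {p : ℤ[X]} {l : ℕ} (hp : 2 * p.natDegree < l)
    (h : T (R := ℤ) (l : ℤ) * aeval (T (R := ℤ) (-1)) p = toLaurent p) : p = 0 := by
  rw [aeval_T_neg_one] at h
  have h1 := congrArg (fun f => f.coeff ((l - p.natDegree : ℕ) : ℤ)) h
  simp only [T, AddMonoidAlgebra.coeff_single_mul_apply, one_mul, invert_apply] at h1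
  rw [show -(-(l : ℤ) + ((l - p.natDegree : ℕ) : ℤ)) = (p.natDegree : ℤ) by omega,
    coeff_toLaurent_natCast, coeff_toLaurent_natCast,
    coeff_eq_zero_of_natDegree_lt (n := l - p.natDegree) (by omega)] at h1
  exact leadingCoeff_eq_zero.1 h1

namespace CoxeterSystem
section
variable {B W B' W' : Type*} [Group W] [Group W'] {M : CoxeterMatrix B} {M' : CoxeterMatrix B'}
  {cs : CoxeterSystem M W} {cs' : CoxeterSystem M' W'} {v : W} {v' : W'} {ψ : W → W'}
  {R P : W → W → ℤ[X]} {R' P' : W' → W' → ℤ[X]}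

open Classical in
theorem _root_.KLAxioms.T_mul_aeval_eq
    {hfin : ∀ u w : W, {z : W | bruhatLE cs u z ∧ bruhatLE cs z w}.Finite}
    (hR : RAxioms cs R) (hP : KLAxioms cs hfin R P) {x w : W} (hxw : bruhatLE cs x w) :
    LaurentPolynomial.T (R := ℤ) ((cs.length w - cs.length x : ℕ) : ℤ) *
        aeval (LaurentPolynomial.T (R := ℤ) (-1)) (P x w) =
      toLaurent (P x w) +
        ∑ z ∈ (hfin x w).toFinset.filter (· ≠ x), toLaurent (R x z) * toLaurent (P z w) := by
  rw [hP.2.2.2 x w hxw, Finset.filter_ne']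
  have hx : x ∈ (hfin x w).toFinset := by simpa using ⟨bruhatLE_refl x, hxw⟩
  rw [← Finset.add_sum_erase _ _ hx, hR.1]
  simp

theorem LowerIso.klPolynomial_eq
    {hfin : ∀ u w : W, {z : W | bruhatLE cs u z ∧ bruhatLE cs z w}.Finite}
    {hfin' : ∀ u w : W', {z : W' | bruhatLE cs' u z ∧ bruhatLE cs' z w}.Finite}
    (h : LowerIso cs cs' v v' ψ) (hR : RAxioms cs R) (hR' : RAxioms cs' R')
    (hP : KLAxioms cs hfin R P) (hP' : KLAxioms cs' hfin' R' P') {x w : W}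
    (hx : bruhatLE cs x v) (hw : bruhatLE cs w v) : P x w = P' (ψ x) (ψ w) := by
  classical
  induction hn : cs.length w - cs.length x using Nat.strong_induction_on generalizing x with
  | _ n ih =>
    by_cases hxw : bruhatLE cs x w
    swap
    · rw [hP.2.1 x w hxw, hP'.2.1 _ _ fun h1 => hxw ((h.le_iff hx hw).2 h1)]
    by_cases hne : x = w
    · rw [hne, hP.1, hP'.1]
    have hne' : ψ x ≠ ψ w := fun h1 => hne (h.inj hx hw h1)
    have hxw' := (h.le_iff hx hw).1 hxw
    have hd := hP.2.2.1 x w hxw hne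
    have hd' := hP'.2.2.1 _ _ hxw' hne'
    have e := hP.T_mul_aeval_eq hR hxw
    have e' := hP'.T_mul_aeval_eq hR' hxw'
    rw [h.length_apply hx, h.length_apply hw] at hd' e'
    have hsum : ∑ z ∈ (hfin x w).toFinset.filter (· ≠ x), toLaurent (R x z) * toLaurent (P z w) =
        ∑ z ∈ (hfin' (ψ x) (ψ w)).toFinset.filter (· ≠ ψ x),
          toLaurent (R' (ψ x) z) * toLaurent (P' z (ψ w)) := by
      refine Finset.sum_bij (fun z _ => ψ z) ?_ ?_ ?_ ?_
      · intro z hz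
        simp only [Finset.mem_filter, Set.Finite.mem_toFinset, Set.mem_ofPred_eq] at hz ⊢
        have hzv := hz.1.2.trans hw
        exact ⟨⟨(h.le_iff hx hzv).1 hz.1.1, (h.le_iff hzv hw).1 hz.1.2⟩,
          fun h1 => hz.2 (h.inj hzv hx h1)⟩
      · intro z hz y hy hzy
        simp only [Finset.mem_filter, Set.Finite.mem_toFinset, Set.mem_ofPred_eq] at hz hy
        exact h.inj (hz.1.2.trans hw) (hy.1.2.trans hw) hzy
      · intro z hz
        simp only [Finset.mem_filter, Set.Finite.mem_toFinset, Set.mem_ofPred_eq] at hz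
        obtain ⟨z, hzv, rfl⟩ := h.surj (hz.1.2.trans (h.apply_le hw))
        refine ⟨z, ?_, rfl⟩
        simp only [Finset.mem_filter, Set.Finite.mem_toFinset, Set.mem_ofPred_eq]
        exact ⟨⟨(h.le_iff hx hzv).2 hz.1.1, (h.le_iff hzv hw).2 hz.1.2⟩,
          fun h1 => hz.2 (congrArg ψ h1)⟩
      · intro z hz
        simp only [Finset.mem_filter, Set.Finite.mem_toFinset, Set.mem_ofPred_eq] at hz
        have hzv := hz.1.2.trans hw
        have h1 := length_lt_of_bruhatLE hz.1.1 (Ne.symm hz.2)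
        have h2 := length_le_of_bruhatLE hz.1.2
        rw [h.rPolynomial_eq hR hR' hx hzv, ih _ (by omega) hzv rfl]
    have hl : 2 * (P x w - P' (ψ x) (ψ w)).natDegree < cs.length w - cs.length x := by
      have := natDegree_sub_le (P x w) (P' (ψ x) (ψ w))
      omega
    refine sub_eq_zero.1 (eq_zero_of_T_mul_aeval hl ?_)
    rw [map_sub, map_sub, mul_sub, e, e', hsum]
    ring

end
end CoxeterSystem

/-- combinatorial invariance for lower Bruhat intervals: a poset
isomorphism `ψ : [e,v] → [e,v']` between lower Bruhat intervals of two Coxeter groups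
preserves the Kazhdan–Lusztig polynomials and the `R`-polynomials. -/
theorem stmt19 {B B' : Type*} {W W' : Type*} [Group W] [Group W']
    {M : CoxeterMatrix B} {M' : CoxeterMatrix B'}
    (cs : CoxeterSystem M W) (cs' : CoxeterSystem M' W')
    (hfin : ∀ u w : W, {z : W | bruhatLE cs u z ∧ bruhatLE cs z w}.Finite)
    (hfin' : ∀ u w : W', {z : W' | bruhatLE cs' u z ∧ bruhatLE cs' z w}.Finite)
    (R : W → W → Polynomial ℤ) (hR : RAxioms cs R)
    (R' : W' → W' → Polynomial ℤ) (hR' : RAxioms cs' R')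
    (P : W → W → Polynomial ℤ) (hP : KLAxioms cs hfin R P)
    (P' : W' → W' → Polynomial ℤ) (hP' : KLAxioms cs' hfin' R' P')
    (v : W) (v' : W') (ψ : W → W') (hψv : ψ v = v')
    (hiso : ∀ x y : W, bruhatLE cs x v → bruhatLE cs y v →
      (bruhatLE cs x y ↔ bruhatLE cs' (ψ x) (ψ y)))
    (hsurj : ∀ z' : W', bruhatLE cs' z' v' →
      ∃ x : W, bruhatLE cs x v ∧ ψ x = z')
    (hinj : ∀ x y : W, bruhatLE cs x v → bruhatLE cs y v → ψ x = ψ y → x = y) :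
    ∀ x y : W, bruhatLE cs x v → bruhatLE cs y v →
      P x y = P' (ψ x) (ψ y) ∧ R x y = R' (ψ x) (ψ y) := by
  have h : LowerIso cs cs' v v' ψ := ⟨hψv, fun {x y} => hiso x y, fun {z} => hsurj z⟩
  exact fun x y hx hy => ⟨h.klPolynomial_eq hR hR' hP hP' hx hy, h.rPolynomial_eq hR hR' hx hy⟩
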